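/- arXiv:0809.1163 — 3 statements merged into one kernel-verified Lean document; each statement's English description precedes it below -/
import Mathlib

section
/- Let S = k[y_{i,j(i)} : 1 ≤ i ≤ n, 1 ≤ j(i) ≤ b_i] and let I_t(D) be the transversal monomial ideal generated by the t-minors of the matrix D(b_1,…,b_n) whose i-th row has entries y_{i,1},…,y_{i,b_i} in its block and zeros elsewhere. Then the q-th Betti number of I_t(D) equals Σ_{s=t}^{min(t+q,n)} binom(s−1, t−1) · Σ_{1≤i_1<⋯<i_s≤n} Σ_{r_1+⋯+r_s=t+q, r_v≥1} binom(b_{i_1}, r_1)⋯binom(b_{i_s}, r_s). -/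
/-- A minimal free resolution of an `S`-module `M` over a local-like pair `(S, 𝔪)`
(for us `S` is a polynomial ring and `𝔪` its irrelevant maximal ideal), recorded together
with its Betti numbers `β q`: an exact complex
`⋯ → S^{β(q+1)} → S^{β q} → ⋯ → S^{β 0} → M → 0`
all of whose differentials have image inside `𝔪` times the target. -/
structure MinimalFreeResolution (S : Type*) [CommRing S] (𝔪 : Ideal S)
    (M : Type*) [AddCommGroup M] [Module S M] where
  /-- the Betti numbers, i.e. the ranks of the free modules in the resolution -/
  β : ℕ → ℕ
  /-- the differentials of the resolution -/
  d : ∀ q : ℕ, ((Fin (β (q + 1)) →₀ S) →ₗ[S] (Fin (β q) →₀ S))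
  /-- the augmentation map onto `M` -/
  ε : (Fin (β 0) →₀ S) →ₗ[S] M
  surj : Function.Surjective ε
  exact_zero : LinearMap.ker ε = LinearMap.range (d 0)
  exact : ∀ q, LinearMap.ker (d q) = LinearMap.range (d (q + 1))
  minimal : ∀ q, LinearMap.range (d q) ≤ 𝔪 • (⊤ : Submodule S (Fin (β q) →₀ S))

universe u v
section Bet
variable {R : Type u} [CommRing R] {k : Type v} [Field k] (ε : R →+* k)

def MinMap {ι : Type} {M : Type u} [AddCommGroup M] [Module R M]
    (f : (ι → R) →ₗ[R] M) : Prop := ∀ z, f z = 0 → ∀ i, ε (z i) = 0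

def Bet : ℕ → ∀ (M : Type u) [AddCommGroup M] [Module R M], ℕ → Prop
  | 0, M, _, _, b => ∃ (ι : Type) (_ : Fintype ι) (f : (ι → R) →ₗ[R] M),
      Function.Surjective f ∧ MinMap ε f ∧ Fintype.card ι = b
  | q + 1, M, _, _, b => ∃ (ι : Type) (_ : Fintype ι) (f : (ι → R) →ₗ[R] M),
      Function.Surjective f ∧ MinMap ε f ∧ Bet q (LinearMap.ker f) b

variable {ε}

theorem Bet.congr {q : ℕ} {M M' : Type u} [AddCommGroup M] [Module R M] [AddCommGroup M']
    [Module R M'] {b : ℕ} (h : Bet ε q M b) (e : M ≃ₗ[R] M') : Bet ε q M' b := by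
  cases q with
  | zero =>
    obtain ⟨ι, hι, f, hs, hm, hb⟩ := h
    refine ⟨ι, hι, e.toLinearMap ∘ₗ f, e.surjective.comp hs, ?_, hb⟩
    intro z hz
    exact hm z (by simpa using hz)
  | succ q =>
    obtain ⟨ι, hι, f, hs, hm, hb⟩ := h
    refine ⟨ι, hι, e.toLinearMap ∘ₗ f, e.surjective.comp hs, ?_, ?_⟩
    · intro z hz
      exact hm z (by simpa using hz)
    · have : LinearMap.ker (e.toLinearMap ∘ₗ f) = LinearMap.ker f := by
        ext z; simp
      rw [this]; exact hb

theorem Bet.prod {q : ℕ} {M : Type u} [AddCommGroup M] [Module R M] {b : ℕ} (h : Bet ε q M b)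
    (κ : Type) [Fintype κ] : Bet ε q (M × (κ → R)) (b + if q = 0 then Fintype.card κ else 0) := by
  have key : ∀ {ι : Type} [Fintype ι] (f : (ι → R) →ₗ[R] M), Function.Surjective f → MinMap ε f →
      ∃ g : (ι ⊕ κ → R) →ₗ[R] (M × (κ → R)), Function.Surjective g ∧ MinMap ε g ∧
        Nonempty (LinearMap.ker f ≃ₗ[R] LinearMap.ker g) := by
    intro ι _ f hs hm
    refine ⟨(f ∘ₗ LinearMap.funLeft R R Sum.inl).prod (LinearMap.funLeft R R Sum.inr), ?_, ?_, ?_⟩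
    · rintro ⟨m, y⟩
      obtain ⟨x, rfl⟩ := hs m
      exact ⟨Sum.elim x y, rfl⟩
    · intro z hz i
      replace hz : f (z ∘ Sum.inl) = 0 ∧ z ∘ Sum.inr = 0 :=
        ⟨congrArg Prod.fst hz, congrArg Prod.snd hz⟩
      rcases i with i | i
      · exact hm _ hz.1 i
      · have := congrFun hz.2 i
        simp only [Function.comp_apply, Pi.zero_apply] at this
        simp [this]
    · refine ⟨LinearEquiv.ofBijective
        (((LinearMap.funLeft R R (Sum.elim some (fun _ : κ => none)) ∘ₗ
          (LinearMap.pi (fun o : Option ι => o.elim 0 (fun i => LinearMap.proj i)) : (ι → R) →ₗ[R] (Option ι → R)))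
          ∘ₗ (LinearMap.ker f).subtype).codRestrict _ ?_) ⟨?_, ?_⟩⟩
      · rintro ⟨z, hz⟩
        have hz' : f z = 0 := hz
        refine Prod.ext ?_ ?_
        · exact hz'
        · ext i; rfl
      · rintro ⟨z, hz⟩ ⟨w, hw⟩ h
        have h' := congrArg Subtype.val h
        ext i
        exact congrFun h' (Sum.inl i)
      · rintro ⟨z, hz⟩
        have hz' : f (z ∘ Sum.inl) = 0 ∧ z ∘ Sum.inr = 0 :=
          ⟨congrArg Prod.fst hz, congrArg Prod.snd hz⟩
        refine ⟨⟨fun i => z (Sum.inl i), hz'.1⟩, ?_⟩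
        ext i
        rcases i with i | i
        · rfl
        · exact (congrFun hz'.2 i).symm
  cases q with
  | zero =>
    obtain ⟨ι, hι, f, hs, hm, hb⟩ := h
    obtain ⟨g, h1, h2, -⟩ := key f hs hm
    exact ⟨ι ⊕ κ, inferInstance, g, h1, h2, by simp [hb]⟩
  | succ q =>
    obtain ⟨ι, hι, f, hs, hm, hb⟩ := h
    obtain ⟨g, h1, h2, ⟨e⟩⟩ := key f hs hm
    exact ⟨ι ⊕ κ, inferInstance, g, h1, h2, by simpa using hb.congr e⟩

theorem card_le_of_minMap (hε : Function.Surjective ε) {ι κ : Type} [Fintype ι] [Fintype κ]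
    {M M' : Type u} [AddCommGroup M] [Module R M] [AddCommGroup M']
    [Module R M'] (e : M' ≃ₗ[R] M) (f : (ι → R) →ₗ[R] M) (g : (κ → R) →ₗ[R] M')
    (hf : Function.Surjective f) (hg : Function.Surjective g) (hm : MinMap ε f) :
    Fintype.card ι ≤ Fintype.card κ := by
  classical
  obtain ⟨φ, hφ⟩ := Module.projective_lifting_property f (e.toLinearMap ∘ₗ g) hf
  have hsur : Function.Surjective (((LinearMap.toMatrix' φ).map ε).mulVecLin) := by
    intro w
    choose s hs using hε
    obtain ⟨y, hy⟩ := hg (e.symm (f (s ∘ w)))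
    refine ⟨ε ∘ y, ?_⟩
    have h1 : f (φ y - s ∘ w) = 0 := by
      have := LinearMap.congr_fun hφ y
      simp only [LinearMap.comp_apply] at this
      rw [map_sub, this, LinearEquiv.coe_coe, hy]; simp
    ext i
    have h2 := hm _ h1 i
    rw [Pi.sub_apply, map_sub, sub_eq_zero, Function.comp_apply, hs] at h2
    rw [← h2, Matrix.mulVecLin_apply, ← LinearMap.toMatrix'_mulVec φ y, RingHom.map_mulVec]
  have := LinearMap.finrank_le_finrank_of_surjective hsur
  simpa using this

theorem schanuel {P Q M M' : Type u} [AddCommGroup P] [Module R P] [AddCommGroup Q] [Module R Q]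
    [AddCommGroup M] [Module R M] [AddCommGroup M'] [Module R M'] [Module.Projective R P]
    [Module.Projective R Q] (e : M ≃ₗ[R] M') (f : P →ₗ[R] M) (g : Q →ₗ[R] M')
    (hf : Function.Surjective f) (hg : Function.Surjective g) :
    Nonempty ((LinearMap.ker f × Q) ≃ₗ[R] (LinearMap.ker g × P)) := by
  obtain ⟨φ, hφ⟩ := Module.projective_lifting_property g (e.toLinearMap ∘ₗ f) hg
  obtain ⟨ψ, hψ⟩ := Module.projective_lifting_property f (e.symm.toLinearMap ∘ₗ g) hf
  have hφ' : ∀ x, g (φ x) = e (f x) := fun x => LinearMap.congr_fun hφ x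
  have hψ' : ∀ x, f (ψ x) = e.symm (g x) := fun x => LinearMap.congr_fun hψ x
  have m1 : ∀ x : LinearMap.ker f × Q, x.2 - φ (x.1 + ψ x.2) ∈ LinearMap.ker g := by
    intro x
    have := x.1.2
    rw [LinearMap.mem_ker] at this ⊢
    simp [hφ', hψ', this]
  have m2 : ∀ x : LinearMap.ker g × P, x.2 - ψ (x.1 + φ x.2) ∈ LinearMap.ker f := by
    intro x
    have := x.1.2
    rw [LinearMap.mem_ker] at this ⊢
    simp [hφ', hψ', this]
  refine ⟨{ toFun := fun x => (⟨_, m1 x⟩, x.1 + ψ x.2)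
            invFun := fun x => (⟨_, m2 x⟩, x.1 + φ x.2)
            map_add' := ?_, map_smul' := ?_, left_inv := ?_, right_inv := ?_ }⟩
  · intro x y
    ext <;> simp <;> abel
  · intro c x
    ext <;> simp [smul_sub]
  · intro x
    ext <;> simp
  · intro x
    ext <;> simp

theorem Bet.unique (hε : Function.Surjective ε) {q : ℕ} : ∀ {M M' : Type u} [AddCommGroup M]
    [Module R M] [AddCommGroup M'] [Module R M'] {b b' : ℕ} (_ : M ≃ₗ[R] M') (_ : Bet ε q M b)
    (_ : Bet ε q M' b'), b = b' := by
  induction q with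
  | zero =>
    intro M M' _ _ _ _ b b' e h h'
    obtain ⟨ι, hι, f, hs, hm, hb⟩ := h
    obtain ⟨ι', hι', f', hs', hm', hb'⟩ := h'
    rw [← hb, ← hb']
    exact le_antisymm (card_le_of_minMap hε e.symm f f' hs hs' hm)
      (card_le_of_minMap hε e f' f hs' hs hm')
  | succ q ih =>
    intro M M' _ _ _ _ b b' e h h'
    obtain ⟨ι, hι, f, hs, hm, hb⟩ := h
    obtain ⟨ι', hι', f', hs', hm', hb'⟩ := h'
    have hc : Fintype.card ι = Fintype.card ι' :=
      le_antisymm (card_le_of_minMap hε e.symm f f' hs hs' hm)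
      (card_le_of_minMap hε e f' f hs' hs hm')
    obtain ⟨E⟩ := schanuel e f f' hs hs'
    have := ih E (hb.prod ι') (hb'.prod ι)
    rw [hc] at this
    omega
end Bet
section Lin
open MvPolynomial
variable {k : Type u} [Field k] {σ : Type}

/-- coordinatewise homogeneous component -/
noncomputable def Hc {κ : Type} (d : ℕ) (z : κ → MvPolynomial σ k) : κ → MvPolynomial σ k :=
  fun i => homogeneousComponent d (z i)

theorem homogeneousComponent_mul_of_isHomogeneous (d e : ℕ) (z u : MvPolynomial σ k)
    (hu : u.IsHomogeneous e) :
    homogeneousComponent (d + e) (z * u) = homogeneousComponent d z * u := by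
  conv_lhs => rw [← sum_homogeneousComponent z, Finset.sum_mul, map_sum]
  rw [Finset.sum_congr rfl (g := fun i => if i = d then homogeneousComponent d z * u else 0)]
  · rw [Finset.sum_ite_eq']
    split_ifs with h
    · rfl
    · rw [homogeneousComponent_eq_zero, zero_mul]
      simpa using h
  · intro i _
    rw [homogeneousComponent_of_mem (((homogeneousComponent_isHomogeneous i z).mul hu))]
    by_cases h : i = d
    · subst h; simp
    · rw [if_neg h, if_neg (by omega)]

@[simp] theorem Hc_apply {κ : Type} (d : ℕ) (z : κ → MvPolynomial σ k) (i : κ) :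
    Hc d z i = homogeneousComponent d (z i) := rfl

theorem Hc_add {κ : Type} (d : ℕ) (z w : κ → MvPolynomial σ k) : Hc d (z + w) = Hc d z + Hc d w := by
  ext1 i; simp

@[simp] theorem Hc_zero' {κ : Type} (d : ℕ) : Hc d (0 : κ → MvPolynomial σ k) = 0 := by
  ext1 i; simp

/-- a map homogeneous of degree `e` -/
def HomDeg {ι κ : Type} (e : ℕ) (f : (ι → MvPolynomial σ k) →ₗ[MvPolynomial σ k]
    (κ → MvPolynomial σ k)) : Prop := ∀ d z, f (Hc d z) = Hc (d + e) (f z)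

def GrSub {κ : Type} (N : Submodule (MvPolynomial σ k) (κ → MvPolynomial σ k)) : Prop :=
  ∀ d, ∀ z ∈ N, Hc d z ∈ N

theorem HomDeg.ker {ι κ : Type} {e : ℕ} {f : (ι → MvPolynomial σ k) →ₗ[MvPolynomial σ k]
    (κ → MvPolynomial σ k)} (hf : HomDeg e f) : GrSub (LinearMap.ker f) := by
  intro d z hz
  rw [LinearMap.mem_ker] at hz ⊢
  rw [hf, hz, Hc_zero']

theorem homDeg_linearCombination {ι κ : Type} [Fintype ι] (e : ℕ)
    (u : ι → κ → MvPolynomial σ k) (hu : ∀ i j, (u i j).IsHomogeneous e) :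
    HomDeg e (Fintype.linearCombination (MvPolynomial σ k) u) := by
  intro d z
  ext1 j
  simp only [Fintype.linearCombination_apply, Finset.sum_apply, Pi.smul_apply, smul_eq_mul,
    Hc_apply, map_sum]
  exact Finset.sum_congr rfl fun i _ =>
    (homogeneousComponent_mul_of_isHomogeneous d e _ _ (hu i j)).symm

def Lin : ℕ → ∀ {κ : Type}, Submodule (MvPolynomial σ k) (κ → MvPolynomial σ k) → ℕ → Prop
  | 0, κ, N, b => ∃ (ι : Type) (_ : Fintype ι)
      (f : (ι → MvPolynomial σ k) →ₗ[MvPolynomial σ k] (κ → MvPolynomial σ k)),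
      LinearMap.range f = N ∧ MinMap constantCoeff f ∧ HomDeg 1 f ∧ Fintype.card ι = b
  | q + 1, κ, N, b => ∃ (ι : Type) (_ : Fintype ι)
      (f : (ι → MvPolynomial σ k) →ₗ[MvPolynomial σ k] (κ → MvPolynomial σ k)),
      LinearMap.range f = N ∧ MinMap constantCoeff f ∧ HomDeg 1 f ∧ Lin q (LinearMap.ker f) b

theorem Lin.bet {q : ℕ} : ∀ {κ : Type} {N : Submodule (MvPolynomial σ k) (κ → MvPolynomial σ k)}
    {b : ℕ}, Lin q N b → Bet (constantCoeff : MvPolynomial σ k →+* k) q N b := by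
  induction q with
  | zero =>
    rintro κ _ b ⟨ι, hι, f, rfl, hm, -, hc⟩
    refine ⟨ι, hι, f.rangeRestrict, f.surjective_rangeRestrict, ?_, hc⟩
    intro z hz
    exact hm z (congrArg Subtype.val hz)
  | succ q ih =>
    rintro κ _ b ⟨ι, hι, f, rfl, hm, -, hc⟩
    refine ⟨ι, hι, f.rangeRestrict, f.surjective_rangeRestrict, ?_, ?_⟩
    · intro z hz
      exact hm z (congrArg Subtype.val hz)
    · rw [LinearMap.ker_rangeRestrict]; exact ih hc

theorem Hc_zero_eq {κ : Type} (z : κ → MvPolynomial σ k) (i : κ) :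
    Hc 0 z i = C (constantCoeff (z i)) := by
  simp [homogeneousComponent_zero, constantCoeff_eq]

/-- extension by zero -/
def extL (R : Type*) [CommRing R] (α γ : Type) : (α → R) →ₗ[R] (α ⊕ γ → R) where
  toFun z := Sum.elim z 0
  map_add' x y := by ext i; rcases i with i | i <;> simp
  map_smul' x y := by ext i; rcases i with i | i <;> simp

theorem horseshoe_step {ι κ l α γ : Type} [Fintype α] [Fintype γ]
    {B : Submodule (MvPolynomial σ k) (κ → MvPolynomial σ k)}
    (i : (ι → MvPolynomial σ k) →ₗ[MvPolynomial σ k] (κ → MvPolynomial σ k))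
    (p : (κ → MvPolynomial σ k) →ₗ[MvPolynomial σ k] (l → MvPolynomial σ k))
    (hi : Function.Injective i) (hid : HomDeg 0 i) (hpd : HomDeg 0 p) (hB : GrSub B)
    (fA : (α → MvPolynomial σ k) →ₗ[MvPolynomial σ k] (ι → MvPolynomial σ k))
    (fC : (γ → MvPolynomial σ k) →ₗ[MvPolynomial σ k] (l → MvPolynomial σ k))
    (hA : (LinearMap.range fA).map i = B ⊓ LinearMap.ker p)
    (hC : B.map p = LinearMap.range fC)
    (mA : MinMap constantCoeff fA) (mC : MinMap constantCoeff fC)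
    (dA : HomDeg 1 fA) (dC : HomDeg 1 fC) :
    ∃ fB : (α ⊕ γ → MvPolynomial σ k) →ₗ[MvPolynomial σ k] (κ → MvPolynomial σ k),
      LinearMap.range fB = B ∧ MinMap constantCoeff fB ∧ HomDeg 1 fB ∧
      (LinearMap.ker fA).map (extL _ α γ) = LinearMap.ker fB ⊓
        LinearMap.ker (LinearMap.funLeft (MvPolynomial σ k) (MvPolynomial σ k) (Sum.inr : γ → α ⊕ γ)) ∧
      (LinearMap.ker fB).map (LinearMap.funLeft (MvPolynomial σ k) (MvPolynomial σ k)
        (Sum.inr : γ → α ⊕ γ)) = LinearMap.ker fC := by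
  classical
  have h1 : ∀ c : γ, ∃ u ∈ B, p u = fC (Pi.single c 1) ∧ ∀ j, (u j).IsHomogeneous 1 := by
    intro c
    have : fC (Pi.single c 1) ∈ B.map p := by rw [hC]; exact ⟨_, rfl⟩
    obtain ⟨u, hu, hpu⟩ := this
    refine ⟨Hc 1 u, hB 1 u hu, ?_, fun j => homogeneousComponent_isHomogeneous _ _⟩
    have e1 := hpd 1 u
    have e2 := dC 0 (Pi.single c 1)
    rw [hpu] at e1
    rw [e1]
    have : Hc 0 (Pi.single c 1 : γ → MvPolynomial σ k) = Pi.single c 1 := by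
      ext1 j
      rw [Hc_zero_eq]
      by_cases h : j = c
      · subst h; simp
      · simp [h]
    rw [this] at e2
    exact e2.symm
  choose u huB hpu hu using h1
  let g := Fintype.linearCombination (MvPolynomial σ k) u
  have hg : HomDeg 1 g := homDeg_linearCombination 1 u hu
  have hpg : ∀ v, p (g v) = fC v := by
    intro v
    conv_rhs => rw [← Finset.univ_sum_single v]
    simp only [g, Fintype.linearCombination_apply, map_sum, map_smul, hpu]
    refine Finset.sum_congr rfl fun c _ => ?_
    rw [← map_smul, ← Pi.single_smul]; simp
  have hgB : ∀ v, g v ∈ B := by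
    intro v
    simp only [g, Fintype.linearCombination_apply]
    exact B.sum_mem fun c _ => B.smul_mem _ (huB c)
  have hAB : ∀ x, i (fA x) ∈ B ∧ p (i (fA x)) = 0 := by
    intro x
    have : i (fA x) ∈ B ⊓ LinearMap.ker p := by
      rw [← hA]; exact ⟨_, ⟨x, rfl⟩, rfl⟩
    exact this
  have hBA : ∀ y ∈ B, p y = 0 → ∃ x, i (fA x) = y := by
    intro y hy hp
    have : y ∈ (LinearMap.range fA).map i := by rw [hA]; exact ⟨hy, hp⟩
    obtain ⟨_, ⟨x, rfl⟩, h⟩ := this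
    exact ⟨x, h⟩
  let fB : (α ⊕ γ → MvPolynomial σ k) →ₗ[MvPolynomial σ k] (κ → MvPolynomial σ k) :=
    i ∘ₗ fA ∘ₗ LinearMap.funLeft _ _ Sum.inl + g ∘ₗ LinearMap.funLeft _ _ Sum.inr
  have hfB : ∀ z, fB z = i (fA (z ∘ Sum.inl)) + g (z ∘ Sum.inr) := fun z => rfl
  have hpB : ∀ z, p (fB z) = fC (z ∘ Sum.inr) := by
    intro z; rw [hfB, map_add, (hAB _).2, hpg, zero_add]
  have dB : HomDeg 1 fB := by
    intro d z
    rw [hfB, hfB, Hc_add, ← hg, ← hid, ← dA]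
    rfl
  refine ⟨fB, ?_, ?_, dB, ?_, ?_⟩
  · apply le_antisymm
    · rintro _ ⟨z, rfl⟩
      exact B.add_mem (hAB _).1 (hgB _)
    · intro y hy
      have : p y ∈ LinearMap.range fC := by rw [← hC]; exact ⟨y, hy, rfl⟩
      obtain ⟨v, hv⟩ := this
      obtain ⟨x, hx⟩ := hBA (y - g v) (B.sub_mem hy (hgB v)) (by rw [map_sub, hpg, hv, sub_self])
      refine ⟨Sum.elim x v, ?_⟩
      rw [hfB, Sum.elim_comp_inl, Sum.elim_comp_inr, hx]; simp
  · intro z hz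
    have hv : fC (z ∘ Sum.inr) = 0 := by rw [← hpB, hz, map_zero]
    have hcv := mC _ hv
    have h0 : fB (Hc 0 z) = 0 := by rw [dB, hz, Hc_zero']
    have h0v : Hc 0 z ∘ Sum.inr = 0 := by
      ext1 j
      have := hcv j
      simp only [Function.comp_apply] at this
      simp only [Function.comp_apply, Hc_zero_eq, this]; simp
    rw [hfB, h0v, map_zero, add_zero] at h0
    have h0u := mA _ (hi (h0.trans (map_zero i).symm))
    rintro (j | j)
    · have := h0u j
      simpa only [Function.comp_apply, Hc_zero_eq, constantCoeff_C] using this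
    · exact hcv j
  · ext z
    constructor
    · rintro ⟨x, hx, rfl⟩
      have hx' : fA x = 0 := hx
      refine ⟨?_, rfl⟩
      change fB (Sum.elim x 0) = 0
      rw [hfB, Sum.elim_comp_inl, Sum.elim_comp_inr, hx']; simp
    · rintro ⟨h1, h2⟩
      have h1' : fB z = 0 := h1
      have h2' : z ∘ Sum.inr = 0 := h2
      rw [hfB, h2', map_zero, add_zero] at h1'
      refine ⟨z ∘ Sum.inl, hi (h1'.trans (map_zero i).symm), ?_⟩
      ext1 j
      rcases j with j | j
      · rfl
      · exact (congrFun h2' j).symm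
  · ext v
    constructor
    · rintro ⟨z, hz, rfl⟩
      have hz' : fB z = 0 := hz
      change fC (z ∘ Sum.inr) = 0
      rw [← hpB, hz', map_zero]
    · intro hv
      have hv' : fC v = 0 := hv
      obtain ⟨x, hx⟩ := hBA (g v) (hgB v) (by rw [hpg, hv'])
      refine ⟨Sum.elim (-x) v, ?_, rfl⟩
      change fB _ = 0
      rw [hfB, Sum.elim_comp_inl, Sum.elim_comp_inr, map_neg, map_neg, hx]; simp

theorem horseshoe {q : ℕ} : ∀ {ι κ l : Type}
    {A : Submodule (MvPolynomial σ k) (ι → MvPolynomial σ k)}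
    {B : Submodule (MvPolynomial σ k) (κ → MvPolynomial σ k)}
    {C : Submodule (MvPolynomial σ k) (l → MvPolynomial σ k)}
    (i : (ι → MvPolynomial σ k) →ₗ[MvPolynomial σ k] (κ → MvPolynomial σ k))
    (p : (κ → MvPolynomial σ k) →ₗ[MvPolynomial σ k] (l → MvPolynomial σ k))
    (_ : Function.Injective i) (_ : HomDeg 0 i) (_ : HomDeg 0 p) (_ : GrSub B)
    (_ : A.map i = B ⊓ LinearMap.ker p)
    (_ : B.map p = C) {a c : ℕ} (_ : Lin q A a) (_ : Lin q C c), Lin q B (a + c) := by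
  induction q with
  | zero =>
    rintro ι κ l _ B _ i p hi hid hpd hB hA hC a c ⟨α, hα, fA, rfl, mA, dA, cA⟩ ⟨γ, hγ, fC, rfl, mC, dC, cC⟩
    obtain ⟨fB, h1, h2, h3, -, -⟩ := horseshoe_step i p hi hid hpd hB fA fC hA hC mA mC dA dC
    exact ⟨α ⊕ γ, inferInstance, fB, h1, h2, h3, by simp [cA, cC]⟩
  | succ q ih =>
    rintro ι κ l _ B _ i p hi hid hpd hB hA hC a c ⟨α, hα, fA, rfl, mA, dA, cA⟩ ⟨γ, hγ, fC, rfl, mC, dC, cC⟩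
    obtain ⟨fB, h1, h2, h3, h4, h5⟩ := horseshoe_step i p hi hid hpd hB fA fC hA hC mA mC dA dC
    refine ⟨α ⊕ γ, inferInstance, fB, h1, h2, h3, ?_⟩
    refine ih _ _ ?_ ?_ ?_ h3.ker h4 h5 cA cC
    · intro x y hxy
      ext1 j
      exact congrFun hxy (Sum.inl j)
    · intro d z
      ext1 j
      rcases j with j | j
      · rfl
      · change 0 = homogeneousComponent _ 0
        simp
    · intro d z
      rfl
end Lin
section LQ
open MvPolynomial
variable {k : Type u} [Field k] {σ : Type}

theorem mem_span_image_fin {α : Type} (g : α → MvPolynomial σ k) (s : Finset α)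
    {c : MvPolynomial σ k} (h : c ∈ Ideal.span (g '' s)) :
    ∃ w : α → MvPolynomial σ k, ∑ x ∈ s, w x * g x = c := by
  classical
  obtain ⟨w, hw⟩ := (Submodule.mem_span_image_finset_iff_exists_fun _).1 h
  refine ⟨fun x => if hx : x ∈ s then w ⟨x, hx⟩ else 0, ?_⟩
  rw [← hw, ← Finset.sum_attach s]
  refine Finset.sum_congr rfl fun x _ => ?_
  simp

def Zs {α : Type} [Fintype α] (g : α → MvPolynomial σ k) (s : Finset α) :
    Submodule (MvPolynomial σ k) (α → MvPolynomial σ k) where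
  carrier := {z | (∀ a ∉ s, z a = 0) ∧ ∑ a, z a * g a = 0}
  zero_mem' := by simp
  add_mem' := by
    rintro x y ⟨hx, hx'⟩ ⟨hy, hy'⟩
    refine ⟨fun a ha => by simp [hx a ha, hy a ha], ?_⟩
    simp [add_mul, Finset.sum_add_distrib, hx', hy']
  smul_mem' := by
    rintro c x ⟨hx, hx'⟩
    refine ⟨fun a ha => by simp [hx a ha], ?_⟩
    simp [mul_assoc, ← Finset.mul_sum, hx']

noncomputable def UI (J : Ideal (MvPolynomial σ k)) : Submodule (MvPolynomial σ k) (Unit → MvPolynomial σ k) :=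
  Submodule.comap (LinearMap.proj ()) J

theorem Zs_gr {α : Type} [Fintype α] {d : ℕ} (g : α → MvPolynomial σ k)
    (hg : ∀ a, (g a).IsHomogeneous d) (s : Finset α) : GrSub (Zs g s) := by
  rintro e z ⟨h1, h2⟩
  refine ⟨fun a ha => by simp [h1 a ha], ?_⟩
  have := congrArg (homogeneousComponent (e + d)) h2
  rw [map_sum, map_zero] at this
  rw [← this]
  exact Finset.sum_congr rfl fun a _ =>
    (homogeneousComponent_mul_of_isHomogeneous e d _ _ (hg a)).symm

theorem Zs_empty {α : Type} [Fintype α] (g : α → MvPolynomial σ k) (q : ℕ) : Lin q (Zs g ∅) 0 := by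
  have hZ : Zs g ∅ = ⊥ := by
    rw [eq_bot_iff]
    rintro z ⟨h, -⟩
    ext1 a
    exact h a (by simp)
  rw [hZ]
  have key : ∀ (q : ℕ) {κ : Type}, Lin q (⊥ : Submodule (MvPolynomial σ k) (κ → MvPolynomial σ k)) 0 := by
    intro q
    induction q with
    | zero =>
      intro κ
      exact ⟨Empty, inferInstance, 0, by simp, fun z _ i => i.elim, fun d z => by simp, by simp⟩
    | succ q ih =>
      intro κ
      refine ⟨Empty, inferInstance, 0, by simp, fun z _ i => i.elim, fun d z => by simp, ?_⟩
      convert ih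
      rw [eq_bot_iff]
      intro z _
      ext1 i
      exact i.elim
  exact key q

theorem Zs_step {α : Type} [Fintype α] [DecidableEq α] {d : ℕ} (g : α → MvPolynomial σ k)
    (hg : ∀ a, (g a).IsHomogeneous d) (s : Finset α) (a : α) (ha : a ∉ s)
    (J : Ideal (MvPolynomial σ k))
    (hJ : ∀ c, c * g a ∈ Ideal.span (g '' s) ↔ c ∈ J) {q b b' : ℕ} (h : Lin q (Zs g s) b)
    (h' : Lin q (UI J) b') : Lin q (Zs g (insert a s)) (b + b') := by
  refine horseshoe LinearMap.id (LinearMap.funLeft _ _ (fun _ : Unit => a)) (fun x y h => h)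
    (fun d z => rfl) (fun d z => rfl) (Zs_gr g hg _) ?_ ?_ h h'
  · rw [Submodule.map_id]
    ext z
    constructor
    · rintro ⟨h1, h2⟩
      refine ⟨⟨fun x hx => h1 x fun hx' => hx (Finset.mem_insert_of_mem hx'), h2⟩, ?_⟩
      ext1 _
      exact h1 a ha
    · rintro ⟨⟨h1, h2⟩, h3⟩
      have h3' : z a = 0 := congrFun h3 ()
      refine ⟨fun x hx => ?_, h2⟩
      by_cases hxa : x = a
      · rw [hxa, h3']
      · exact h1 x (by simp [hxa, hx])
  · ext c
    have hc : c ∈ UI J ↔ c () ∈ J := Iff.rfl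
    rw [hc, ← hJ]
    constructor
    · rintro ⟨z, ⟨h1, h2⟩, rfl⟩
      change z a * g a ∈ _
      rw [Fintype.sum_eq_add_sum_compl a] at h2
      rw [eq_neg_of_add_eq_zero_left h2]
      refine neg_mem (Ideal.sum_mem _ fun x hx => ?_)
      by_cases hxs : x ∈ s
      · exact Ideal.mul_mem_left _ _ (Ideal.subset_span ⟨x, hxs, rfl⟩)
      · rw [h1 x (by simp at hx; simp [hx, hxs]), zero_mul]; exact zero_mem _
    · intro h
      obtain ⟨w, hw⟩ := mem_span_image_fin _ _ h
      refine ⟨fun x => if x = a then c () else if x ∈ s then - w x else 0, ⟨?_, ?_⟩, ?_⟩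
      · intro x hx
        rw [Finset.mem_insert, not_or] at hx
        simp [hx.1, hx.2]
      · rw [Fintype.sum_eq_add_sum_compl a]
        have h2 : ∑ x ∈ {a}ᶜ, (if x = a then c () else if x ∈ s then -w x else 0) * g x =
            ∑ x ∈ s, -(w x * g x) := by
          symm
          have hsub : s ⊆ {a}ᶜ := by
            intro x hx
            simp only [Finset.mem_compl, Finset.mem_singleton]
            exact fun h => ha (h ▸ hx)
          refine (Finset.sum_congr rfl fun x hx => ?_).trans (Finset.sum_subset hsub ?_)
          · have hxa : x ≠ a := by
              rintro rfl
              exact ha hx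
            rw [if_neg hxa, if_pos hx]
            simp
          · intro x hx hx'
            simp only [Finset.mem_compl, Finset.mem_singleton] at hx
            simp [hx, hx']
        rw [h2, Finset.sum_neg_distrib, hw]
        simp
      · ext1 _
        change (if a = a then c () else _) = _
        simp

theorem minMono {α : Type} [Fintype α] (e : α → σ →₀ ℕ) (he : Function.Injective e) (d : ℕ)
    (hd : ∀ a, (e a).degree = d) (z : α → MvPolynomial σ k)
    (hz : ∑ a, z a * monomial (e a) 1 = 0) (a : α) : constantCoeff (z a) = 0 := by
  classical
  have := congrArg (coeff (e a)) hz
  rw [coeff_sum, coeff_zero, Finset.sum_eq_single a] at this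
  · rw [coeff_mul_monomial'] at this
    simpa [constantCoeff_eq] using this
  · intro x _ hx
    rw [coeff_mul_monomial', if_neg]
    intro hle
    apply hx
    apply he
    obtain ⟨c, hc⟩ := exists_add_of_le hle
    have h2 := congrArg Finsupp.degree hc
    rw [map_add, hd, hd] at h2
    have : c = 0 := by
      rw [← Finsupp.degree_eq_zero_iff]; omega
    rw [hc, this, add_zero]
  · simp

theorem koszul (q : ℕ) : ∀ V : Finset σ,
    Lin q (UI (Ideal.span ((X : σ → MvPolynomial σ k) '' V))) (V.card.choose (q + 1)) := by
  classical
  have base : ∀ V : Finset σ, ∃ f : (V → MvPolynomial σ k) →ₗ[MvPolynomial σ k] (Unit → MvPolynomial σ k),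
      LinearMap.range f = UI (Ideal.span ((X : σ → MvPolynomial σ k) '' V)) ∧
      MinMap constantCoeff f ∧ HomDeg 1 f ∧ LinearMap.ker f =
        Zs (fun v : V => (X v.1 : MvPolynomial σ k)) Finset.univ := by
    intro V
    have hap : ∀ z : V → MvPolynomial σ k, Fintype.linearCombination (MvPolynomial σ k)
      (fun (v : V) (_ : Unit) => (X v.1 : MvPolynomial σ k)) z = fun _ => ∑ v, z v * X v.1 := by
      intro z
      ext1 _
      simp [Fintype.linearCombination_apply]
    refine ⟨Fintype.linearCombination (MvPolynomial σ k)
      (fun (v : V) (_ : Unit) => (X v.1 : MvPolynomial σ k)), ?_, ?_, ?_, ?_⟩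
    · ext c
      have hc : c ∈ UI (Ideal.span ((X : σ → MvPolynomial σ k) '' V)) ↔
        c () ∈ Ideal.span ((X : σ → MvPolynomial σ k) '' V) := Iff.rfl
      rw [hc]
      constructor
      · rintro ⟨z, rfl⟩
        rw [hap]
        exact Ideal.sum_mem _ fun v _ => Ideal.mul_mem_left _ _ (Ideal.subset_span ⟨v.1, v.2, rfl⟩)
      · intro h
        obtain ⟨w, hw⟩ := mem_span_image_fin _ _ h
        refine ⟨fun v => w v.1, ?_⟩
        rw [hap]
        ext1 _
        rw [← hw]
        exact Finset.sum_coe_sort V (fun v => w v * (X v : MvPolynomial σ k))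
    · intro z hz
      rw [hap] at hz
      refine minMono (fun v : V => Finsupp.single v.1 1) ?_ 1 (by simp) z (congrFun hz ())
      intro x y h
      exact Subtype.ext (Finsupp.single_left_injective one_ne_zero h)
    · exact homDeg_linearCombination 1 _ fun _ _ => isHomogeneous_X _ _
    · ext z
      rw [LinearMap.mem_ker, hap]
      constructor
      · intro h
        exact ⟨fun a ha => absurd (Finset.mem_univ a) ha, congrFun h ()⟩
      · rintro ⟨-, h⟩
        ext1 _
        exact h
  induction q with
  | zero =>
    intro V
    obtain ⟨f, h1, h2, h3, -⟩ := base V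
    exact ⟨V, inferInstance, f, h1, h2, h3, by simp⟩
  | succ q ih =>
    intro V
    obtain ⟨f, h1, h2, h3, h4⟩ := base V
    refine ⟨V, inferInstance, f, h1, h2, h3, ?_⟩
    rw [h4]
    have key : ∀ s : Finset V, Lin q (Zs (fun v : V => (X v.1 : MvPolynomial σ k)) s)
        (s.card.choose (q + 1 + 1)) := by
      intro s
      induction s using Finset.induction_on with
      | empty => simpa using Zs_empty _ q
      | insert a s ha ihs =>
        rw [Finset.card_insert_of_notMem ha, Nat.choose_succ_succ, add_comm]
        refine Zs_step _ (fun _ => isHomogeneous_X _ _) s a ha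
          (Ideal.span ((X : σ → MvPolynomial σ k) '' (s.image Subtype.val : Finset σ))) ?_ ihs ?_
        · intro c
          have himg : (fun v : V => (X v.1 : MvPolynomial σ k)) '' s =
            (X : σ → MvPolynomial σ k) '' (s.image Subtype.val : Finset σ) := by
            rw [Finset.coe_image, Set.image_image]
          rw [himg, mem_ideal_span_X_image, mem_ideal_span_X_image]
          simp only [support_mul_X, Finset.mem_map, addRightEmbedding_apply, forall_exists_index,
            and_imp, forall_apply_eq_imp_iff₂]
          refine forall₂_congr fun m _ => exists_congr fun v => and_congr_right fun hv => ?_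
          have : a.1 ≠ v := by
            rintro rfl
            simp at hv
            exact ha hv
          simp [Finsupp.single_eq_of_ne' this]
        · have := ih (s.image Subtype.val)
          rwa [Finset.card_image_of_injective _ Subtype.val_injective] at this
    simpa using key Finset.univ

theorem bet_linear_quotients {α : Type} [Fintype α] [LinearOrder α] (e : α → σ →₀ ℕ)
    (he : Function.Injective e) (d : ℕ) (hd : ∀ a, (e a).degree = d) (V : α → Finset σ)
    (hV : ∀ a u, (∃ m, m < a ∧ e m ≤ u + e a) ↔ ∃ v ∈ V a, u v ≠ 0) (q : ℕ) :
    Bet (constantCoeff : MvPolynomial σ k →+* k) q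
      (Ideal.span (Set.range fun a => (monomial (e a) 1 : MvPolynomial σ k)))
      (∑ a, (V a).card.choose q) := by
  classical
  let g : α → MvPolynomial σ k := fun a => monomial (e a) 1
  have hmem : ∀ z : α → MvPolynomial σ k, (Fintype.linearCombination (MvPolynomial σ k) g) z ∈
      Ideal.span (Set.range fun a => (monomial (e a) 1 : MvPolynomial σ k)) := by
    intro z
    rw [Fintype.linearCombination_apply]
    exact Ideal.sum_mem _ fun v _ => Ideal.mul_mem_left _ _ (Ideal.subset_span ⟨v, rfl⟩)
  let f := (Fintype.linearCombination (MvPolynomial σ k) g).codRestrict _ hmem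
  have hs : Function.Surjective f := by
    rintro ⟨c, hc⟩
    obtain ⟨w, hw⟩ := (Submodule.mem_span_range_iff_exists_fun _).1 hc
    exact ⟨w, Subtype.ext (by simpa [f, g, Fintype.linearCombination_apply] using hw)⟩
  have hf : ∀ z, f z = 0 ↔ ∑ a, z a * g a = 0 := by
    intro z
    rw [Subtype.ext_iff]
    exact Iff.rfl
  have hm : MinMap constantCoeff f := by
    intro z hz
    exact minMono e he d hd z ((hf z).1 hz)
  cases q with
  | zero => exact ⟨α, inferInstance, f, hs, hm, by simp⟩
  | succ q =>
    refine ⟨α, inferInstance, f, hs, hm, Lin.bet ?_⟩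
    have hk : LinearMap.ker f = Zs g Finset.univ := by
      ext z
      rw [LinearMap.mem_ker, hf]
      constructor
      · intro h
        exact ⟨fun a ha => absurd (Finset.mem_univ a) ha, h⟩
      · rintro ⟨-, h⟩
        exact h
    rw [hk]
    have key : ∀ s : Finset α, (∀ x ∈ s, ∀ y, y ≤ x → y ∈ s) →
        Lin q (Zs g s) (∑ a ∈ s, (V a).card.choose (q + 1)) := by
      intro s
      induction s using Finset.induction_on_max with
      | empty => intro _; simpa using Zs_empty g q
      | insert a s hmax ih =>
        intro hlow
        have ha : a ∉ s := fun h => lt_irrefl _ (hmax a h)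
        have hsa : ∀ x, x ∈ s ↔ x < a := by
          intro x
          refine ⟨hmax x, fun h => ?_⟩
          have := hlow a (Finset.mem_insert_self _ _) x h.le
          rw [Finset.mem_insert] at this
          exact this.resolve_left h.ne
        rw [Finset.sum_insert ha, add_comm]
        refine Zs_step g (fun a => isHomogeneous_monomial 1 (hd a)) s a ha _ ?_
          (ih fun x hx y hy => (hsa y).2 (hy.trans_lt (hmax x hx))) (koszul q (V a))
        intro c
        have himg : g '' s = (fun m => (monomial m 1 : MvPolynomial σ k)) '' (e '' s) := by
          rw [Set.image_image]
        rw [himg, mem_ideal_span_monomial_image, mem_ideal_span_X_image]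
        have hsupp : ∀ m, m ∈ (c * g a).support ↔ ∃ u ∈ c.support, u + e a = m := by
          intro m
          simp only [mem_support_iff, g, coeff_mul_monomial', mul_one]
          constructor
          · intro h
            split_ifs at h with hle
            · exact ⟨_, h, tsub_add_cancel_of_le hle⟩
            · exact absurd rfl h
          · rintro ⟨u, hu, rfl⟩
            simpa using hu
        simp only [hsupp, forall_exists_index, and_imp, forall_apply_eq_imp_iff₂]
        refine forall₂_congr fun u _ => ?_
        have := hV a u
        simpa [hsa] using this
    exact key Finset.univ fun _ _ _ _ => Finset.mem_univ _
end LQ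
section MFR
open MvPolynomial
variable {k : Type u} [Field k] {σ : Type}

theorem mem_smul_top_coord {b : ℕ} (z : Fin b →₀ MvPolynomial σ k)
    (hz : z ∈ Ideal.span (Set.range (X : σ → MvPolynomial σ k)) •
      (⊤ : Submodule (MvPolynomial σ k) (Fin b →₀ MvPolynomial σ k))) (i : Fin b) :
    constantCoeff (z i) = 0 := by
  induction hz using Submodule.smul_induction_on' with
  | smul r hr n hn =>
    have hr' : r ∈ RingHom.ker (constantCoeff : MvPolynomial σ k →+* k) := by
      refine (Ideal.span_le.2 ?_) hr
      rintro _ ⟨x, rfl⟩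
      simp [RingHom.mem_ker]
    rw [RingHom.mem_ker] at hr'
    simp [hr']
  | add x _ y _ hx hy => simp [hx, hy]

noncomputable def MinimalFreeResolution.shift {S : Type*} [CommRing S] {𝔪 : Ideal S}
    {M : Type*} [AddCommGroup M] [Module S M] (F : MinimalFreeResolution S 𝔪 M) :
    MinimalFreeResolution S 𝔪 (LinearMap.ker F.ε) where
  β q := F.β (q + 1)
  d q := F.d (q + 1)
  ε := (F.d 0).codRestrict _ (fun x => by rw [F.exact_zero]; exact ⟨x, rfl⟩)
  surj := by
    rintro ⟨x, hx⟩
    have hx' := hx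
    rw [F.exact_zero] at hx'
    obtain ⟨y, rfl⟩ := hx'
    exact ⟨y, rfl⟩
  exact_zero := by rw [LinearMap.ker_codRestrict]; exact F.exact 0
  exact q := F.exact (q + 1)
  minimal q := F.minimal (q + 1)

theorem MinimalFreeResolution.bet (q : ℕ) : ∀ {M : Type u} [AddCommGroup M]
    [Module (MvPolynomial σ k) M] (F : MinimalFreeResolution (MvPolynomial σ k)
      (Ideal.span (Set.range (X : σ → MvPolynomial σ k))) M),
    Bet (constantCoeff : MvPolynomial σ k →+* k) q M (F.β q) := by
  have key : ∀ {M : Type u} [AddCommGroup M]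
    [Module (MvPolynomial σ k) M] (F : MinimalFreeResolution (MvPolynomial σ k)
      (Ideal.span (Set.range (X : σ → MvPolynomial σ k))) M),
    ∃ f : (Fin (F.β 0) → MvPolynomial σ k) →ₗ[MvPolynomial σ k] M, Function.Surjective f ∧
      MinMap constantCoeff f ∧ Nonempty (LinearMap.ker F.ε ≃ₗ[MvPolynomial σ k] LinearMap.ker f) := by
    intro M _ _ F
    let E := (Finsupp.linearEquivFunOnFinite (MvPolynomial σ k) (MvPolynomial σ k) (Fin (F.β 0)))
    refine ⟨F.ε ∘ₗ E.symm.toLinearMap, F.surj.comp E.symm.surjective, ?_, ⟨?_⟩⟩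
    · intro z hz i
      have h1 : E.symm z ∈ LinearMap.ker F.ε := hz
      rw [F.exact_zero] at h1
      exact mem_smul_top_coord _ (F.minimal 0 h1) i
    · rw [LinearMap.ker_comp]
      exact (E.symm.ofSubmodule' (LinearMap.ker F.ε)).symm
  induction q with
  | zero =>
    intro M _ _ F
    obtain ⟨f, h1, h2, -⟩ := key F
    exact ⟨_, inferInstance, f, h1, h2, by simp⟩
  | succ q ih =>
    intro M _ _ F
    obtain ⟨f, h1, h2, ⟨e⟩⟩ := key F
    exact ⟨_, inferInstance, f, h1, h2, (ih F.shift).congr e⟩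
end MFR
section Comb
open Finset

/-- rows occupied -/
def rowsOf {n : ℕ} {b : Fin n → ℕ} (a : ∀ i, WithTop (Fin (b i))) : Finset (Fin n) :=
  univ.filter fun i => a i ≠ ⊤

def suppOf {n : ℕ} {b : Fin n → ℕ} (a : ∀ i, WithTop (Fin (b i))) : Finset (Σ i, Fin (b i)) :=
  univ.filter fun v => a v.1 = (v.2 : WithTop (Fin (b v.1)))

def colonOf {n : ℕ} {b : Fin n → ℕ} (a : ∀ i, WithTop (Fin (b i))) : Finset (Σ i, Fin (b i)) :=
  univ.filter fun v => (v.2 : WithTop (Fin (b v.1))) < a v.1 ∧ (a v.1 = ⊤ → ∃ i, v.1 < i ∧ a i ≠ ⊤)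

theorem card_suppOf {n : ℕ} {b : Fin n → ℕ} (a : ∀ i, WithTop (Fin (b i))) :
    (suppOf a).card = (rowsOf a).card := by
  refine Finset.card_bij (fun v _ => v.1) ?_ ?_ ?_
  · intro v hv
    simp only [suppOf, rowsOf, mem_filter, mem_univ, true_and] at hv ⊢
    rw [hv]; exact WithTop.coe_ne_top
  · rintro ⟨i, j⟩ hv ⟨i', j'⟩ hw h
    simp only [suppOf, mem_filter, mem_univ, true_and] at hv hw h
    subst h
    rw [hv] at hw
    rw [WithTop.coe_inj.1 hw]
  · intro i hi
    simp only [rowsOf, mem_filter, mem_univ, true_and] at hi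
    obtain ⟨j, hj⟩ := WithTop.ne_top_iff_exists.1 hi
    exact ⟨⟨i, j⟩, by simp [suppOf, hj], rfl⟩

def rowOf {n : ℕ} {b : Fin n → ℕ} (W : Finset (Σ i, Fin (b i))) (i : Fin n) : Finset (Fin (b i)) :=
  univ.filter fun j => (⟨i, j⟩ : Σ i, Fin (b i)) ∈ W

theorem disj_supp {n : ℕ} {b : Fin n → ℕ} (a : ∀ i, WithTop (Fin (b i))) {A : Finset (Σ i, Fin (b i))}
    (hA : A ⊆ colonOf a) : Disjoint A (suppOf a) := by
  rw [Finset.disjoint_left]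
  intro v hv hv'
  have := hA hv
  simp only [suppOf, colonOf, mem_filter, mem_univ, true_and] at this hv'
  rw [hv'] at this
  exact lt_irrefl _ this.1

theorem comb_bij {n t q : ℕ} (ht : 1 ≤ t) (b : Fin n → ℕ) :
    ∑ a : (∀ i, WithTop (Fin (b i))) with (rowsOf a).card = t, (colonOf a).card.choose q =
    ∑ W ∈ powersetCard (t + q) (univ : Finset (Σ i, Fin (b i))),
      #{T ∈ powersetCard t (W.image Sigma.fst) | ∃ i ∈ T, ∀ v ∈ W, v.1 ≤ i} := by
  classical
  simp_rw [← card_powersetCard]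
  rw [← card_sigma, ← card_sigma]
  refine Finset.card_bij (fun x _ => ⟨x.2 ∪ suppOf x.1, rowsOf x.1⟩) ?_ ?_ ?_
  · rintro ⟨a, A⟩ h
    simp only [mem_sigma, mem_filter, mem_univ, true_and, mem_powersetCard] at h
    obtain ⟨ha, hA, hAc⟩ := h
    simp only [mem_sigma, mem_filter, mem_powersetCard, subset_univ, true_and]
    refine ⟨?_, ⟨?_, ha⟩, ?_⟩
    · rw [card_union_of_disjoint (disj_supp a hA), hAc, card_suppOf, ha, add_comm]
    · intro i hi
      simp only [rowsOf, mem_filter, mem_univ, true_and] at hi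
      obtain ⟨j, hj⟩ := WithTop.ne_top_iff_exists.1 hi
      exact mem_image.2 ⟨⟨i, j⟩, by simp [suppOf, hj], rfl⟩
    · have hne : (rowsOf a).Nonempty := by rw [← card_pos]; omega
      refine ⟨_, max'_mem _ hne, ?_⟩
      intro v hv
      rcases mem_union.1 hv with hv | hv
      · have := hA hv
        simp only [colonOf, mem_filter, mem_univ, true_and] at this
        by_cases htop : a v.1 = ⊤
        · obtain ⟨i, hi, hi'⟩ := this.2 htop
          exact hi.le.trans (le_max' _ _ (by simp [rowsOf, hi']))
        · exact le_max' _ _ (by simp [rowsOf, htop])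
      · simp only [suppOf, mem_filter, mem_univ, true_and] at hv
        exact le_max' _ _ (by simp [rowsOf, hv])
  · rintro ⟨a, A⟩ h ⟨a', A'⟩ h' heq
    simp only [mem_sigma, mem_filter, mem_univ, true_and, mem_powersetCard] at h h'
    obtain ⟨ha, hA, hAc⟩ := h
    obtain ⟨ha', hA', hAc'⟩ := h'
    simp only [Sigma.mk.injEq, heq_eq_eq] at heq
    obtain ⟨h1, h2⟩ := heq
    have key : ∀ (a a' : ∀ i, WithTop (Fin (b i))) (A A' : Finset (Σ i, Fin (b i))),
        A' ⊆ colonOf a' → A ∪ suppOf a = A' ∪ suppOf a' → rowsOf a = rowsOf a' → ∀ i, a i ≤ a' i := by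
      intro a a' A A' hA' h1 h2 i
      by_cases hi : i ∈ rowsOf a
      · simp only [rowsOf, mem_filter, mem_univ, true_and] at hi
        obtain ⟨j, hj⟩ := WithTop.ne_top_iff_exists.1 hi
        have : (⟨i, j⟩ : Σ i, Fin (b i)) ∈ A' ∪ suppOf a' := by
          rw [← h1]; exact mem_union_right _ (by simp [suppOf, hj])
        rw [← hj]
        rcases mem_union.1 this with h | h
        · have := hA' h
          simp only [colonOf, mem_filter, mem_univ, true_and] at this
          exact this.1.le
        · simp only [suppOf, mem_filter, mem_univ, true_and] at h
          exact h.ge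
      · rw [h2] at hi
        simp only [rowsOf, mem_filter, mem_univ, true_and, not_not] at hi
        rw [hi]; exact le_top
    have haa : a = a' := by
      ext1 i
      exact le_antisymm (key a a' A A' hA' h1 h2 i) (key a' a A' A hA h1.symm h2.symm i)
    subst haa
    have : A = A' := by
      rw [← union_sdiff_cancel_right (disj_supp a hA), h1,
        union_sdiff_cancel_right (disj_supp a hA')]
    rw [this]
  · rintro ⟨W, T⟩ h
    simp only [mem_sigma, mem_filter, mem_powersetCard, subset_univ, true_and] at h
    obtain ⟨hW, ⟨hT, hTc⟩, i0, hi0, hmax⟩ := h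
    have hrow : ∀ i ∈ T, (rowOf W i).Nonempty := by
      intro i hi
      obtain ⟨⟨i', j⟩, hv, rfl⟩ := mem_image.1 (hT hi)
      exact ⟨j, by simp [rowOf, hv]⟩
    let a : ∀ i, WithTop (Fin (b i)) := fun i =>
      if h : i ∈ T then (((rowOf W i).max' (hrow i h) : Fin (b i)) : WithTop (Fin (b i))) else ⊤
    have ha1 : ∀ i (h : i ∈ T), a i = (((rowOf W i).max' (hrow i h) : Fin (b i)) : WithTop (Fin (b i))) :=
      fun i h => by simp [a, h]
    have ha2 : ∀ i, i ∉ T → a i = ⊤ := fun i h => by simp [a, h]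
    have hrows : rowsOf a = T := by
      ext i
      simp only [rowsOf, mem_filter, mem_univ, true_and]
      by_cases h : i ∈ T
      · simp [ha1 i h, h]
      · simp [ha2 i h, h]
    have hsupp : suppOf a ⊆ W := by
      rintro ⟨i, j⟩ hv
      simp only [suppOf, mem_filter, mem_univ, true_and] at hv
      by_cases h : i ∈ T
      · rw [ha1 i h, WithTop.coe_inj] at hv
        have := max'_mem _ (hrow i h)
        rw [hv] at this
        simpa [rowOf] using this
      · rw [ha2 i h] at hv
        exact absurd hv.symm WithTop.coe_ne_top
    refine ⟨⟨a, W \ suppOf a⟩, ?_, ?_⟩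
    · simp only [mem_sigma, mem_filter, mem_univ, true_and, mem_powersetCard]
      refine ⟨by rw [hrows, hTc], ?_, ?_⟩
      · rintro ⟨i, j⟩ hv
        obtain ⟨hvW, hvs⟩ := mem_sdiff.1 hv
        simp only [suppOf, mem_filter, mem_univ, true_and] at hvs
        simp only [colonOf, mem_filter, mem_univ, true_and]
        by_cases h : i ∈ T
        · rw [ha1 i h] at hvs ⊢
          refine ⟨?_, fun h => absurd h WithTop.coe_ne_top⟩
          have h1 : j ≤ (rowOf W i).max' (hrow i h) := le_max' _ _ (by simp [rowOf, hvW])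
          exact lt_of_le_of_ne (WithTop.coe_le_coe.2 h1) (Ne.symm hvs)
        · rw [ha2 i h]
          refine ⟨WithTop.coe_lt_top _, fun _ => ⟨i0, ?_, by rw [ha1 i0 hi0]; exact WithTop.coe_ne_top⟩⟩
          refine lt_of_le_of_ne (hmax _ hvW) ?_
          rintro rfl
          exact h hi0
      · rw [card_sdiff_of_subset hsupp, card_suppOf, hrows, hW, hTc]; omega
    · simp only [Sigma.mk.injEq, heq_eq_eq]
      exact ⟨sdiff_union_of_subset hsupp, hrows⟩

theorem card_T {n t : ℕ} (ht : 1 ≤ t) {b : Fin n → ℕ} (W : Finset (Σ i, Fin (b i)))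
    (hW : W.Nonempty) :
    #{T ∈ powersetCard t (W.image Sigma.fst) | ∃ i ∈ T, ∀ v ∈ W, v.1 ≤ i} =
      ((W.image Sigma.fst).card - 1).choose (t - 1) := by
  classical
  set U := W.image Sigma.fst with hU
  have hUn : U.Nonempty := hW.image _
  set m := U.max' hUn with hm
  have hmU : m ∈ U := max'_mem _ _
  rw [← card_erase_of_mem hmU, ← card_powersetCard]
  have hcond : ∀ T, T ⊆ U → ((∃ i ∈ T, ∀ v ∈ W, v.1 ≤ i) ↔ m ∈ T) := by
    intro T hT
    constructor
    · rintro ⟨i, hi, h⟩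
      have : i = m := by
        apply le_antisymm (le_max' _ _ (hT hi))
        obtain ⟨v, hv, hvm⟩ := mem_image.1 hmU
        exact hvm.symm.le.trans (h v hv)
      rwa [← this]
    · intro h
      exact ⟨m, h, fun v hv => le_max' _ _ (mem_image_of_mem _ hv)⟩
  refine card_nbij' (fun T => T.erase m) (fun T => insert m T) ?_ ?_ ?_ ?_
  · intro T h
    simp only [coe_filter, mem_powersetCard, Set.mem_ofPred_eq] at h
    obtain ⟨⟨h1, h2⟩, h3⟩ := h
    rw [hcond T h1] at h3
    simp only [mem_coe, mem_powersetCard]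
    exact ⟨erase_subset_erase _ h1, by rw [card_erase_of_mem h3, h2]⟩
  · intro T h
    simp only [mem_coe, mem_powersetCard] at h
    have hmT : m ∉ T := fun hh => by simpa using h.1 hh
    have hs : insert m T ⊆ U := insert_subset hmU (h.1.trans (erase_subset _ _))
    simp only [coe_filter, mem_powersetCard, Set.mem_ofPred_eq]
    refine ⟨⟨hs, ?_⟩, (hcond _ hs).2 (mem_insert_self _ _)⟩
    rw [card_insert_of_notMem hmT, h.2]; omega
  · intro T h
    simp only [coe_filter, mem_powersetCard, Set.mem_ofPred_eq] at h
    obtain ⟨⟨h1, h2⟩, h3⟩ := h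
    rw [hcond T h1] at h3
    exact insert_erase h3
  · intro T h
    simp only [mem_coe, mem_powersetCard] at h
    have hmT : m ∉ T := fun hh => by simpa using h.1 hh
    exact erase_insert hmT

theorem eq_sigma_row {n : ℕ} {b : Fin n → ℕ} (W : Finset (Σ i, Fin (b i))) :
    W = univ.sigma (rowOf W) := by
  ext ⟨i, j⟩
  simp [rowOf]

theorem card_rows {n : ℕ} {b : Fin n → ℕ} (r : Fin n → ℕ) :
    #{W : Finset (Σ i, Fin (b i)) | ∀ i, (rowOf W i).card = r i} = ∏ i, (b i).choose (r i) := by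
  classical
  have : ∏ i, (b i).choose (r i) =
      (Fintype.piFinset fun i => powersetCard (r i) (univ : Finset (Fin (b i)))).card := by
    rw [Fintype.card_piFinset]; simp
  rw [this]
  refine card_nbij' (fun W => rowOf W) (fun w => univ.sigma w) ?_ ?_ ?_ ?_
  · intro W h
    simp only [coe_filter, mem_univ, true_and, Set.mem_ofPred_eq] at h
    simp [h]
  · intro w h
    simp only [mem_coe, Fintype.mem_piFinset, mem_powersetCard, subset_univ, true_and] at h
    simp only [coe_filter, mem_univ, true_and, Set.mem_ofPred_eq]
    intro i
    rw [← h i]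
    congr 1
    ext j
    simp [rowOf]
  · intro W _
    exact (eq_sigma_row W).symm
  · intro w _
    ext i j
    simp [rowOf]

theorem card_U {n t q : ℕ} (b : Fin n → ℕ) (U : Finset (Fin n)) :
    #{W ∈ powersetCard (t + q) (univ : Finset (Σ i, Fin (b i))) | W.image Sigma.fst = U} =
    ∑ r ∈ (Fintype.piFinset fun _ : Fin n => Finset.range (t + q + 1)).filter
                (fun r => (∑ i, r i) = t + q ∧ ∀ i, 1 ≤ r i ↔ i ∈ U),
              ∏ i ∈ U, (b i).choose (r i) := by
  classical
  have hcard : ∀ W : Finset (Σ i, Fin (b i)), W.card = ∑ i, (rowOf W i).card := by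
    intro W
    conv_lhs => rw [eq_sigma_row W]
    rw [card_sigma]
  have hmem : ∀ (W : Finset (Σ i, Fin (b i))) i, 1 ≤ (rowOf W i).card ↔ i ∈ W.image Sigma.fst := by
    intro W i
    rw [Nat.one_le_iff_ne_zero, card_ne_zero]
    constructor
    · rintro ⟨j, hj⟩
      exact mem_image.2 ⟨⟨i, j⟩, by simpa [rowOf] using hj, rfl⟩
    · intro h
      obtain ⟨⟨i', j⟩, hv, rfl⟩ := mem_image.1 h
      exact ⟨j, by simp [rowOf, hv]⟩
  rw [card_eq_sum_card_fiberwise (f := fun W i => (rowOf W i).card)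
    (t := (Fintype.piFinset fun _ : Fin n => Finset.range (t + q + 1)).filter
                (fun r => (∑ i, r i) = t + q ∧ ∀ i, 1 ≤ r i ↔ i ∈ U))]
  · refine sum_congr rfl fun r hr => ?_
    simp only [mem_filter, Fintype.mem_piFinset, mem_range] at hr
    obtain ⟨-, hr1, hr2⟩ := hr
    have : ∏ i ∈ U, (b i).choose (r i) = ∏ i, (b i).choose (r i) := by
      refine prod_subset (subset_univ _) fun i _ hi => ?_
      rw [← hr2 i] at hi
      have : r i = 0 := by omega
      simp [this]
    rw [this, ← card_rows]
    congr 1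
    ext W
    simp only [mem_filter, mem_powersetCard, subset_univ, true_and, mem_univ, funext_iff]
    constructor
    · exact fun h => h.2
    · intro h
      refine ⟨⟨?_, ?_⟩, h⟩
      · rw [hcard, ← hr1]; exact sum_congr rfl fun i _ => h i
      · ext i
        rw [← hmem, h, hr2]
  · intro W hW
    simp only [coe_filter, mem_powersetCard, subset_univ, true_and, Set.mem_ofPred_eq] at hW
    obtain ⟨h1, rfl⟩ := hW
    simp only [coe_filter, Fintype.mem_piFinset, mem_range, Set.mem_ofPred_eq]
    refine ⟨fun i => ?_, ?_, fun i => hmem W i⟩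
    · have : (rowOf W i).card ≤ ∑ i, (rowOf W i).card := single_le_sum (f := fun i => (rowOf W i).card) (fun _ _ => Nat.zero_le _) (mem_univ i)
      rw [← hcard, h1] at this
      omega
    · rw [← hcard, h1]

theorem comb_main {n t q : ℕ} (ht : 1 ≤ t) (b : Fin n → ℕ) :
    ∑ a : (∀ i, WithTop (Fin (b i))) with (rowsOf a).card = t, (colonOf a).card.choose q =
    ∑ s ∈ Finset.Icc t (min (t + q) n), (s - 1).choose (t - 1) *
          ∑ T ∈ Finset.powersetCard s (Finset.univ : Finset (Fin n)),
            ∑ r ∈ (Fintype.piFinset fun _ : Fin n => Finset.range (t + q + 1)).filter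
                (fun r => (∑ i, r i) = t + q ∧ ∀ i, 1 ≤ r i ↔ i ∈ T),
              ∏ i ∈ T, (b i).choose (r i) := by
  classical
  rw [comb_bij ht b]
  have hne : ∀ W ∈ powersetCard (t + q) (univ : Finset (Σ i, Fin (b i))), W.Nonempty := by
    intro W hW
    rw [← card_pos, (mem_powersetCard.1 hW).2]; omega
  rw [sum_congr rfl fun W hW => card_T ht W (hne W hW)]
  rw [← sum_filter_of_ne (p := fun W => t ≤ (W.image Sigma.fst).card)]
  swap
  · intro W hW h
    have h1 := Nat.choose_ne_zero_iff.1 h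
    have := card_pos.2 ((hne W hW).image Sigma.fst)
    omega
  rw [← sum_fiberwise_of_maps_to (g := fun W => (W.image Sigma.fst).card)
    (t := Finset.Icc t (min (t + q) n))]
  swap
  · intro W hW
    obtain ⟨h1, h2⟩ := mem_filter.1 hW
    have h3 := (mem_powersetCard.1 h1).2
    refine mem_Icc.2 ⟨h2, le_min ?_ ?_⟩
    · rw [← h3]; exact card_image_le
    · simpa using card_le_univ (W.image Sigma.fst)
  refine sum_congr rfl fun s hs => ?_
  rw [mem_Icc] at hs
  simp_rw [← card_U]
  rw [sum_congr rfl (g := fun _ => (s - 1).choose (t - 1))]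
  swap
  · intro W hW
    rw [(mem_filter.1 hW).2]
  rw [sum_const, smul_eq_mul, mul_comm]
  congr 1
  rw [card_eq_sum_card_fiberwise (f := fun W => W.image Sigma.fst) (t := powersetCard s univ)]
  · refine sum_congr rfl fun U hU => ?_
    congr 1
    ext W
    have := (mem_powersetCard.1 hU).2
    simp only [mem_filter]
    constructor
    · exact fun h => ⟨h.1.1.1, h.2⟩
    · rintro ⟨h1, rfl⟩
      exact ⟨⟨⟨h1, by omega⟩, this⟩, rfl⟩
  · intro W hW
    have := (mem_filter.1 hW).2
    simpa using this
end Comb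
section Final
open Finset MvPolynomial

noncomputable def eOf {n : ℕ} {b : Fin n → ℕ} (a : ∀ i, WithTop (Fin (b i))) :
    (Σ i, Fin (b i)) →₀ ℕ :=
  Finsupp.equivFunOnFinite.symm (fun v => if v ∈ suppOf a then 1 else 0)

theorem eOf_apply {n : ℕ} {b : Fin n → ℕ} (a : ∀ i, WithTop (Fin (b i))) (v : Σ i, Fin (b i)) :
    eOf a v = if a v.1 = (v.2 : WithTop (Fin (b v.1))) then 1 else 0 := by
  simp [eOf, suppOf]

theorem eOf_degree {n : ℕ} {b : Fin n → ℕ} (a : ∀ i, WithTop (Fin (b i))) :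
    (eOf a).degree = (rowsOf a).card := by
  rw [← card_suppOf, Finsupp.degree_eq_sum]
  simp [eOf]

theorem eOf_injective {n : ℕ} {b : Fin n → ℕ} :
    Function.Injective (eOf : (∀ i, WithTop (Fin (b i))) → _) := by
  have key : ∀ a a' : ∀ i, WithTop (Fin (b i)), eOf a = eOf a' → ∀ i, a' i ≤ a i := by
    intro a a' h i
    by_cases hi : a i = ⊤
    · rw [hi]; exact le_top
    · obtain ⟨j, hj⟩ := WithTop.ne_top_iff_exists.1 hi
      have := DFunLike.congr_fun h ⟨i, j⟩
      rw [eOf_apply, eOf_apply, if_pos hj.symm] at this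
      by_cases h' : a' i = (j : WithTop (Fin (b i)))
      · rw [h', hj]
      · simp [h'] at this
  intro a a' h
  ext1 i
  exact le_antisymm (key a' a h.symm i) (key a a' h i)

theorem colon_cond {n t : ℕ} {b : Fin n → ℕ} (a : ∀ i, WithTop (Fin (b i)))
    (ha : (rowsOf a).card = t) (u : (Σ i, Fin (b i)) →₀ ℕ) :
    (∃ m : ∀ i, WithTop (Fin (b i)), (rowsOf m).card = t ∧ toLex m < toLex a ∧ eOf m ≤ u + eOf a) ↔
      ∃ v ∈ colonOf a, u v ≠ 0 := by
  classical
  constructor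
  · rintro ⟨m, hm, hlt, hle⟩
    obtain ⟨i, hi1, hi2⟩ := hlt
    replace hi1 : ∀ j, j < i → m j = a j := hi1
    replace hi2 : m i < a i := hi2
    obtain ⟨j, hj⟩ := WithTop.ne_top_iff_exists.1 (ne_top_of_lt hi2)
    rw [← hj] at hi2
    refine ⟨⟨i, j⟩, ?_, ?_⟩
    · simp only [colonOf, mem_filter, mem_univ, true_and]
      refine ⟨hi2, fun htop => ?_⟩
      by_contra hcon
      push Not at hcon
      have hss : rowsOf a ⊂ rowsOf m := by
        rw [ssubset_iff_of_subset]
        · exact ⟨i, by simp [rowsOf, ← hj], by simp [rowsOf, htop]⟩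
        · intro l hl
          simp only [rowsOf, mem_filter, mem_univ, true_and] at hl ⊢
          rcases lt_trichotomy l i with h | h | h
          · rwa [hi1 l h]
          · subst h; exact absurd htop hl
          · exact absurd (hcon l h) hl
      have := card_lt_card hss
      omega
    · have := hle ⟨i, j⟩
      rw [Finsupp.add_apply, eOf_apply, eOf_apply, if_pos hj.symm, if_neg hi2.ne'] at this
      omega
  · rintro ⟨⟨i, j⟩, hv, hu⟩
    simp only [colonOf, mem_filter, mem_univ, true_and] at hv
    obtain ⟨hlt, htop⟩ := hv
    by_cases hi : a i = ⊤
    · obtain ⟨i', hi', hai'⟩ := htop hi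
      refine ⟨Function.update (Function.update a i (j : WithTop (Fin (b i)))) i' ⊤, ?_, ⟨i, ?_, ?_⟩, ?_⟩
      · have : rowsOf (Function.update (Function.update a i (j : WithTop (Fin (b i)))) i' ⊤) =
            insert i ((rowsOf a).erase i') := by
          ext l
          simp only [rowsOf, mem_filter, mem_univ, true_and, mem_insert, mem_erase]
          by_cases h1 : l = i'
          · subst h1; simp [hi'.ne']
          · rw [Function.update_of_ne h1]
            by_cases h2 : l = i
            · subst h2; simp
            · rw [Function.update_of_ne h2]; simp [h1, h2]
        rw [this, card_insert_of_notMem, card_erase_of_mem, ha]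
        · have : 0 < (rowsOf a).card := card_pos.2 ⟨i', by simp [rowsOf, hai']⟩
          omega
        · simp [rowsOf, hai']
        · simp [rowsOf, hi]
      · intro l hl
        change Function.update (Function.update a i (j : WithTop (Fin (b i)))) i' ⊤ l = a l
        rw [Function.update_of_ne (hl.trans hi').ne, Function.update_of_ne hl.ne]
      · change Function.update (Function.update a i (j : WithTop (Fin (b i)))) i' ⊤ i < a i
        rw [Function.update_of_ne hi'.ne, Function.update_self]
        exact hlt
      · rintro ⟨l, x⟩
        rw [Finsupp.add_apply, eOf_apply, eOf_apply]
        by_cases h1 : l = i'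
        · subst h1; simp
        · simp only [Function.update_of_ne h1]
          by_cases h2 : l = i
          · subst h2
            simp only [Function.update_self, WithTop.coe_inj]
            by_cases h3 : j = x
            · subst h3; rw [if_pos rfl]; omega
            · rw [if_neg h3]; omega
          · simp only [Function.update_of_ne h2]
            omega
    · refine ⟨Function.update a i (j : WithTop (Fin (b i))), ?_, ⟨i, ?_, ?_⟩, ?_⟩
      · rw [← ha]
        congr 1
        ext l
        simp only [rowsOf, mem_filter, mem_univ, true_and]
        by_cases h2 : l = i
        · subst h2; simp [hi]
        · rw [Function.update_of_ne h2]
      · intro l hl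
        change Function.update a i (j : WithTop (Fin (b i))) l = a l
        rw [Function.update_of_ne hl.ne]
      · change Function.update a i (j : WithTop (Fin (b i))) i < a i
        rw [Function.update_self]
        exact hlt
      · rintro ⟨l, x⟩
        rw [Finsupp.add_apply, eOf_apply, eOf_apply]
        by_cases h2 : l = i
        · subst h2
          simp only [Function.update_self, WithTop.coe_inj]
          by_cases h3 : j = x
          · subst h3; rw [if_pos rfl]; omega
          · rw [if_neg h3]; omega
        · simp only [Function.update_of_ne h2]
          omega

theorem gens_eq {k : Type u} [Field k] (n t : ℕ) (b : Fin n → ℕ) :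
    {p : MvPolynomial (Σ i : Fin n, Fin (b i)) k |
        ∃ T : Finset (Fin n), T.card = t ∧
          ∃ j : ∀ i : Fin n, i ∈ T → Fin (b i),
            p = MvPolynomial.monomial
              (∑ i ∈ T.attach, Finsupp.single ⟨i.1, j i.1 i.2⟩ 1) 1} =
    Set.range (fun a : {a : Lex (∀ i, WithTop (Fin (b i))) // (rowsOf (ofLex a)).card = t} =>
      (monomial (eOf (ofLex a.1)) 1 : MvPolynomial (Σ i : Fin n, Fin (b i)) k)) := by
  classical
  have key : ∀ (T : Finset (Fin n)) (j : ∀ i : Fin n, i ∈ T → Fin (b i))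
      (a : ∀ i, WithTop (Fin (b i))) (_ : ∀ i (h : i ∈ T), a i = (j i h : WithTop (Fin (b i))))
      (_ : ∀ i, i ∉ T → a i = ⊤), 
      (∑ i ∈ T.attach, Finsupp.single (⟨i.1, j i.1 i.2⟩ : Σ i, Fin (b i)) 1) = eOf a := by
    intro T j a h1 h2
    ext ⟨l, x⟩
    rw [eOf_apply, Finsupp.finsetSum_apply]
    by_cases hl : l ∈ T
    · rw [sum_eq_single ⟨l, hl⟩]
      · rw [Finsupp.single_apply]
        simp [h1 l hl]
      · rintro ⟨i, hi⟩ _ hne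
        rw [Finsupp.single_apply, if_neg]
        intro h
        apply hne
        simp only [Sigma.mk.injEq] at h
        exact Subtype.ext h.1
      · intro h; exact absurd (mem_attach _ _) h
    · rw [h2 l hl, if_neg WithTop.top_ne_coe]
      refine sum_eq_zero ?_
      rintro ⟨i, hi⟩ _
      rw [Finsupp.single_apply, if_neg]
      intro h
      simp only [Sigma.mk.injEq] at h
      exact hl (h.1 ▸ hi)
  ext p
  constructor
  · rintro ⟨T, hT, j, rfl⟩
    let a : ∀ i, WithTop (Fin (b i)) := fun i =>
      if h : i ∈ T then (j i h : WithTop (Fin (b i))) else ⊤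
    have h1 : ∀ i (h : i ∈ T), a i = (j i h : WithTop (Fin (b i))) := fun i h => by simp [a, h]
    have h2 : ∀ i, i ∉ T → a i = ⊤ := fun i h => by simp [a, h]
    refine ⟨⟨toLex a, ?_⟩, ?_⟩
    · rw [ofLex_toLex, ← hT]
      congr 1
      ext i
      by_cases h : i ∈ T
      · simp [rowsOf, h1 i h, h]
      · simp [rowsOf, h2 i h, h]
    · simp only [ofLex_toLex]
      rw [key T j a h1 h2]
  · rintro ⟨⟨a, ha⟩, rfl⟩
    have hne : ∀ i, i ∈ rowsOf (ofLex a) → ofLex a i ≠ ⊤ := fun i hi =>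
      (Finset.mem_filter.1 hi).2
    refine ⟨rowsOf (ofLex a), ha, fun i hi => (ofLex a i).untop (hne i hi), ?_⟩
    have := key (rowsOf (ofLex a)) (fun i hi => (ofLex a i).untop (hne i hi)) (ofLex a)
      (fun i hi => (WithTop.coe_untop _ _).symm)
      (fun i hi => by
        by_contra h
        exact hi (Finset.mem_filter.2 ⟨Finset.mem_univ _, h⟩))
    exact congrArg (fun e => monomial e (1 : k)) this.symm
end Final

/-- Proposition 2.4, general form. Let `S = k[y_{i,j(i)} : 1 ≤ i ≤ n, 1 ≤ j(i) ≤ b_i]`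
and let `I_t(D)` be the transversal monomial ideal generated by the `t`-minors of
`D(b_1,…,b_n)`, i.e. by the monomials `y_{i_1,j_1}⋯y_{i_t,j_t}` with `i_1 < ⋯ < i_t`.
Then
`β_q(I_t(D)) = ∑_{s=t}^{min(t+q,n)} C(s−1, t−1) ·
   ∑_{i_1<⋯<i_s} ∑_{r_1+⋯+r_s=t+q, r_v ≥ 1} C(b_{i_1}, r_1)⋯C(b_{i_s}, r_s)`. -/
theorem betti_transversal {k : Type*} [Field k] (n t : ℕ) (b : Fin n → ℕ)
    (ht : 1 ≤ t) (htn : t ≤ n)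
    (F : MinimalFreeResolution (MvPolynomial (Σ i : Fin n, Fin (b i)) k)
      (Ideal.span (Set.range MvPolynomial.X))
      (Ideal.span {p : MvPolynomial (Σ i : Fin n, Fin (b i)) k |
        ∃ T : Finset (Fin n), T.card = t ∧
          ∃ j : ∀ i : Fin n, i ∈ T → Fin (b i),
            p = MvPolynomial.monomial
              (∑ i ∈ T.attach, Finsupp.single ⟨i.1, j i.1 i.2⟩ 1) 1}))
    (q : ℕ) :
    F.β q
      = ∑ s ∈ Finset.Icc t (min (t + q) n), (s - 1).choose (t - 1) *
          ∑ T ∈ Finset.powersetCard s (Finset.univ : Finset (Fin n)),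
            ∑ r ∈ (Fintype.piFinset fun _ : Fin n => Finset.range (t + q + 1)).filter
                (fun r => (∑ i, r i) = t + q ∧ ∀ i, 1 ≤ r i ↔ i ∈ T),
              ∏ i ∈ T, (b i).choose (r i) := by
  classical
  have h1 := F.bet q
  let _ : Fintype {a : Lex (∀ i, WithTop (Fin (b i))) // (rowsOf (ofLex a)).card = t} :=
    inferInstanceAs (Fintype {a : ∀ i, WithTop (Fin (b i)) // (rowsOf a).card = t})
  have h2 := bet_linear_quotients (k := k)
    (α := {a : Lex (∀ i, WithTop (Fin (b i))) // (rowsOf (ofLex a)).card = t})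
    (fun a => eOf (ofLex a.1))
    (fun x y h => Subtype.ext (ofLex.injective (eOf_injective h))) t
    (fun a => (eOf_degree _).trans a.2) (fun a => colonOf (ofLex a.1))
    (fun a u => by
      rw [← colon_cond (ofLex a.1) a.2 u]
      constructor
      · rintro ⟨m, hm, hle⟩
        exact ⟨ofLex m.1, m.2, hm, hle⟩
      · rintro ⟨m, hm, hlt, hle⟩
        exact ⟨⟨toLex m, hm⟩, hlt, hle⟩) q
  rw [← gens_eq (k := k) n t b] at h2
  have hs : Function.Surjective
      (MvPolynomial.constantCoeff : MvPolynomial (Σ i : Fin n, Fin (b i)) k →+* k) :=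
    fun c => ⟨MvPolynomial.C c, by simp⟩
  rw [Bet.unique hs (LinearEquiv.refl _ _) h1 h2, ← comb_main ht b]
  symm
  exact (Finset.sum_subtype (p := fun a : (∀ i, WithTop (Fin (b i))) => (rowsOf a).card = t) _
    (fun a => by simp) (fun a => (colonOf a).card.choose q))
end

section
/- With b_1 = ⋯ = b_n = b, the q-th Betti number of the transversal monomial ideal I_t(D) equals Σ_{s=t}^{t+q} binom(s−1, t−1)·binom(n, s)·Σ_{r_1+⋯+r_s=t+q, r_v≥1} binom(b, r_1)⋯binom(b, r_s). -/
namespace BettiTr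

section uniq
variable {S : Type*} [CommRing S]

/-- Stable equivalence of submodules (adding the same free module on both sides). -/
def StabEq {W W' : Type*} [AddCommGroup W] [Module S W] [AddCommGroup W'] [Module S W']
    (A : Submodule S W) (A' : Submodule S W') : Prop :=
  ∃ a : ℕ, Nonempty ((A × (Fin a → S)) ≃ₗ[S] (A' × (Fin a → S)))

/-- The fibre product splits when there is a lift. -/
noncomputable def pullEquiv {Q Q' N : Type*} [AddCommGroup Q] [Module S Q] [AddCommGroup Q']
    [Module S Q'] [AddCommGroup N] [Module S N] (p : Q →ₗ[S] N) (p' : Q' →ₗ[S] N)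
    (s : Q →ₗ[S] Q') (hs : ∀ x, p' (s x) = p x) :
    LinearMap.eqLocus (p ∘ₗ LinearMap.fst S Q Q') (p' ∘ₗ LinearMap.snd S Q Q')
      ≃ₗ[S] (LinearMap.ker p' × Q) where
  toFun z := (⟨z.1.2 - s z.1.1, by
    have := z.2
    simp only [LinearMap.mem_eqLocus, LinearMap.comp_apply, LinearMap.fst_apply,
      LinearMap.snd_apply] at this
    simp [hs, this]⟩, z.1.1)
  map_add' z w := by
    ext <;> simp
    abel
  map_smul' r z := by
    ext <;> simp [smul_sub]
  invFun z := ⟨(z.2, z.1.1 + s z.2), by simp [hs]⟩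
  left_inv z := by ext <;> simp
  right_inv z := by ext <;> simp

/-- Swapping the factors of the fibre product. -/
noncomputable def pullSwap {Q Q' N : Type*} [AddCommGroup Q] [Module S Q] [AddCommGroup Q']
    [Module S Q'] [AddCommGroup N] [Module S N] (p : Q →ₗ[S] N) (p' : Q' →ₗ[S] N) :
    LinearMap.eqLocus (p ∘ₗ LinearMap.fst S Q Q') (p' ∘ₗ LinearMap.snd S Q Q')
      ≃ₗ[S] LinearMap.eqLocus (p' ∘ₗ LinearMap.fst S Q' Q) (p ∘ₗ LinearMap.snd S Q' Q) where
  toFun z := ⟨(z.1.2, z.1.1), by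
    have := z.2
    simp only [LinearMap.mem_eqLocus, LinearMap.comp_apply, LinearMap.fst_apply,
      LinearMap.snd_apply] at this ⊢
    exact this.symm⟩
  map_add' z w := by ext <;> simp
  map_smul' r z := by ext <;> simp
  invFun z := ⟨(z.1.2, z.1.1), by
    have := z.2
    simp only [LinearMap.mem_eqLocus, LinearMap.comp_apply, LinearMap.fst_apply,
      LinearMap.snd_apply] at this ⊢
    exact this.symm⟩
  left_inv z := by ext <;> simp
  right_inv z := by ext <;> simp

theorem schanuel {Q Q' N : Type*} [AddCommGroup Q] [Module S Q] [AddCommGroup Q']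
    [Module S Q'] [AddCommGroup N] [Module S N] [Module.Projective S Q] [Module.Projective S Q']
    (p : Q →ₗ[S] N) (p' : Q' →ₗ[S] N) (hp : Function.Surjective p)
    (hp' : Function.Surjective p') :
    Nonempty ((LinearMap.ker p × Q') ≃ₗ[S] (LinearMap.ker p' × Q)) := by
  obtain ⟨s, hs⟩ := Module.projective_lifting_property p' p hp'
  obtain ⟨s', hs'⟩ := Module.projective_lifting_property p p' hp
  have hs : ∀ x, p' (s x) = p x := fun x => LinearMap.congr_fun hs x
  have hs' : ∀ x, p (s' x) = p' x := fun x => LinearMap.congr_fun hs' x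
  exact ⟨(pullEquiv p' p s' hs').symm.trans ((pullSwap p' p).trans (pullEquiv p p' s hs))⟩

/-- Hom into the residue ring computed from a minimal cover. -/
theorem hom_equiv (m : Ideal S) {P N ι : Type*} [AddCommGroup P] [Module S P]
    [AddCommGroup N] [Module S N] [Fintype ι] (bP : Module.Basis ι S P)
    (p : P →ₗ[S] N) (hp : Function.Surjective p)
    (hk : LinearMap.ker p ≤ m • (⊤ : Submodule S P)) :
    Nonempty ((N →ₗ[S] (S ⧸ m)) ≃ₗ[S] (ι → S ⧸ m)) := by
  have e1 : Function.Bijective (LinearMap.lcomp S (S ⧸ m) p) := by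
    constructor
    · intro f g h
      ext x
      obtain ⟨y, rfl⟩ := hp x
      exact LinearMap.congr_fun h y
    · intro h
      have hh : LinearMap.ker p ≤ LinearMap.ker h := by
        refine hk.trans ?_
        rw [Submodule.smul_le]
        intro r hr x _
        rw [LinearMap.mem_ker, map_smul]
        obtain ⟨y, hy⟩ := Ideal.Quotient.mk_surjective (h x)
        rw [← hy, Algebra.smul_def]
        change Ideal.Quotient.mk m r * _ = 0
        rw [Ideal.Quotient.eq_zero_iff_mem.2 hr, zero_mul]
      refine ⟨(LinearMap.ker p).liftQ h hh ∘ₗ (p.quotKerEquivOfSurjective hp).symm.toLinearMap, ?_⟩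
      ext x
      have : (p.quotKerEquivOfSurjective hp).symm (p x) = (LinearMap.ker p).mkQ x := by
        rw [LinearEquiv.symm_apply_eq]
        simp [LinearMap.quotKerEquivOfSurjective]
      simp [this]
  exact ⟨(LinearEquiv.ofBijective _ e1).trans (bP.constr S).symm⟩

theorem card_eq_of_equiv (m : Ideal S) (hm : m ≠ ⊤) {ι ι' : Type*} [Fintype ι] [Fintype ι']
    (e : (ι → S ⧸ m) ≃ₗ[S] (ι' → S ⧸ m)) : Fintype.card ι = Fintype.card ι' := by
  have : Nontrivial (S ⧸ m) := Ideal.Quotient.nontrivial_iff.2 hm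
  have e' : (ι → S ⧸ m) ≃ₗ[S ⧸ m] (ι' → S ⧸ m) :=
    e.extendScalarsOfSurjective (by exact Ideal.Quotient.mk_surjective)
  have := e'.finrank_eq
  simpa using this

theorem stab_gen (m : Ideal S) (a : ℕ) {P W : Type*} [AddCommGroup P] [Module S P]
    [AddCommGroup W] [Module S W]
    (f : P →ₗ[S] W) (hf : LinearMap.ker f ≤ m • (⊤ : Submodule S P)) :
    Function.Surjective (f.rangeRestrict.prodMap (LinearMap.id : (Fin a → S) →ₗ[S] _)) ∧
    LinearMap.ker (f.rangeRestrict.prodMap (LinearMap.id : (Fin a → S) →ₗ[S] _)) ≤ m • ⊤ ∧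
    Nonempty (LinearMap.ker (f.rangeRestrict.prodMap (LinearMap.id : (Fin a → S) →ₗ[S] _))
      ≃ₗ[S] LinearMap.ker f) := by
  have hker : LinearMap.ker (f.rangeRestrict.prodMap (LinearMap.id : (Fin a → S) →ₗ[S] _))
      = (LinearMap.ker f).map (LinearMap.inl S P (Fin a → S)) := by
    ext ⟨x, y⟩
    simp [eq_comm]
  refine ⟨?_, ?_, ?_⟩
  · rintro ⟨⟨_, x, rfl⟩, y⟩
    exact ⟨(x, y), rfl⟩
  · rw [hker]
    refine (Submodule.map_mono hf).trans ?_
    rw [Submodule.map_smul'']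
    exact Submodule.smul_mono le_rfl le_top
  · rw [hker]
    exact ⟨((LinearMap.ker f).equivMapOfInjective _ LinearMap.inl_injective).symm⟩

theorem step (m : Ideal S) (hm : m ≠ ⊤)
    {P P' W W' ι ι' : Type*} [AddCommGroup P] [Module S P] [AddCommGroup P'] [Module S P']
    [AddCommGroup W] [Module S W] [AddCommGroup W'] [Module S W'] [Fintype ι] [Fintype ι']
    (bP : Module.Basis ι S P) (bP' : Module.Basis ι' S P')
    (f : P →ₗ[S] W) (f' : P' →ₗ[S] W')
    (hf : LinearMap.ker f ≤ m • (⊤ : Submodule S P))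
    (hf' : LinearMap.ker f' ≤ m • (⊤ : Submodule S P'))
    (h : StabEq (LinearMap.range f) (LinearMap.range f')) :
    Fintype.card ι = Fintype.card ι' ∧ StabEq (LinearMap.ker f) (LinearMap.ker f') := by
  classical
  obtain ⟨a, ⟨e⟩⟩ := h
  obtain ⟨s1, k1, ⟨i1⟩⟩ := stab_gen m a f hf
  obtain ⟨s2, k2, ⟨i2⟩⟩ := stab_gen m a f' hf'
  set p := f.rangeRestrict.prodMap (LinearMap.id : (Fin a → S) →ₗ[S] _) with hpdef
  set p2 := f'.rangeRestrict.prodMap (LinearMap.id : (Fin a → S) →ₗ[S] _) with hp2def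
  let p' := e.symm.toLinearMap ∘ₗ p2
  have s2' : Function.Surjective p' := e.symm.surjective.comp s2
  have hk' : LinearMap.ker p' = LinearMap.ker p2 := by
    simp [p', LinearMap.ker_comp]
  let B1 := bP.prod (Pi.basisFun S (Fin a))
  let B2 := bP'.prod (Pi.basisFun S (Fin a))
  obtain ⟨h1⟩ := hom_equiv m B1 p s1 k1
  obtain ⟨h2⟩ := hom_equiv m B2 p' s2' (hk' ▸ k2)
  have hc := card_eq_of_equiv m hm (h1.symm.trans h2)
  have hc' : Fintype.card ι = Fintype.card ι' := by simpa using hc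
  refine ⟨hc', ?_⟩
  have : Module.Projective S (P × (Fin a → S)) := Module.Projective.of_basis B1
  have : Module.Projective S (P' × (Fin a → S)) := Module.Projective.of_basis B2
  obtain ⟨sch⟩ := schanuel p p' s1 s2'
  let j1 : (P × (Fin a → S)) ≃ₗ[S] (Fin (Fintype.card (ι ⊕ Fin a)) → S) :=
    (B1.reindex (Fintype.equivFin _)).equivFun
  let j2 : (P' × (Fin a → S)) ≃ₗ[S] (Fin (Fintype.card (ι ⊕ Fin a)) → S) :=
    (B2.reindex (Fintype.equivFinOfCardEq hc.symm)).equivFun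
  refine ⟨Fintype.card (ι ⊕ Fin a), ⟨?_⟩⟩
  exact ((i1.symm.prodCongr j2.symm).trans sch).trans
    (((LinearEquiv.ofEq _ _ hk').trans i2).prodCongr j1)

end uniq
end BettiTr

namespace BettiTr
open MvPolynomial Matrix

section lin
variable {k σ : Type*} [Field k]

theorem homComp_mul (e r : ℕ) {p : MvPolynomial σ k} (hp : p.IsHomogeneous e)
    (x : MvPolynomial σ k) :
    homogeneousComponent (e + r) (p * x) = p * homogeneousComponent r x := by
  conv_lhs => rw [← sum_homogeneousComponent x, Finset.mul_sum, map_sum]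
  have : ∀ i, homogeneousComponent (e + r) (p * homogeneousComponent i x)
      = if i = r then p * homogeneousComponent r x else 0 := by
    intro i
    rw [homogeneousComponent_of_mem (n := e + i)]
    · by_cases h : i = r
      · subst h; simp
      · rw [if_neg h, if_neg (by omega)]
    · exact hp.mul (homogeneousComponent_isHomogeneous i x)
  simp only [this, Finset.sum_ite_eq', Finset.mem_range]
  split_ifs with h
  · rfl
  · rw [homogeneousComponent_eq_zero, mul_zero]
    omega

/-- A finite linear free resolution of an ideal, recorded as one square matrix. -/
structure LinRes (I : Ideal (MvPolynomial σ k)) (t : ℕ) (B : Type) [Fintype B]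
    (deg : B → ℕ) (D : Matrix B B (MvPolynomial σ k)) (E : B → MvPolynomial σ k) : Prop where
  DD : D * D = 0
  ED : E ᵥ* D = 0
  exact : ∀ v, D *ᵥ v = 0 → E ⬝ᵥ v = 0 → ∃ w, D *ᵥ w = v
  range : ∀ x, x ∈ I ↔ ∃ v, E ⬝ᵥ v = x
  Dhom : ∀ c b, (D c b).IsHomogeneous 1
  Ddeg : ∀ c b, deg c + 1 ≠ deg b → D c b = 0
  Ehom : ∀ b, (E b).IsHomogeneous t
  Edeg : ∀ b, deg b ≠ 0 → E b = 0

variable {I A K : Ideal (MvPolynomial σ k)} {t : ℕ}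

theorem LinRes.range' {B : Type} [Fintype B] {deg : B → ℕ}
    {D : Matrix B B (MvPolynomial σ k)} {E : B → MvPolynomial σ k} (h : LinRes I t B deg D E)
    {x : MvPolynomial σ k} (hx : x ∈ I) : ∃ v, D *ᵥ v = 0 ∧ E ⬝ᵥ v = x := by
  obtain ⟨v, rfl⟩ := (h.range x).1 hx
  refine ⟨fun b => if deg b = 0 then v b else 0, ?_, ?_⟩
  · ext1 c
    refine Finset.sum_eq_zero fun b _ => ?_
    dsimp only
    split_ifs with hb
    · rw [h.Ddeg c b (by omega), zero_mul]
    · rw [mul_zero]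
  · refine Finset.sum_congr rfl fun b _ => ?_
    dsimp only
    split_ifs with hb
    · rfl
    · rw [h.Edeg b hb, zero_mul, zero_mul]

/-- Lifting the inclusion of ideals to a chain map with linear entries. -/
theorem LinRes.lift {BA BK : Type} [Fintype BA] [Fintype BK]
    {degA : BA → ℕ} {DA : Matrix BA BA (MvPolynomial σ k)} {EA : BA → MvPolynomial σ k}
    {degK : BK → ℕ} {DK : Matrix BK BK (MvPolynomial σ k)} {EK : BK → MvPolynomial σ k}
    (hA : LinRes A (t + 1) BA degA DA EA) (hK : LinRes K t BK degK DK EK) (hAK : A ≤ K) :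
    ∃ Φ : Matrix BK BA (MvPolynomial σ k), DK * Φ = Φ * DA ∧ EK ᵥ* Φ = EA ∧
      (∀ c b, (Φ c b).IsHomogeneous 1) ∧ (∀ c b, degK c ≠ degA b → Φ c b = 0) := by
  classical
  have key : ∀ N : ℕ, ∃ Φ : Matrix BK BA (MvPolynomial σ k),
      (∀ b, degA b < N → DK *ᵥ (fun c => Φ c b) = Φ *ᵥ (fun b' => DA b' b) ∧
        EK ⬝ᵥ (fun c => Φ c b) = EA b) ∧
      (∀ c b, (Φ c b).IsHomogeneous 1) ∧ (∀ c b, degK c ≠ degA b → Φ c b = 0) := by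
    intro N
    induction N with
    | zero =>
      refine ⟨0, ?_, ?_, ?_⟩
      · intro b hb; omega
      · intro c b; exact isHomogeneous_zero _ _ _
      · intro c b _; rfl
    | succ N ih =>
      obtain ⟨Φ, h1, h2, h3⟩ := ih
      have ex : ∀ b, degA b = N → ∃ w : BK → MvPolynomial σ k,
          DK *ᵥ w = Φ *ᵥ (fun b' => DA b' b) ∧ EK ⬝ᵥ w = EA b ∧
          (∀ c, (w c).IsHomogeneous 1) ∧ (∀ c, degK c ≠ N → w c = 0) := by
        intro b hb
        set v := Φ *ᵥ (fun b' => DA b' b) with hv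
        have vhom : ∀ c, (v c).IsHomogeneous 2 := by
          intro c
          refine IsHomogeneous.sum _ _ _ fun b' _ => ?_
          exact (h2 c b').mul (hA.Dhom b' b)
        have vdeg : ∀ c, degK c + 1 ≠ N → v c = 0 := by
          intro c hc
          refine Finset.sum_eq_zero fun b' _ => ?_
          by_cases hb' : degA b' + 1 = degA b
          · dsimp only
            rw [h3 c b' (by omega), zero_mul]
          · dsimp only
            rw [hA.Ddeg b' b hb', mul_zero]
        have hcol : DA *ᵥ (fun b' => DA b' b) = 0 := by
          ext1 c
          exact congrFun (congrFun hA.DD c) b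
        have dv : DK *ᵥ v = 0 := by
          have e1 : DK *ᵥ v = (Φ * DA) *ᵥ (fun b' => DA b' b) := by
            rw [hv, Matrix.mulVec_mulVec]
            ext1 c
            refine Finset.sum_congr rfl fun b' _ => ?_
            dsimp only
            by_cases hb' : degA b' + 1 = degA b
            · have := congrFun (h1 b' (by omega)).1 c
              congr 1
            · rw [hA.Ddeg b' b hb', mul_zero, mul_zero]
          rw [e1, ← Matrix.mulVec_mulVec, hcol, Matrix.mulVec_zero]
        have ev : EK ⬝ᵥ v = 0 := by
          have e1 : EK ⬝ᵥ v = EA ⬝ᵥ (fun b' => DA b' b) := by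
            rw [hv, Matrix.dotProduct_mulVec]
            refine Finset.sum_congr rfl fun b' _ => ?_
            dsimp only
            by_cases hb' : degA b' + 1 = degA b
            · have := (h1 b' (by omega)).2
              congr 1
            · rw [hA.Ddeg b' b hb', mul_zero, mul_zero]
          rw [e1]
          exact congrFun hA.ED b
        obtain ⟨w1, hw1⟩ := hK.exact v dv ev
        have hEA : EA b ∈ A := (hA.range _).2 ⟨Pi.single b 1, by simp⟩
        have hmem : EA b - EK ⬝ᵥ w1 ∈ K := K.sub_mem (hAK hEA) ((hK.range _).2 ⟨w1, rfl⟩)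
        obtain ⟨w0, hw0, hw0'⟩ := hK.range' hmem
        obtain ⟨w, hw, hw'⟩ : ∃ w, DK *ᵥ w = v ∧ EK ⬝ᵥ w = EA b :=
          ⟨w1 + w0, by rw [Matrix.mulVec_add, hw1, hw0, add_zero],
            by rw [dotProduct_add, hw0']; ring⟩
        refine ⟨fun c => if degK c = N then homogeneousComponent 1 (w c) else 0, ?_, ?_, ?_, ?_⟩
        · ext1 c
          by_cases hc : degK c + 1 = N
          · have e2 : v c = homogeneousComponent 2 (v c) :=
              (homogeneousComponent_eq_self (vhom c)).symm
            rw [e2, ← hw]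
            unfold Matrix.mulVec dotProduct
            rw [map_sum]
            refine Finset.sum_congr rfl fun b' _ => ?_
            dsimp only
            rw [show (2 : ℕ) = 1 + 1 from rfl, homComp_mul 1 1 (hK.Dhom c b')]
            split_ifs with h
            · rfl
            · rw [hK.Ddeg c b' (by omega), zero_mul, zero_mul]
          · rw [vdeg c hc]
            refine Finset.sum_eq_zero fun b' _ => ?_
            dsimp only
            split_ifs with h
            · rw [hK.Ddeg c b' (by omega), zero_mul]
            · rw [mul_zero]
        · by_cases hN : N = 0
          · have e2 : EA b = homogeneousComponent (t + 1) (EA b) :=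
              (homogeneousComponent_eq_self (hA.Ehom b)).symm
            rw [e2, ← hw']
            unfold dotProduct
            rw [map_sum]
            refine Finset.sum_congr rfl fun b' _ => ?_
            dsimp only
            rw [homComp_mul t 1 (hK.Ehom b')]
            split_ifs with h
            · rfl
            · rw [hK.Edeg b' (by omega), zero_mul, zero_mul]
          · rw [hA.Edeg b (by omega)]
            refine Finset.sum_eq_zero fun b' _ => ?_
            dsimp only
            split_ifs with h
            · rw [hK.Edeg b' (by omega), zero_mul]
            · rw [mul_zero]
        · intro c
          dsimp only
          split_ifs
          · exact homogeneousComponent_isHomogeneous _ _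
          · exact isHomogeneous_zero _ _ _
        · intro c hc
          exact if_neg hc
      choose! w hw1 hw2 hw3 hw4 using ex
      refine ⟨fun c b => if degA b = N then w b c else Φ c b, ?_, ?_, ?_⟩
      · intro b hb
        have e0 : (fun c b => if degA b = N then w b c else Φ c b : Matrix BK BA _) *ᵥ
            (fun b' => DA b' b) = Φ *ᵥ (fun b' => DA b' b) := by
          ext1 c
          refine Finset.sum_congr rfl fun b' _ => ?_
          dsimp only
          by_cases hb' : degA b' + 1 = degA b
          · rw [if_neg (by omega)]
          · rw [hA.Ddeg b' b hb', mul_zero, mul_zero]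
        rw [e0]
        by_cases hbN : degA b = N
        · simp only [hbN, if_true]
          exact ⟨hw1 b hbN, hw2 b hbN⟩
        · simp only [hbN, if_false]
          exact h1 b (by omega)
      · intro c b
        dsimp only
        split_ifs with h
        · exact hw3 b h c
        · exact h2 c b
      · intro c b hcb
        dsimp only
        split_ifs with h
        · exact hw4 b h c (by omega)
        · exact h3 c b hcb
  obtain ⟨Φ, h1, h2, h3⟩ := key (Finset.univ.sup degA + 1)
  have hlt : ∀ b, degA b < Finset.univ.sup degA + 1 := fun b =>
    Nat.lt_succ_of_le (Finset.le_sup (Finset.mem_univ b))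
  refine ⟨Φ, ?_, ?_, h2, h3⟩
  · ext1 c b
    exact congrFun (h1 b (hlt b)).1 c
  · ext1 b
    exact (h1 b (hlt b)).2

/-- The mapping cone. -/
theorem LinRes.cone {L : Ideal (MvPolynomial σ k)} {BA BK : Type} [Fintype BA] [Fintype BK]
    {degA : BA → ℕ} {DA : Matrix BA BA (MvPolynomial σ k)} {EA : BA → MvPolynomial σ k}
    {degK : BK → ℕ} {DK : Matrix BK BK (MvPolynomial σ k)} {EK : BK → MvPolynomial σ k}
    (hA : LinRes A (t + 1) BA degA DA EA) (hK : LinRes K t BK degK DK EK) (hAK : A ≤ K)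
    (y : σ) (hy : ∀ w, X y * w ∈ A → w ∈ A)
    (hL : L = A ⊔ Ideal.span {X y} * K) :
    ∃ D E, LinRes L (t + 1) (BA ⊕ (BK ⊕ BA))
      (Sum.elim degA (Sum.elim degK (fun a => degA a + 1))) D E := by
  classical
  obtain ⟨Φ, c1, c2, c3, c4⟩ := hA.lift hK hAK
  let Y : MvPolynomial σ k := X y
  have hY : Y.IsHomogeneous 1 := isHomogeneous_X _ _
  have hY0 : Y ≠ 0 := X_ne_zero y
  let D : Matrix (BA ⊕ (BK ⊕ BA)) (BA ⊕ (BK ⊕ BA)) (MvPolynomial σ k) := fun c b =>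
    match c, b with
    | .inl a, .inl a' => DA a a'
    | .inl _, .inr (.inl _) => 0
    | .inl a, .inr (.inr a') => if a = a' then Y else 0
    | .inr (.inl _), .inl _ => 0
    | .inr (.inl c), .inr (.inl c') => DK c c'
    | .inr (.inl c), .inr (.inr a') => Φ c a'
    | .inr (.inr _), .inl _ => 0
    | .inr (.inr _), .inr (.inl _) => 0
    | .inr (.inr a), .inr (.inr a') => - DA a a'
  let E : BA ⊕ (BK ⊕ BA) → MvPolynomial σ k :=
    Sum.elim EA (Sum.elim (fun c => - (Y * EK c)) 0)
  have Dv : ∀ a c a', D *ᵥ (Sum.elim a (Sum.elim c a')) =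
      Sum.elim (DA *ᵥ a + Y • a') (Sum.elim (DK *ᵥ c + Φ *ᵥ a') (- (DA *ᵥ a'))) := by
    intro a c a'
    ext1 i
    rcases i with i | i | i
    · simp [Matrix.mulVec, dotProduct, D]
    · simp [Matrix.mulVec, dotProduct, D]
    · simp [Matrix.mulVec, dotProduct, D]
  have Ev : ∀ a c a', E ⬝ᵥ (Sum.elim a (Sum.elim c a')) = EA ⬝ᵥ a - Y * (EK ⬝ᵥ c) := by
    intro a c a'
    simp [dotProduct, E, Finset.mul_sum, mul_assoc, sub_eq_add_neg]
  have split : ∀ v : BA ⊕ (BK ⊕ BA) → MvPolynomial σ k, ∃ a c a', v = Sum.elim a (Sum.elim c a') := by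
    intro v
    refine ⟨fun i => v (.inl i), fun i => v (.inr (.inl i)), fun i => v (.inr (.inr i)), ?_⟩
    ext1 i
    rcases i with i | i | i <;> rfl
  have DDA : ∀ v, DA *ᵥ (DA *ᵥ v) = 0 := fun v => by
    rw [Matrix.mulVec_mulVec, hA.DD, Matrix.zero_mulVec]
  have DDK : ∀ v, DK *ᵥ (DK *ᵥ v) = 0 := fun v => by
    rw [Matrix.mulVec_mulVec, hK.DD, Matrix.zero_mulVec]
  have EDA : ∀ v, EA ⬝ᵥ (DA *ᵥ v) = 0 := fun v => by
    rw [Matrix.dotProduct_mulVec, hA.ED, zero_dotProduct]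
  have EDK : ∀ v, EK ⬝ᵥ (DK *ᵥ v) = 0 := fun v => by
    rw [Matrix.dotProduct_mulVec, hK.ED, zero_dotProduct]
  have com : ∀ v, DK *ᵥ (Φ *ᵥ v) = Φ *ᵥ (DA *ᵥ v) := fun v => by
    rw [Matrix.mulVec_mulVec, c1, ← Matrix.mulVec_mulVec]
  have EΦ : ∀ v, EK ⬝ᵥ (Φ *ᵥ v) = EA ⬝ᵥ v := fun v => by
    rw [Matrix.dotProduct_mulVec, c2]
  have inj : ∀ {a c a' b d b'}, (Sum.elim a (Sum.elim c a') : BA ⊕ (BK ⊕ BA) → MvPolynomial σ k)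
      = Sum.elim b (Sum.elim d b') → a = b ∧ c = d ∧ a' = b' := by
    intro a c a' b d b' h
    refine ⟨?_, ?_, ?_⟩ <;> ext1 i
    · exact congrFun h (.inl i)
    · exact congrFun h (.inr (.inl i))
    · exact congrFun h (.inr (.inr i))
  have zer : (0 : BA ⊕ (BK ⊕ BA) → MvPolynomial σ k) =
      Sum.elim (fun _ => 0) (Sum.elim (fun _ => 0) (fun _ => 0)) := by
    ext1 i
    rcases i with i | i | i <;> rfl
  refine ⟨D, E, ?_, ?_, ?_, ?_, ?_, ?_, ?_, ?_⟩
  · refine Matrix.ext_of_mulVec_single fun i => ?_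
    obtain ⟨a, c, a', h⟩ := split (Pi.single i 1)
    rw [h, ← Matrix.mulVec_mulVec, Dv, Dv, Matrix.zero_mulVec, zer]
    congr 1
    · rw [Matrix.mulVec_add, DDA, Matrix.mulVec_smul, zero_add, smul_neg, add_neg_cancel]
      rfl
    · congr 1
      · rw [Matrix.mulVec_add, DDK, com, Matrix.mulVec_neg, zero_add, add_neg_cancel]
        rfl
      · rw [Matrix.mulVec_neg, DDA, neg_zero, neg_zero]
        rfl
  · ext1 i
    have : (E ᵥ* D) i = E ⬝ᵥ (D *ᵥ Pi.single i 1) := by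
      rw [Matrix.dotProduct_mulVec]; simp
    rw [this]
    obtain ⟨a, c, a', h⟩ := split (Pi.single i 1)
    rw [h, Dv, Ev, dotProduct_add, dotProduct_add, EDA, EDK, EΦ, dotProduct_smul]
    simp
  · intro v hv1 hv2
    obtain ⟨a, c, a', rfl⟩ := split v
    rw [Dv, zer] at hv1
    rw [Ev] at hv2
    obtain ⟨h1, h2, h3⟩ := inj hv1
    replace h1 : DA *ᵥ a + Y • a' = 0 := h1
    replace h2 : DK *ᵥ c + Φ *ᵥ a' = 0 := h2
    have h3 : DA *ᵥ a' = 0 := neg_eq_zero.1 h3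
    have h4 : EA ⬝ᵥ a' = 0 := by
      have := congrArg (fun z => EA ⬝ᵥ z) h1
      simp only [dotProduct_add, EDA, dotProduct_smul, dotProduct_zero, zero_add,
        smul_eq_mul] at this
      exact (mul_eq_zero.1 this).resolve_left hY0
    obtain ⟨w, hw⟩ := hA.exact a' h3 h4
    have h5 : EK ⬝ᵥ (c + Φ *ᵥ w) ∈ A := by
      apply hy
      have : X y * (EK ⬝ᵥ (c + Φ *ᵥ w)) = EA ⬝ᵥ (a + Y • w) := by
        rw [dotProduct_add, dotProduct_add, EΦ, dotProduct_smul, smul_eq_mul,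
          sub_eq_zero.1 hv2]
        change Y * _ = _
        ring
      rw [this]
      exact (hA.range _).2 ⟨_, rfl⟩
    obtain ⟨w0, hw0, hw0'⟩ := hA.range' h5
    obtain ⟨p, hp⟩ := hA.exact (a + Y • w - Y • w0)
      (by rw [Matrix.mulVec_sub, Matrix.mulVec_add, Matrix.mulVec_smul, Matrix.mulVec_smul,
            hw0, hw, h1, smul_zero, sub_zero])
      (by rw [dotProduct_sub, dotProduct_smul, hw0', dotProduct_add, dotProduct_add, EΦ,
            dotProduct_smul, sub_eq_zero.1 hv2, smul_eq_mul, smul_eq_mul]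
          ring)
    obtain ⟨r, hr⟩ := hK.exact (c + Φ *ᵥ w - Φ *ᵥ w0)
      (by rw [Matrix.mulVec_sub, Matrix.mulVec_add, com, com, hw0, hw, h2, Matrix.mulVec_zero,
            sub_zero])
      (by rw [dotProduct_sub, EΦ, hw0', sub_self])
    refine ⟨Sum.elim p (Sum.elim r (w0 - w)), ?_⟩
    rw [Dv, hp, hr]
    congr 1
    · rw [smul_sub]; abel
    · congr 1
      · rw [Matrix.mulVec_sub]; abel
      · rw [Matrix.mulVec_sub, hw0, hw, zero_sub, neg_neg]
  · intro x
    rw [hL, Submodule.mem_sup]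
    constructor
    · rintro ⟨u, hu, z, hz, rfl⟩
      obtain ⟨c, hc, rfl⟩ := Ideal.mem_span_singleton_mul.1 hz
      obtain ⟨a, rfl⟩ := (hA.range _).1 hu
      obtain ⟨d, rfl⟩ := (hK.range _).1 hc
      refine ⟨Sum.elim a (Sum.elim (-d) 0), ?_⟩
      rw [Ev, dotProduct_neg]
      change _ = _ + Y * _
      ring
    · rintro ⟨v, rfl⟩
      obtain ⟨a, c, a', rfl⟩ := split v
      refine ⟨EA ⬝ᵥ a, (hA.range _).2 ⟨_, rfl⟩, - (Y * (EK ⬝ᵥ c)), ?_, ?_⟩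
      · exact neg_mem (Ideal.mul_mem_mul (Ideal.mem_span_singleton_self _)
          ((hK.range _).2 ⟨_, rfl⟩))
      · rw [Ev, sub_eq_add_neg]
  · rintro (c | c | c) (b | b | b)
    · exact hA.Dhom c b
    · exact isHomogeneous_zero _ _ _
    · change (if c = b then Y else 0).IsHomogeneous 1
      split_ifs
      · exact hY
      · exact isHomogeneous_zero _ _ _
    · exact isHomogeneous_zero _ _ _
    · exact hK.Dhom c b
    · exact c3 c b
    · exact isHomogeneous_zero _ _ _
    · exact isHomogeneous_zero _ _ _
    · exact (hA.Dhom c b).neg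
  · rintro (c | c | c) (b | b | b) h
    · exact hA.Ddeg c b h
    · rfl
    · change (if c = b then Y else 0) = 0
      rw [if_neg]
      rintro rfl
      exact h rfl
    · rfl
    · exact hK.Ddeg c b h
    · exact c4 c b (fun h' => h (by simp [h']))
    · rfl
    · rfl
    · change - DA c b = 0
      rw [hA.Ddeg c b (fun h' => h (by simp [h'])), neg_zero]
  · rintro (b | b | b)
    · exact hA.Ehom b
    · rw [add_comm]
      exact (hY.mul (hK.Ehom b)).neg
    · exact isHomogeneous_zero _ _ _
  · rintro (b | b | b) h
    · exact hA.Edeg b h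
    · change - (Y * EK b) = 0
      rw [hK.Edeg b h, mul_zero, neg_zero]
    · rfl

/-- `I` has a linear resolution generated in degree `t` with Betti polynomial `p`. -/
def HasLin (I : Ideal (MvPolynomial σ k)) (t : ℕ) (p : Polynomial ℕ) : Prop :=
  ∃ (B : Type) (_ : Fintype B) (deg : B → ℕ) (D : Matrix B B (MvPolynomial σ k))
    (E : B → MvPolynomial σ k), LinRes I t B deg D E ∧
    (∑ b, (Polynomial.X : Polynomial ℕ) ^ deg b) = p

theorem HasLin.top : HasLin (⊤ : Ideal (MvPolynomial σ k)) 0 1 := by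
  refine ⟨Unit, inferInstance, fun _ => 0, 0, fun _ => 1, ⟨?_, ?_, ?_, ?_, ?_, ?_, ?_, ?_⟩, ?_⟩
  · simp
  · simp
  · intro v _ h
    refine ⟨0, ?_⟩
    ext1 i
    simpa [dotProduct] using h.symm
  · intro x
    simp only [Submodule.mem_top, true_iff]
    exact ⟨fun _ => x, by simp [dotProduct]⟩
  · intro c b; exact isHomogeneous_zero _ _ _
  · intro c b _; rfl
  · intro b; exact isHomogeneous_one _ _
  · intro b h; exact absurd rfl h
  · simp

theorem HasLin.bot (t : ℕ) : HasLin (⊥ : Ideal (MvPolynomial σ k)) t 0 := by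
  refine ⟨Empty, inferInstance, fun _ => 0, 0, fun _ => 1, ⟨?_, ?_, ?_, ?_, ?_, ?_, ?_, ?_⟩, ?_⟩
  · simp
  · simp
  · intro v _ h
    exact ⟨0, Subsingleton.elim _ _⟩
  · intro x
    simp [dotProduct, eq_comm]
  · intro c; exact c.elim
  · intro c; exact c.elim
  · intro c; exact c.elim
  · intro c; exact c.elim
  · simp

theorem HasLin.cone {L : Ideal (MvPolynomial σ k)} {p q : Polynomial ℕ}
    (hA : HasLin A (t + 1) p) (hK : HasLin K t q) (hAK : A ≤ K)
    (y : σ) (hy : ∀ w, X y * w ∈ A → w ∈ A)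
    (hL : L = A ⊔ Ideal.span {X y} * K) :
    HasLin L (t + 1) ((Polynomial.X + 1) * p + q) := by
  obtain ⟨BA, _, degA, DA, EA, hA, rfl⟩ := hA
  obtain ⟨BK, _, degK, DK, EK, hK, rfl⟩ := hK
  obtain ⟨D, E, h⟩ := hA.cone hK hAK y hy hL
  refine ⟨_, _, _, D, E, h, ?_⟩
  simp only [Fintype.sum_sum_type, Sum.elim_inl, Sum.elim_inr, pow_succ, ← Finset.sum_mul]
  ring

end lin
end BettiTr
namespace BettiTr
open MvPolynomial Matrix

section cmp
variable {k σ : Type*} [Field k]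

theorem irr_ne_top : (Ideal.span (Set.range (X : σ → MvPolynomial σ k))) ≠ ⊤ := by
  intro h
  have h1 : (Ideal.span (Set.range (X : σ → MvPolynomial σ k)))
      ≤ RingHom.ker (constantCoeff : MvPolynomial σ k →+* k) := by
    rw [Ideal.span_le]
    rintro _ ⟨i, rfl⟩
    simp [RingHom.mem_ker]
  rw [h, top_le_iff] at h1
  have : (1 : MvPolynomial σ k) ∈ RingHom.ker (constantCoeff : MvPolynomial σ k →+* k) := by
    rw [h1]; trivial
  simp [RingHom.mem_ker] at this

theorem mem_irr {p : MvPolynomial σ k} (hp : p.IsHomogeneous 1) :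
    p ∈ Ideal.span (Set.range (X : σ → MvPolynomial σ k)) := by
  rw [← Set.image_univ, mem_ideal_span_X_image]
  intro m hm
  have := hp (mem_support_iff.1 hm)
  by_contra hcon
  push Not at hcon
  have hm0 : m = 0 := by
    ext i
    simpa using hcon i (Set.mem_univ _)
  subst hm0
  simp at this

theorem pi_mem_smul_top {S ι : Type*} [CommRing S] [Fintype ι] (m : Ideal S) (v : ι → S)
    (h : ∀ i, v i ∈ m) : v ∈ m • (⊤ : Submodule S (ι → S)) := by
  classical
  rw [pi_eq_sum_univ v]
  exact Submodule.sum_mem _ fun i _ => Submodule.smul_mem_smul (h i) trivial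

theorem betti_eq {I : Ideal (MvPolynomial σ k)} {t : ℕ} {p : Polynomial ℕ}
    (F : MinimalFreeResolution (MvPolynomial σ k) (Ideal.span (Set.range MvPolynomial.X)) I)
    (h : HasLin I t p) (q : ℕ) : F.β q = p.coeff q := by
  classical
  obtain ⟨B, _, deg, D, E, h, rfl⟩ := h
  let m : Ideal (MvPolynomial σ k) := Ideal.span (Set.range MvPolynomial.X)
  have hm : m ≠ ⊤ := irr_ne_top
  have hcoef : (∑ b, (Polynomial.X : Polynomial ℕ) ^ deg b).coeff q
      = Fintype.card {b // deg b = q} := by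
    rw [Polynomial.finsetSum_coeff, Fintype.card_subtype, Finset.card_filter]
    refine Finset.sum_congr rfl fun b _ => ?_
    rw [Polynomial.coeff_X_pow]
    simp [eq_comm]
  rw [hcoef]
  let G : ℕ → Type := fun q => {b // deg b = q}
  let f0 : (G 0 → MvPolynomial σ k) →ₗ[MvPolynomial σ k] MvPolynomial σ k :=
    Fintype.linearCombination (MvPolynomial σ k) (fun b : G 0 => E b.1)
  let f : ∀ q, (G (q + 1) → MvPolynomial σ k) →ₗ[MvPolynomial σ k] (G q → MvPolynomial σ k) :=
    fun q => (D.submatrix (fun c : G q => c.1) (fun c : G (q + 1) => c.1)).mulVecLin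
  have sumG : ∀ (q : ℕ) (g : B → MvPolynomial σ k), (∀ b, deg b ≠ q → g b = 0) →
      ∑ b : G q, g b.1 = ∑ b, g b := by
    intro q g hg
    rw [← Finset.sum_subtype (Finset.univ.filter fun b => deg b = q) (by simp) g,
      Finset.sum_filter]
    refine Finset.sum_congr rfl fun b _ => ?_
    split_ifs with hb
    · rfl
    · rw [hg b hb]
  have f0v : ∀ w : B → MvPolynomial σ k, f0 (fun b => w b.1) = E ⬝ᵥ w := by
    intro w
    refine Eq.trans ?_ (sumG 0 (fun b => E b * w b) fun b hb => by rw [h.Edeg b hb, zero_mul])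
    simp only [f0, Fintype.linearCombination_apply, smul_eq_mul]
    exact Finset.sum_congr rfl fun b _ => mul_comm _ _
  have fv : ∀ q (w : B → MvPolynomial σ k), f q (fun b => w b.1) = fun c : G q => (D *ᵥ w) c.1 := by
    intro q w
    ext1 c
    exact sumG (q + 1) (fun b => D c.1 b * w b) fun b hb => by
      rw [h.Ddeg c.1 b (by have := c.2; omega), zero_mul]
  let ext0 : ∀ q, (G q → MvPolynomial σ k) → (B → MvPolynomial σ k) :=
    fun q v b => if hb : deg b = q then v ⟨b, hb⟩ else 0
  have ext0v : ∀ q v, (fun b : G q => ext0 q v b.1) = v := by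
    intro q v
    ext1 b
    simp [ext0, b.2]
  have ext0z : ∀ q v b, deg b ≠ q → ext0 q v b = 0 := by
    intro q v b hb
    simp [ext0, hb]
  have DDv : ∀ v, D *ᵥ (D *ᵥ v) = 0 := fun v => by
    rw [Matrix.mulVec_mulVec, h.DD, Matrix.zero_mulVec]
  have EDv : ∀ v, E ⬝ᵥ (D *ᵥ v) = 0 := fun v => by
    rw [Matrix.dotProduct_mulVec, h.ED, zero_dotProduct]
  have r0 : LinearMap.range f0 = I := by
    ext x
    rw [LinearMap.mem_range, h.range]
    constructor
    · rintro ⟨v, rfl⟩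
      exact ⟨ext0 0 v, by rw [← f0v, ext0v]⟩
    · rintro ⟨w, rfl⟩
      exact ⟨_, f0v w⟩
  have ex0 : LinearMap.ker f0 = LinearMap.range (f 0) := by
    ext v
    rw [LinearMap.mem_ker, LinearMap.mem_range]
    constructor
    · intro hv
      rw [← ext0v 0 v, f0v] at hv
      have hd : D *ᵥ ext0 0 v = 0 := by
        ext1 c
        refine Finset.sum_eq_zero fun b _ => ?_
        dsimp only
        by_cases hb : deg b = 0
        · rw [h.Ddeg c b (by omega), zero_mul]
        · rw [ext0z 0 v b hb, mul_zero]
      obtain ⟨w, hw⟩ := h.exact _ hd hv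
      exact ⟨fun b => w b.1, by rw [fv, hw, ext0v]⟩
    · rintro ⟨w, rfl⟩
      rw [← ext0v 1 w]
      erw [fv 0]
      rw [f0v, EDv]
  have ex1 : ∀ q, LinearMap.ker (f q) = LinearMap.range (f (q + 1)) := by
    intro q
    ext v
    rw [LinearMap.mem_ker, LinearMap.mem_range]
    constructor
    · intro hv
      rw [← ext0v (q + 1) v, fv] at hv
      have hd : D *ᵥ ext0 (q + 1) v = 0 := by
        ext1 c
        by_cases hc : deg c = q
        · exact congrFun hv ⟨c, hc⟩
        · refine Finset.sum_eq_zero fun b _ => ?_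
          dsimp only
          by_cases hb : deg b = q + 1
          · rw [h.Ddeg c b (by omega), zero_mul]
          · rw [ext0z _ v b hb, mul_zero]
      have he : E ⬝ᵥ ext0 (q + 1) v = 0 := by
        refine Finset.sum_eq_zero fun b _ => ?_
        by_cases hb : deg b = q + 1
        · rw [h.Edeg b (by omega), zero_mul]
        · rw [ext0z _ v b hb, mul_zero]
      obtain ⟨w, hw⟩ := h.exact _ hd he
      exact ⟨fun b => w b.1, by rw [fv, hw, ext0v]⟩
    · rintro ⟨w, rfl⟩
      rw [← ext0v (q + 1 + 1) w, fv, fv, DDv]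
      rfl
  have mn : ∀ q, LinearMap.range (f q) ≤ m • (⊤ : Submodule _ (G q → MvPolynomial σ k)) := by
    rintro q _ ⟨v, rfl⟩
    refine pi_mem_smul_top m _ fun c => ?_
    refine Ideal.sum_mem _ fun b _ => ?_
    exact Ideal.mul_mem_right _ _ (mem_irr (h.Dhom _ _))
  have start : StabEq (LinearMap.range (I.subtype ∘ₗ F.ε)) (LinearMap.range f0) := by
    rw [r0, LinearMap.range_comp, LinearMap.range_eq_top.2 F.surj, Submodule.map_subtype_top]
    exact ⟨0, ⟨LinearEquiv.refl _ _⟩⟩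
  have kε : LinearMap.ker (I.subtype ∘ₗ F.ε) = LinearMap.range (F.d 0) := by
    rw [LinearMap.ker_comp, Submodule.ker_subtype, ← F.exact_zero]
    rfl
  have s0 := step m hm Finsupp.basisSingleOne (Pi.basisFun (MvPolynomial σ k) (G 0))
    (I.subtype ∘ₗ F.ε) f0 (by rw [kε]; exact F.minimal 0) (by rw [ex0]; exact mn 0) start
  rw [kε, ex0] at s0
  have main : ∀ q, F.β q = Fintype.card (G q) ∧
      StabEq (LinearMap.range (F.d q)) (LinearMap.range (f q)) := by
    intro q
    induction q with
    | zero => simpa using s0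
    | succ q ih =>
      have s1 := step m hm Finsupp.basisSingleOne (Pi.basisFun (MvPolynomial σ k) (G (q + 1)))
        (F.d q) (f q) (by rw [F.exact]; exact F.minimal (q + 1))
        (by rw [ex1]; exact mn (q + 1)) ih.2
      rw [F.exact, ex1] at s1
      simpa using s1
  exact (main q).1

end cmp
end BettiTr
namespace BettiTr
open MvPolynomial

section ideals
variable {k : Type*} [Field k]

/-- The ideal generated by the monomials with exponents in `s`. -/
noncomputable def Imon (k : Type*) [Field k] {σ : Type*} (s : Set (σ →₀ ℕ)) :
    Ideal (MvPolynomial σ k) :=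
  Ideal.span ((fun e => monomial e (1 : k)) '' s)

theorem Imon_colon {σ : Type*} {s : Set (σ →₀ ℕ)} (y : σ) (hs : ∀ e ∈ s, e y = 0)
    (w : MvPolynomial σ k) (h : X y * w ∈ Imon k s) : w ∈ Imon k s := by
  classical
  unfold Imon at *
  rw [mem_ideal_span_monomial_image] at *
  intro x hx
  obtain ⟨e, he, hle⟩ := h (Finsupp.single y 1 + x) (by
    rw [mem_support_iff, coeff_X_mul]
    exact mem_support_iff.1 hx)
  refine ⟨e, he, fun i => ?_⟩
  by_cases hi : i = y
  · subst hi; rw [hs e he]; exact Nat.zero_le _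
  · have := hle i
    rw [Finsupp.add_apply, Finsupp.single_eq_of_ne hi, zero_add] at this
    exact this

theorem Imon_le {σ : Type*} {s s' : Set (σ →₀ ℕ)} (h : ∀ e ∈ s, ∃ e' ∈ s', e' ≤ e) :
    Imon k s ≤ Imon k s' := by
  unfold Imon
  rw [Ideal.span_le]
  rintro _ ⟨e, he, rfl⟩
  obtain ⟨e', he', hle⟩ := h e he
  rw [SetLike.mem_coe, mem_ideal_span_monomial_image]
  intro x hx
  have := support_monomial_subset hx
  rw [Finset.mem_singleton] at this
  subst this
  exact ⟨e', he', hle⟩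

variable {n b : ℕ}

/-- Exponents of transversal monomials of degree `t` in the first `m` blocks. -/
def G0 (n b t m : ℕ) : Set (Fin n × Fin b →₀ ℕ) :=
  {e | ∃ T : Finset (Fin n), T.card = t ∧ (∀ i ∈ T, i.val < m) ∧ ∃ j : Fin n → Fin b,
    e = ∑ i ∈ T, Finsupp.single (i, j i) 1}

/-- Intermediate sets of exponents. -/
def G1 (n b t : ℕ) (m : Fin n) (j0 : ℕ) : Set (Fin n × Fin b →₀ ℕ) :=
  G0 n b (t + 1) m ∪ {e | ∃ e' ∈ G0 n b t m, ∃ j : Fin b, j.val < j0 ∧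
    e = Finsupp.single (m, j) 1 + e'}

theorem G0_le {t m : ℕ} {e : Fin n × Fin b →₀ ℕ} (he : e ∈ G0 n b (t + 1) m) :
    ∃ e' ∈ G0 n b t m, e' ≤ e := by
  obtain ⟨T, hT, hm, j, rfl⟩ := he
  obtain ⟨i, hi⟩ : T.Nonempty := by rw [← Finset.card_pos]; omega
  refine ⟨_, ⟨T.erase i, ?_, fun i' h => hm i' (Finset.mem_of_mem_erase h), j, rfl⟩, ?_⟩
  · rw [Finset.card_erase_of_mem hi, hT]; rfl
  · rw [← Finset.add_sum_erase T _ hi]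
    exact le_add_self

theorem G0_apply {t m : ℕ} {e : Fin n × Fin b →₀ ℕ} (he : e ∈ G0 n b t m)
    (i : Fin n) (j : Fin b) (hi : m ≤ i.val) : e (i, j) = 0 := by
  obtain ⟨T, hT, hm, j', rfl⟩ := he
  rw [Finsupp.finsetSum_apply]
  refine Finset.sum_eq_zero fun i' hi' => ?_
  refine Finsupp.single_eq_of_ne ?_
  intro h
  have := hm i' hi'
  have h2 : i = i' := congrArg Prod.fst h
  subst h2
  omega

theorem G1_zero (t : ℕ) (m : Fin n) : G1 n b t m 0 = G0 n b (t + 1) m := by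
  ext e
  simp [G1]

theorem G1_last (t : ℕ) (m : Fin n) : G1 n b t m b = G0 n b (t + 1) (m + 1) := by
  classical
  ext e
  constructor
  · rintro (⟨T, hT, hm, j, rfl⟩ | ⟨_, ⟨T, hT, hm, j, rfl⟩, l, _, rfl⟩)
    · exact ⟨T, hT, fun i hi => Nat.lt_succ_of_lt (hm i hi), j, rfl⟩
    · have hmT : m ∉ T := fun h => lt_irrefl _ (hm m h)
      refine ⟨insert m T, by rw [Finset.card_insert_of_notMem hmT, hT], ?_,
        Function.update j m l, ?_⟩
      · intro i hi
        rcases Finset.mem_insert.1 hi with rfl | hi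
        · exact Nat.lt_succ_self _
        · exact Nat.lt_succ_of_lt (hm i hi)
      · rw [Finset.sum_insert hmT, Function.update_self]
        congr 1
        refine Finset.sum_congr rfl fun i hi => ?_
        rw [Function.update_of_ne]
        rintro rfl
        exact hmT hi
  · rintro ⟨T, hT, hm, j, rfl⟩
    have hlt : ∀ i ∈ T, i ≠ m → i.val < m.val := by
      intro i hi hne
      have := hm i hi
      have h2 : i.val ≠ m.val := fun h => hne (Fin.ext h)
      omega
    by_cases hmT : m ∈ T
    · right
      refine ⟨_, ⟨T.erase m, ?_, ?_, j, rfl⟩, j m, (j m).2, ?_⟩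
      · rw [Finset.card_erase_of_mem hmT, hT]; rfl
      · intro i hi
        exact hlt i (Finset.mem_of_mem_erase hi) (Finset.ne_of_mem_erase hi)
      · rw [Finset.add_sum_erase T (fun i => Finsupp.single (i, j i) 1) hmT]
    · left
      refine ⟨T, hT, fun i hi => hlt i hi ?_, j, rfl⟩
      rintro rfl
      exact hmT hi

theorem Imon_G1_succ (t : ℕ) (m : Fin n) (j : Fin b) :
    Imon k (G1 n b t m (j + 1)) =
      Imon k (G1 n b t m j) ⊔ Ideal.span {X (m, j)} * Imon k (G0 n b t m) := by
  unfold Imon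
  rw [Ideal.span_mul_span', ← Ideal.span_union]
  congr 1
  ext p
  constructor
  · rintro ⟨e, (he | ⟨e', he', l, hl, rfl⟩), rfl⟩
    · exact Or.inl ⟨e, Or.inl he, rfl⟩
    · by_cases hlj : l.val < j.val
      · exact Or.inl ⟨_, Or.inr ⟨e', he', l, hlj, rfl⟩, rfl⟩
      · have : l = j := Fin.ext (by omega)
        subst this
        right
        refine Set.mem_mul.2 ⟨_, rfl, _, ⟨e', he', rfl⟩, ?_⟩
        simp [X, monomial_mul]
  · rintro (⟨e, (he | ⟨e', he', l, hl, rfl⟩), rfl⟩ | hp)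
    · exact ⟨e, Or.inl he, rfl⟩
    · exact ⟨_, Or.inr ⟨e', he', l, by omega, rfl⟩, rfl⟩
    · obtain ⟨_, rfl, _, ⟨e', he', rfl⟩, rfl⟩ := Set.mem_mul.1 hp
      refine ⟨_, Or.inr ⟨e', he', j, by omega, rfl⟩, ?_⟩
      simp [X, monomial_mul]

/-- The Betti polynomials, by recursion. -/
noncomputable def P (b : ℕ) : ℕ → ℕ → Polynomial ℕ
  | 0, _ => 1
  | _ + 1, 0 => 0
  | t + 1, m + 1 => (Polynomial.X + 1) ^ b * P b (t + 1) m
      + (∑ i ∈ Finset.range b, (Polynomial.X + 1) ^ i) * P b t m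

theorem Imon_top (hb : 0 < b) (m : ℕ) : Imon k (G0 n b 0 m) = ⊤ := by
  rw [Ideal.eq_top_iff_one]
  exact Ideal.subset_span ⟨0, ⟨∅, rfl, by simp, fun _ => ⟨0, hb⟩, by simp⟩, rfl⟩

theorem hasLin_main (hb : 0 < b) : ∀ m ≤ n, ∀ t, HasLin (Imon k (G0 n b t m)) t (P b t m) := by
  intro m
  induction m with
  | zero =>
    intro _ t
    rcases t with _ | t
    · rw [Imon_top hb, P]
      exact HasLin.top
    · have : G0 n b (t + 1) 0 = ∅ := by
        ext e
        simp only [Set.mem_empty_iff_false, iff_false]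
        rintro ⟨T, hT, hm, _⟩
        obtain ⟨i, hi⟩ : T.Nonempty := by rw [← Finset.card_pos]; omega
        exact absurd (hm i hi) (by omega)
      rw [this, P, Imon, Set.image_empty, Ideal.span_empty]
      exact HasLin.bot _
  | succ m ih =>
    intro hm t
    rcases t with _ | t
    · rw [Imon_top hb, P]
      exact HasLin.top
    · have inner : ∀ j ≤ b, HasLin (Imon k (G1 n b t ⟨m, hm⟩ j)) (t + 1)
          ((Polynomial.X + 1) ^ j * P b (t + 1) m
            + (∑ i ∈ Finset.range j, (Polynomial.X + 1) ^ i) * P b t m) := by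
        intro j
        induction j with
        | zero =>
          intro _
          rw [G1_zero]
          simpa using ih (by omega) (t + 1)
        | succ j ihj =>
          intro hj
          have h1 := ihj (by omega)
          have h2 := ih (by omega) t
          have h3 := HasLin.cone (y := ((⟨m, hm⟩ : Fin n), (⟨j, hj⟩ : Fin b))) h1 h2 ?_ ?_
            (Imon_G1_succ t ⟨m, hm⟩ ⟨j, hj⟩)
          · convert h3 using 1
            rw [geom_sum_succ]
            ring
          · refine Imon_le ?_
            rintro e (he | ⟨e', he', l, hl, rfl⟩)
            · exact G0_le he
            · exact ⟨e', he', le_add_self⟩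
          · refine Imon_colon _ ?_
            rintro e (he | ⟨e', he', l, hl, rfl⟩)
            · exact G0_apply he _ _ le_rfl
            · rw [Finsupp.add_apply, G0_apply he' _ _ le_rfl, add_zero]
              refine Finsupp.single_eq_of_ne ?_
              intro h
              have := congrArg (fun x => x.2.val) h
              simp only at this
              omega
      have := inner b le_rfl
      rw [G1_last] at this
      rw [P]
      exact this

end ideals
end BettiTr
namespace BettiTr
open Finset

section comb

/-- The polynomial `(1+X)^b - 1`. -/
noncomputable def U (b : ℕ) : Polynomial ℕ :=
  (∑ i ∈ range b, (Polynomial.X + 1) ^ i) * Polynomial.X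

theorem U_add_one (b : ℕ) : U b + 1 = (Polynomial.X + 1) ^ b := geom_sum_mul_add _ _

theorem U_coeff (b r : ℕ) : (U b).coeff r = if 1 ≤ r then b.choose r else 0 := by
  rcases r with _ | r
  · simp [U]
  · have := congrArg (fun p => p.coeff (r + 1)) (U_add_one b)
    simp only [Polynomial.coeff_add, Polynomial.coeff_one] at this
    rw [Polynomial.coeff_X_add_one_pow] at this
    simpa using this

theorem U_pow_coeff (b s N : ℕ) : (U b ^ s).coeff N =
    ∑ r ∈ (Finset.Nat.antidiagonalTuple s N).filter (fun r => ∀ v, 1 ≤ r v),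
      ∏ v, b.choose (r v) := by
  have h : (U b ^ s).coeff N = ∑ r ∈ Finset.Nat.antidiagonalTuple s N,
      ∏ v, (U b).coeff (r v) := by
    rw [← Polynomial.coeff_coe, Polynomial.coe_pow]
    have : ((U b : PowerSeries ℕ)) ^ s = ∏ _v : Fin s, (U b : PowerSeries ℕ) := by simp
    rw [this, PowerSeries.coeff_prod]
    rw [← Finset.piAntidiag_univ_fin_eq_antidiagonalTuple]
    simp only [Polynomial.coeff_coe]
    refine Finset.sum_bij' (fun f _ => (f : Fin s → ℕ)) (fun f _ => Finsupp.equivFunOnFinite.symm f)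
      ?_ ?_ ?_ ?_ ?_
    · intro f hf; simpa using hf
    · intro f hf; simpa using hf
    · intro f hf; ext; simp
    · intro f hf; ext; simp
    · intro f hf; rfl
  rw [h, Finset.sum_filter]
  refine Finset.sum_congr rfl fun r _ => ?_
  split_ifs with hr
  · exact Finset.prod_congr rfl fun v _ => by rw [U_coeff, if_pos (hr v)]
  · push Not at hr
    obtain ⟨v, hv⟩ := hr
    exact Finset.prod_eq_zero (Finset.mem_univ v) (by rw [U_coeff, if_neg (by omega)])

/-- coefficients -/
def cc : ℕ → ℕ → ℕ → ℕ
  | 0, _, 0 => 1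
  | 0, _, _ + 1 => 0
  | _ + 1, _, 0 => 0
  | t + 1, m, s + 1 => s.choose t * m.choose (s + 1)

theorem cc_rec (t m s : ℕ) : cc (t + 1) (m + 1) (s + 1)
    = cc (t + 1) m (s + 1) + cc (t + 1) m s + cc t m s := by
  rcases s with _ | s <;> rcases t with _ | t
  · simp [cc]
  · simp [cc]
  · simp [cc, Nat.choose_succ_succ]; ring
  · simp only [cc, Nat.choose_succ_succ s t, Nat.choose_succ_succ m (s + 1)]; ring

theorem P_eq (b t m M : ℕ) (hM : m ≤ M) :
    Polynomial.X ^ t * P b t m = ∑ s ∈ range (M + 1), Polynomial.C (cc t m s) * U b ^ s := by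
  induction m generalizing t M with
  | zero =>
    rcases t with _ | t
    · rw [Finset.sum_eq_single 0]
      · simp [cc, P]
      · intro s _ hs
        obtain ⟨s, rfl⟩ := Nat.exists_eq_succ_of_ne_zero hs
        simp [cc]
      · simp
    · rw [P, mul_zero]
      symm
      refine Finset.sum_eq_zero fun s _ => ?_
      rcases s with _ | s <;> simp [cc]
  | succ m ih =>
    rcases t with _ | t
    · rw [Finset.sum_eq_single 0]
      · simp [cc, P]
      · intro s _ hs
        obtain ⟨s, rfl⟩ := Nat.exists_eq_succ_of_ne_zero hs
        simp [cc]
      · simp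
    · obtain ⟨M, rfl⟩ : ∃ M', M = M' + 1 := ⟨M - 1, by omega⟩
      have e1 : Polynomial.X ^ (t + 1) * P b (t + 1) (m + 1) =
          Polynomial.X ^ (t + 1) * P b (t + 1) m
          + U b * (Polynomial.X ^ (t + 1) * P b (t + 1) m)
          + U b * (Polynomial.X ^ t * P b t m) := by
        rw [P, ← U_add_one, U]
        ring
      have e2 : Polynomial.X ^ (t + 1) * P b (t + 1) m =
          ∑ s ∈ range (M + 1), Polynomial.C (cc (t + 1) m (s + 1)) * U b ^ (s + 1) := by
        rw [ih (t + 1) (M + 1) (by omega), Finset.sum_range_succ']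
        have z : cc (t + 1) m 0 = 0 := rfl
        rw [z, map_zero, zero_mul, add_zero]
      have : ∀ s, Polynomial.C (cc (t + 1) (m + 1) (s + 1)) * U b ^ (s + 1)
        = Polynomial.C (cc (t + 1) m (s + 1)) * U b ^ (s + 1)
          + U b * (Polynomial.C (cc (t + 1) m s) * U b ^ s)
          + U b * (Polynomial.C (cc t m s) * U b ^ s) := by
        intro s
        rw [cc_rec, Polynomial.C_add, Polynomial.C_add]
        ring
      have z : cc (t + 1) (m + 1) 0 = 0 := rfl
      rw [Finset.sum_range_succ', z, map_zero, zero_mul, add_zero,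
        Finset.sum_congr rfl fun s _ => this s, Finset.sum_add_distrib, Finset.sum_add_distrib,
        ← Finset.mul_sum, ← Finset.mul_sum, ← e2, ← ih (t + 1) M (by omega),
        ← ih t M (by omega), e1]

theorem P_coeff (b t n q : ℕ) (ht : 1 ≤ t) : (P b t n).coeff q =
    ∑ s ∈ Finset.Icc t (t + q), (s - 1).choose (t - 1) * n.choose s *
          ∑ r ∈ (Finset.Nat.antidiagonalTuple s (t + q)).filter (fun r => ∀ v, 1 ≤ r v),
            ∏ v, b.choose (r v) := by
  have h1 : (P b t n).coeff q = (Polynomial.X ^ t * P b t n).coeff (t + q) := by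
    rw [add_comm, Polynomial.coeff_X_pow_mul]
  rw [h1, P_eq b t n (n + t + q) (by omega), Polynomial.finsetSum_coeff]
  have hcc : ∀ s, 1 ≤ s → cc t n s = (s - 1).choose (t - 1) * n.choose s := by
    intro s hs
    obtain ⟨s, rfl⟩ : ∃ s', s = s' + 1 := ⟨s - 1, by omega⟩
    obtain ⟨t, rfl⟩ : ∃ s', t = s' + 1 := ⟨t - 1, by omega⟩
    rfl
  symm
  refine Eq.trans (Finset.sum_congr rfl fun s hs => ?_) (Finset.sum_subset
    (f := fun s => (Polynomial.C (cc t n s) * U b ^ s).coeff (t + q)) ?_ ?_)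
  · rw [Finset.mem_Icc] at hs
    rw [Polynomial.coeff_C_mul, U_pow_coeff, hcc s (by omega)]
  · intro s hs
    rw [Finset.mem_Icc] at hs
    rw [Finset.mem_range]; omega
  · intro s _ hs
    rw [Finset.mem_Icc] at hs
    rw [Polynomial.coeff_C_mul]
    by_cases h : s < t
    · rcases Nat.eq_zero_or_pos s with rfl | h0
      · obtain ⟨t, rfl⟩ : ∃ s', t = s' + 1 := ⟨t - 1, by omega⟩
        simp [cc]
      · rw [hcc s h0, Nat.choose_eq_zero_of_lt (by omega), zero_mul, zero_mul]
    · rw [U, mul_pow, Polynomial.coeff_mul_X_pow', if_neg (by omega), mul_zero]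

end comb
end BettiTr
/-- Proposition 2.4 in the equal-block-size case `b_1 = ⋯ = b_n = b`. The transversal
monomial ideal `I_t(D)` lives in `k[y_{i,j} : 1 ≤ i ≤ n, 1 ≤ j ≤ b]` and is generated by
the monomials `y_{i_1,j_1}⋯y_{i_t,j_t}` with `i_1 < ⋯ < i_t`. Then
`β_q(I_t(D)) = ∑_{s=t}^{t+q} C(s−1, t−1)·C(n, s)·
   ∑_{r_1+⋯+r_s=t+q, r_v ≥ 1} C(b, r_1)⋯C(b, r_s)`. -/
theorem betti_transversal_equal_blocks {k : Type*} [Field k] (n t b : ℕ)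
    (ht : 1 ≤ t) (htn : t ≤ n)
    (F : MinimalFreeResolution (MvPolynomial (Fin n × Fin b) k)
      (Ideal.span (Set.range MvPolynomial.X))
      (Ideal.span {p : MvPolynomial (Fin n × Fin b) k |
        ∃ T : Finset (Fin n), T.card = t ∧
          ∃ j : Fin n → Fin b,
            p = MvPolynomial.monomial (∑ i ∈ T, Finsupp.single (i, j i) 1) 1}))
    (q : ℕ) :
    F.β q
      = ∑ s ∈ Finset.Icc t (t + q), (s - 1).choose (t - 1) * n.choose s *
          ∑ r ∈ (Finset.Nat.antidiagonalTuple s (t + q)).filter (fun r => ∀ v, 1 ≤ r v),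
            ∏ v, b.choose (r v) := by
  have key : (F.β q) = (BettiTr.P b t n).coeff q := by
    rcases Nat.eq_zero_or_pos b with rfl | hb
    · have hP : BettiTr.P 0 t n = 0 := by
        clear F
        obtain ⟨t, rfl⟩ : ∃ t', t = t' + 1 := ⟨t - 1, by omega⟩
        clear ht htn
        induction n with
        | zero => rw [BettiTr.P]
        | succ n ih => rw [BettiTr.P, ih]; simp
      rw [hP]
      refine BettiTr.betti_eq F (t := t) ?_ q
      have hI : ({p : MvPolynomial (Fin n × Fin 0) k |
        ∃ T : Finset (Fin n), T.card = t ∧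
          ∃ j : Fin n → Fin 0,
            p = MvPolynomial.monomial (∑ i ∈ T, Finsupp.single (i, j i) 1) 1}) = ∅ := by
        ext p
        simp only [Set.mem_ofPred_eq, Set.mem_empty_iff_false, iff_false]
        rintro ⟨T, _, j, _⟩
        exact (j ⟨0, by omega⟩).elim0
      rw [hI, Ideal.span_empty]
      exact BettiTr.HasLin.bot t
    · refine BettiTr.betti_eq F (t := t) ?_ q
      have h := BettiTr.hasLin_main (k := k) (n := n) hb n le_rfl t
      convert h using 1
      unfold BettiTr.Imon
      congr 1
      ext p
      constructor
      · rintro ⟨T, hT, j, rfl⟩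
        exact ⟨_, ⟨T, hT, fun i _ => i.2, j, rfl⟩, rfl⟩
      · rintro ⟨_, ⟨T, hT, _, j, rfl⟩, rfl⟩
        exact ⟨T, hT, j, rfl⟩
  rw [key, BettiTr.P_coeff b t n q ht]
end

section
/- With b_1 = ⋯ = b_n = 2, the q-th Betti number of the transversal monomial ideal I_t(D) equals Σ_{s=t}^{t+q} binom(s−1, t−1)·binom(n, s)·binom(s, t+q−s)·2^(2s−t−q). -/
namespace TB

universe u v

section HBsec
variable {S : Type u} [CommRing S]

/-- a surjection from a finite free module with kernel inside `𝔪` times the source -/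
def IsCover (𝔪 : Ideal S) {ι : Type} {M : Type u} [AddCommGroup M] [Module S M]
    (f : (ι → S) →ₗ[S] M) : Prop :=
  Function.Surjective f ∧ ∀ v, f v = 0 → ∀ i, v i ∈ 𝔪

/-- `M` has a minimal resolution up to step `q`, with `q`-th rank `b` -/
def HB (𝔪 : Ideal S) : ℕ → ∀ (M : Type u) [AddCommGroup M] [Module S M], ℕ → Prop
  | 0 => fun M _ _ b => ∃ (ι : Type) (_ : Fintype ι) (f : (ι → S) →ₗ[S] M),
      IsCover 𝔪 f ∧ Fintype.card ι = b
  | q + 1 => fun M _ _ b => ∃ (ι : Type) (_ : Fintype ι) (f : (ι → S) →ₗ[S] M),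
      IsCover 𝔪 f ∧ HB 𝔪 q (LinearMap.ker f) b

theorem mem_of_smul_top {𝔪 : Ideal S} {ι : Type} {v : ι →₀ S}
    (h : v ∈ 𝔪 • (⊤ : Submodule S (ι →₀ S))) (i : ι) : v i ∈ 𝔪 := by
  refine Submodule.smul_induction_on (p := fun v : ι →₀ S => v i ∈ 𝔪) h ?_ ?_
  · intro r hr n _
    simpa using 𝔪.mul_mem_right _ hr
  · intro x y hx hy
    simpa using 𝔪.add_mem hx hy

theorem cover_le {k : Type v} [Field k] (π : S →+* k) (hπ : Function.Surjective π)
    {ι ι' : Type} [Fintype ι] [Fintype ι'] {N : Type u} [AddCommGroup N] [Module S N]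
    (f : (ι → S) →ₗ[S] N) (g : (ι' → S) →ₗ[S] N) (hf : Function.Surjective f)
    (hg : IsCover (RingHom.ker π) g) : Fintype.card ι' ≤ Fintype.card ι := by
  classical
  obtain ⟨s, hs⟩ := Module.projective_lifting_property g f hg.1
  let A := (LinearMap.toMatrix' s).map π
  have hA : Function.Surjective (Matrix.toLin' A) := by
    intro y
    choose r hr using hπ
    obtain ⟨x, hx⟩ := hf (g (fun i => r (y i)))
    refine ⟨fun i => π (x i), ?_⟩
    funext i
    have h1 : g (s x - fun i => r (y i)) = 0 := by
      rw [map_sub, ← LinearMap.comp_apply, hs, hx, sub_self]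
    have h2 := hg.2 _ h1 i
    rw [RingHom.mem_ker, Pi.sub_apply, map_sub, hr, sub_eq_zero] at h2
    rw [← h2]
    conv_rhs => rw [← LinearMap.toMatrix'_mulVec s x]
    simp [A, Matrix.mulVec, dotProduct]
  have := LinearMap.finrank_le_finrank_of_surjective hA
  simpa using this

theorem cover_card {k : Type v} [Field k] (π : S →+* k) (hπ : Function.Surjective π)
    {ι ι' : Type} [Fintype ι] [Fintype ι'] {N : Type u} [AddCommGroup N] [Module S N]
    (f : (ι → S) →ₗ[S] N) (g : (ι' → S) →ₗ[S] N) (hf : IsCover (RingHom.ker π) f)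
    (hg : IsCover (RingHom.ker π) g) : Fintype.card ι = Fintype.card ι' :=
  le_antisymm (cover_le π hπ g f hg.1 hf) (cover_le π hπ f g hf.1 hg)

theorem schanuel {P Q N : Type u} [AddCommGroup N] [Module S N] [AddCommGroup P] [Module S P]
    [AddCommGroup Q] [Module S Q] [Module.Projective S P] [Module.Projective S Q]
    (f : P →ₗ[S] N) (g : Q →ₗ[S] N)
    (hf : Function.Surjective f) (hg : Function.Surjective g) :
    Nonempty ((LinearMap.ker f × Q) ≃ₗ[S] (LinearMap.ker g × P)) := by
  obtain ⟨s, hs⟩ := Module.projective_lifting_property g f hg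
  obtain ⟨r, hr⟩ := Module.projective_lifting_property f g hf
  have hs' : ∀ x, g (s x) = f x := fun x => by rw [← LinearMap.comp_apply, hs]
  have hr' : ∀ x, f (r x) = g x := fun x => by rw [← LinearMap.comp_apply, hr]
  refine ⟨{
    toFun := fun z => (⟨z.2 - s (z.1 + r z.2), ?_⟩, z.1 + r z.2)
    invFun := fun z => (⟨z.2 - r (z.1 + s z.2), ?_⟩, z.1 + s z.2)
    map_add' := ?_
    map_smul' := ?_
    left_inv := ?_
    right_inv := ?_ }⟩
  · obtain ⟨⟨a, ha⟩, b⟩ := z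
    simp only [LinearMap.mem_ker] at ha ⊢
    simp [hs', hr', ha]
  · intro x y
    ext
    · simp; abel
    · simp; abel
  · intro c x
    ext
    · simp [smul_sub]
    · simp
  · obtain ⟨⟨a, ha⟩, b⟩ := z
    simp only [LinearMap.mem_ker] at ha ⊢
    simp [hs', hr', ha]
  · rintro ⟨⟨a, ha⟩, b⟩
    ext <;> simp
  · rintro ⟨⟨a, ha⟩, b⟩
    ext <;> simp

/-- add a free summand to a cover -/
noncomputable def stab {ι : Type} (κ : Type) {M N : Type u} [AddCommGroup M] [Module S M]
    [AddCommGroup N] [Module S N]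
    (f : (ι → S) →ₗ[S] M) (e : (M × (κ → S)) ≃ₗ[S] N) : (ι ⊕ κ → S) →ₗ[S] N :=
  e.toLinearMap ∘ₗ (LinearMap.prodMap f LinearMap.id) ∘ₗ
    (LinearEquiv.sumArrowLequivProdArrow ι κ S S).toLinearMap

theorem stab_cover {𝔪 : Ideal S} {ι : Type} (κ : Type) {M N : Type u} [AddCommGroup M] [Module S M]
    [AddCommGroup N] [Module S N]
    (f : (ι → S) →ₗ[S] M) (e : (M × (κ → S)) ≃ₗ[S] N) (hf : IsCover 𝔪 f) :
    IsCover 𝔪 (stab κ f e) := by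
  constructor
  · intro y
    obtain ⟨⟨m, w⟩, rfl⟩ := e.surjective y
    obtain ⟨v, rfl⟩ := hf.1 m
    refine ⟨Sum.elim v w, ?_⟩
    simp only [stab, LinearMap.comp_apply, LinearEquiv.coe_coe]
    congr 1
  · intro v hv i
    simp only [stab, LinearMap.comp_apply, LinearEquiv.coe_coe, LinearEquiv.map_eq_zero_iff] at hv
    have h1 : f (fun i => v (Sum.inl i)) = 0 := congrArg Prod.fst hv
    have h2 : (fun i => v (Sum.inr i)) = 0 := congrArg Prod.snd hv
    rcases i with i | i
    · exact hf.2 _ h1 i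
    · have := congrFun h2 i
      simp only [Pi.zero_apply] at this
      rw [this]; exact 𝔪.zero_mem

theorem stab_ker {ι : Type} (κ : Type) {M N : Type u} [AddCommGroup M] [Module S M]
    [AddCommGroup N] [Module S N]
    (f : (ι → S) →ₗ[S] M) (e : (M × (κ → S)) ≃ₗ[S] N) :
    Nonempty (LinearMap.ker f ≃ₗ[S] LinearMap.ker (stab κ f e)) := by
  have key : ∀ v, stab κ f e v = 0 ↔
      f (fun i => v (Sum.inl i)) = 0 ∧ (fun i => v (Sum.inr i)) = 0 := by
    intro v
    simp only [stab, LinearMap.comp_apply, LinearEquiv.coe_coe, LinearEquiv.map_eq_zero_iff]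
    constructor
    · intro hv
      exact ⟨congrArg Prod.fst hv, congrArg Prod.snd hv⟩
    · rintro ⟨h1, h2⟩
      exact Prod.ext h1 h2
  refine ⟨{
    toFun := fun z => ⟨Sum.elim z.1 0, ?_⟩
    invFun := fun z => ⟨fun i => z.1 (Sum.inl i), ?_⟩
    map_add' := ?_
    map_smul' := ?_
    left_inv := ?_
    right_inv := ?_ }⟩
  · rw [LinearMap.mem_ker, key]
    exact ⟨z.2, rfl⟩
  · intro x y
    ext i
    rcases i with i | i <;> simp
  · intro c x
    ext i
    rcases i with i | i <;> simp
  · exact ((key _).1 z.2).1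
  · intro x
    ext i
    simp
  · intro x
    ext i
    rcases i with i | i
    · simp
    · exact (congrFun ((key _).1 x.2).2 i).symm

theorem HB_unique {k : Type v} [Field k] (π : S →+* k) (hπ : Function.Surjective π) (q : ℕ) :
    ∀ (M M' : Type u) [AddCommGroup M] [Module S M] [AddCommGroup M'] [Module S M']
      (κ : Type) [Fintype κ] (_ : (M × (κ → S)) ≃ₗ[S] (M' × (κ → S))) (b b' : ℕ),
      HB (RingHom.ker π) q M b → HB (RingHom.ker π) q M' b' → b = b' := by
  induction q with
  | zero =>
    rintro M M' _ _ _ _ κ _ e b b' ⟨ι, _, f, hf, rfl⟩ ⟨ι', _, f', hf', rfl⟩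
    have := cover_card π hπ (stab κ f e) (stab κ f' (LinearEquiv.refl _ _))
      (stab_cover _ _ _ hf) (stab_cover _ _ _ hf')
    simpa using this
  | succ q ih =>
    rintro M M' _ _ _ _ κ _ e b b' ⟨ι, _, f, hf, h⟩ ⟨ι', _, f', hf', h'⟩
    have c1 := stab_cover κ f e hf
    have c2 := stab_cover κ f' (LinearEquiv.refl _ _) hf'
    have hc := cover_card π hπ _ _ c1 c2
    obtain ⟨E⟩ := schanuel _ _ c1.1 c2.1
    obtain ⟨e1⟩ := stab_ker κ f e
    obtain ⟨e2⟩ := stab_ker κ f' (LinearEquiv.refl S _)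
    let r : (ι ⊕ κ → S) ≃ₗ[S] (ι' ⊕ κ → S) :=
      LinearEquiv.funCongrLeft S S (Fintype.equivOfCardEq hc.symm)
    exact ih _ _ (ι' ⊕ κ)
      ((e1.prodCongr (LinearEquiv.refl S _)).trans (E.trans (e2.symm.prodCongr r))) b b' h h'

/-- syzygy shift of a minimal free resolution -/
noncomputable def shift {𝔪 : Ideal S} {M : Type u} [AddCommGroup M] [Module S M]
    (F : MinimalFreeResolution S 𝔪 M) : MinimalFreeResolution S 𝔪 (LinearMap.ker F.ε) where
  β q := F.β (q + 1)
  d q := F.d (q + 1)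
  ε := (F.d 0).codRestrict _ (fun c => by rw [F.exact_zero]; exact ⟨c, rfl⟩)
  surj := by
    rintro ⟨y, hy⟩
    have hy' := hy
    rw [F.exact_zero] at hy'
    obtain ⟨x, hx⟩ := hy'
    exact ⟨x, Subtype.ext hx⟩
  exact_zero := by rw [LinearMap.ker_codRestrict]; exact F.exact 0
  exact q := F.exact (q + 1)
  minimal q := F.minimal (q + 1)

theorem HB_iso {𝔪 : Ideal S} (q : ℕ) : ∀ {M M' : Type u} [AddCommGroup M] [Module S M]
    [AddCommGroup M'] [Module S M'] (_ : M ≃ₗ[S] M') (b : ℕ), HB 𝔪 q M b → HB 𝔪 q M' b := by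
  cases q with
  | zero =>
    rintro M M' _ _ _ _ e b ⟨ι, _, f, hf, hb⟩
    refine ⟨ι, inferInstance, e.toLinearMap ∘ₗ f, ⟨e.surjective.comp hf.1, ?_⟩, hb⟩
    intro v hv
    exact hf.2 v (by simpa using hv)
  | succ q =>
    rintro M M' _ _ _ _ e b ⟨ι, _, f, hf, hb⟩
    refine ⟨ι, inferInstance, e.toLinearMap ∘ₗ f, ⟨e.surjective.comp hf.1, ?_⟩, ?_⟩
    · intro v hv
      exact hf.2 v (by simpa using hv)
    · rwa [LinearEquiv.ker_comp]

theorem HB_iso_ker {𝔪 : Ideal S} (q : ℕ) {P P' M M' : Type u} [AddCommGroup M] [Module S M]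
    [AddCommGroup M'] [Module S M'] [AddCommGroup P] [Module S P] [AddCommGroup P'] [Module S P']
    (f : P →ₗ[S] M) (e : P' ≃ₗ[S] P) (b : ℕ) (h : HB 𝔪 q (LinearMap.ker f) b) :
    HB 𝔪 q (LinearMap.ker (f ∘ₗ e.toLinearMap)) b := by
  refine HB_iso q (LinearEquiv.ofSubmodules e.symm _ _ ?_) b h
  ext x
  simp only [Submodule.mem_map, LinearMap.mem_ker, LinearMap.comp_apply, LinearEquiv.coe_coe]
  constructor
  · rintro ⟨y, hy, rfl⟩
    simpa using hy
  · intro hx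
    exact ⟨e x, hx, by simp⟩

theorem HB_of_res {𝔪 : Ideal S} (q : ℕ) : ∀ {M : Type u} [AddCommGroup M] [Module S M]
    (F : MinimalFreeResolution S 𝔪 M), HB 𝔪 q M (F.β q) := by
  have cov : ∀ {M : Type u} [AddCommGroup M] [Module S M]
    (F : MinimalFreeResolution S 𝔪 M), IsCover 𝔪 (F.ε ∘ₗ
      (Finsupp.linearEquivFunOnFinite S S (Fin (F.β 0))).symm.toLinearMap) := by
    intro M _ _ F
    refine ⟨F.surj.comp (LinearEquiv.surjective _), ?_⟩
    intro v hv i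
    set w := (Finsupp.linearEquivFunOnFinite S S (Fin (F.β 0))).symm v with hw
    have h1 : w ∈ LinearMap.ker F.ε := hv
    rw [F.exact_zero] at h1
    have := mem_of_smul_top (F.minimal 0 h1) i
    rw [hw] at this
    exact this
  induction q with
  | zero =>
    intro M _ _ F
    exact ⟨Fin (F.β 0), inferInstance, _, cov F, by simp⟩
  | succ q ih =>
    intro M _ _ F
    refine ⟨Fin (F.β 0), inferInstance, _, cov F, ?_⟩
    exact HB_iso_ker (M' := M) q _ _ _ (ih (shift F))

end HBsec

section TResSec
open Matrix

variable {S : Type u} [CommRing S]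

/-- a finite graded free resolution of an ideal, written as one square matrix -/
structure TRes (𝔪 I : Ideal S) where
  ι : Type
  [fin : Fintype ι]
  deg : ι → ℕ
  D : Matrix ι ι S
  ε : ι → S
  D_deg : ∀ i j, D i j ≠ 0 → deg j = deg i + 1
  D_min : ∀ i j, D i j ∈ 𝔪
  ε_deg : ∀ i, ε i ≠ 0 → deg i = 0
  DD : D * D = 0
  εD : ε ᵥ* D = 0
  ε_mem : ∀ i, ε i ∈ I
  lift : ∀ g ∈ I, ∃ e, D *ᵥ e = 0 ∧ ε ⬝ᵥ e = g
  exact : ∀ v, D *ᵥ v = 0 → ε ⬝ᵥ v = 0 → ∃ w, D *ᵥ w = v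

attribute [instance] TRes.fin

/-- minimal chain maps over inclusions -/
structure THom {𝔪 I J : Ideal S} (X : TRes 𝔪 I) (Y : TRes 𝔪 J) where
  φ : Matrix Y.ι X.ι S
  φ_deg : ∀ i j, φ i j ≠ 0 → Y.deg i = X.deg j
  φ_min : ∀ i j, φ i j ∈ 𝔪
  comm : Y.D * φ = φ * X.D
  aug : Y.ε ᵥ* φ = X.ε

variable {𝔪 I J 𝔞 𝔟 𝔠 : Ideal S}

theorem TRes.ε_dot_mem (X : TRes 𝔪 I) (v : X.ι → S) : X.ε ⬝ᵥ v ∈ I := by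
  unfold dotProduct
  exact I.sum_mem fun i _ => I.mul_mem_right _ (X.ε_mem i)

theorem TRes.ε_D_dot (X : TRes 𝔪 I) (v : X.ι → S) : X.ε ⬝ᵥ (X.D *ᵥ v) = 0 := by
  rw [dotProduct_mulVec, X.εD, zero_dotProduct]

theorem TRes.D_D_vec (X : TRes 𝔪 I) (v : X.ι → S) : X.D *ᵥ (X.D *ᵥ v) = 0 := by
  rw [mulVec_mulVec, X.DD, zero_mulVec]

theorem THom.comm_vec {X : TRes 𝔪 I} {Y : TRes 𝔪 J} (f : THom X Y) (v : X.ι → S) :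
    Y.D *ᵥ (f.φ *ᵥ v) = f.φ *ᵥ (X.D *ᵥ v) := by
  rw [mulVec_mulVec, f.comm, mulVec_mulVec]

theorem THom.aug_vec {X : TRes 𝔪 I} {Y : TRes 𝔪 J} (f : THom X Y) (v : X.ι → S) :
    Y.ε ⬝ᵥ (f.φ *ᵥ v) = X.ε ⬝ᵥ v := by
  rw [dotProduct_mulVec, f.aug]

/-- matrix of the cone -/
def coneD {A B C : Type} (a : Matrix A A S) (b : Matrix B B S) (c : Matrix C C S)
    (f : Matrix A C S) (g : Matrix B C S) : Matrix (A ⊕ (B ⊕ C)) (A ⊕ (B ⊕ C)) S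
  | .inl i, .inl j => a i j
  | .inl _, .inr (.inl _) => 0
  | .inl i, .inr (.inr j) => f i j
  | .inr (.inl _), .inl _ => 0
  | .inr (.inl i), .inr (.inl j) => b i j
  | .inr (.inl i), .inr (.inr j) => - g i j
  | .inr (.inr _), .inl _ => 0
  | .inr (.inr _), .inr (.inl _) => 0
  | .inr (.inr i), .inr (.inr j) => - c i j

theorem coneD_mulVec {A B C : Type} [Fintype A] [Fintype B] [Fintype C]
    (a : Matrix A A S) (b : Matrix B B S) (c : Matrix C C S)
    (f : Matrix A C S) (g : Matrix B C S) (x : A → S) (y : B → S) (z : C → S) :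
    coneD a b c f g *ᵥ (Sum.elim x (Sum.elim y z)) =
      Sum.elim (a *ᵥ x + f *ᵥ z) (Sum.elim (b *ᵥ y - g *ᵥ z) (- (c *ᵥ z))) := by
  funext i
  rcases i with i | i | i <;>
  simp [coneD, mulVec, dotProduct, sub_eq_add_neg]

theorem vec_eta {A B C : Type} (v : A ⊕ (B ⊕ C) → S) : ∃ x y z, v = Sum.elim x (Sum.elim y z) :=
  ⟨fun i => v (.inl i), fun i => v (.inr (.inl i)), fun i => v (.inr (.inr i)), by
    funext i; rcases i with i | i | i <;> rfl⟩

theorem mat_ext_vec {A B : Type} [Fintype B] {M N : Matrix A B S}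
    (h : ∀ v, M *ᵥ v = N *ᵥ v) : M = N := by
  classical
  exact Matrix.ext_of_mulVec_single fun i => h _

theorem elim_inj {A B C : Type} {x x' : A → S} {y y' : B → S} {z z' : C → S}
    (h : Sum.elim x (Sum.elim y z) = Sum.elim x' (Sum.elim y' z')) :
    x = x' ∧ y = y' ∧ z = z' :=
  ⟨funext fun i => congrFun h (.inl i), funext fun i => congrFun h (.inr (.inl i)),
    funext fun i => congrFun h (.inr (.inr i))⟩

theorem elim_dot {A B C : Type} [Fintype A] [Fintype B] [Fintype C]
    {x x' : A → S} {y y' : B → S} {z z' : C → S} :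
    Sum.elim x (Sum.elim y z) ⬝ᵥ Sum.elim x' (Sum.elim y' z') =
      x ⬝ᵥ x' + y ⬝ᵥ y' + z ⬝ᵥ z' := by
  simp [dotProduct, add_assoc]

theorem elim_zero {A B C : Type} :
    (0 : A ⊕ (B ⊕ C) → S) = Sum.elim (0 : A → S) (Sum.elim (0 : B → S) (0 : C → S)) := by
  funext i; rcases i with i | i | i <;> rfl

/-- the mapping cone (Mayer-Vietoris) -/
def cone (A : TRes 𝔪 𝔞) (B : TRes 𝔪 𝔟) (C : TRes 𝔪 𝔠) (f : THom C A) (g : THom C B)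
    (hc : ∀ p, p ∈ 𝔞 → p ∈ 𝔟 → p ∈ 𝔠) (hI : I = 𝔞 ⊔ 𝔟) : TRes 𝔪 I where
  ι := A.ι ⊕ (B.ι ⊕ C.ι)
  deg := Sum.elim A.deg (Sum.elim B.deg (fun i => C.deg i + 1))
  D := coneD A.D B.D C.D f.φ g.φ
  ε := Sum.elim A.ε (Sum.elim B.ε 0)
  D_deg := by
    rintro (i | i | i) (j | j | j) h <;> simp [coneD] at h ⊢
    · exact A.D_deg _ _ h
    · exact (f.φ_deg _ _ h).symm
    · exact B.D_deg _ _ h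
    · exact (g.φ_deg _ _ h).symm
    · exact C.D_deg _ _ h
  D_min := by
    rintro (i | i | i) (j | j | j) <;>
      simp [coneD, A.D_min, B.D_min, C.D_min, f.φ_min, g.φ_min]
  ε_deg := by
    rintro (i | i | i) h <;> simp at h ⊢
    · exact A.ε_deg _ h
    · exact B.ε_deg _ h
  DD := by
    apply mat_ext_vec
    intro v
    obtain ⟨x, y, z, rfl⟩ := vec_eta v
    rw [← mulVec_mulVec, coneD_mulVec, coneD_mulVec, zero_mulVec, elim_zero]
    congr 2
    · simp [mulVec_add, A.D_D_vec, f.comm_vec, mulVec_neg]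
    · simp [mulVec_sub, B.D_D_vec, g.comm_vec, mulVec_neg]
    · simp [mulVec_neg, C.D_D_vec]
  εD := by
    classical
    have h : ∀ v, (Sum.elim A.ε (Sum.elim B.ε 0) ᵥ* coneD A.D B.D C.D f.φ g.φ) ⬝ᵥ v = 0 ⬝ᵥ v := by
      intro v
      obtain ⟨x, y, z, rfl⟩ := vec_eta v
      rw [← dotProduct_mulVec, coneD_mulVec, elim_dot]
      simp [A.ε_D_dot, B.ε_D_dot, f.aug_vec, g.aug_vec]
    exact dotProduct_eq _ _ h
  ε_mem := by
    subst hI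
    rintro (i | i | i)
    · exact Ideal.mem_sup_left (A.ε_mem i)
    · exact Ideal.mem_sup_right (B.ε_mem i)
    · simp
  lift := by
    subst hI
    intro p hp
    obtain ⟨a, ha, b, hb, rfl⟩ := Submodule.mem_sup.1 hp
    obtain ⟨x, hx, hx'⟩ := A.lift a ha
    obtain ⟨y, hy, hy'⟩ := B.lift b hb
    refine ⟨Sum.elim x (Sum.elim y 0), ?_, ?_⟩
    · rw [coneD_mulVec, elim_zero]
      simp [hx, hy]
    · rw [elim_dot]; simp [hx', hy']
  exact := by
    intro v hv hε
    obtain ⟨x, y, z, rfl⟩ := vec_eta v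
    rw [coneD_mulVec, elim_zero] at hv
    obtain ⟨h1, h2, h3⟩ := elim_inj hv
    rw [elim_dot] at hε
    rw [neg_eq_zero] at h3
    have hz : C.ε ⬝ᵥ z = 0 := by
      have := congrArg (fun w => A.ε ⬝ᵥ w) h1
      simpa [A.ε_D_dot, f.aug_vec] using this
    obtain ⟨z', rfl⟩ := C.exact z h3 hz
    have hx1 : A.D *ᵥ (x + f.φ *ᵥ z') = 0 := by
      rw [mulVec_add, f.comm_vec, h1]
    have hy1 : B.D *ᵥ (y - g.φ *ᵥ z') = 0 := by
      rw [mulVec_sub, g.comm_vec, h2]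
    have hs : A.ε ⬝ᵥ (x + f.φ *ᵥ z') + B.ε ⬝ᵥ (y - g.φ *ᵥ z') = 0 := by
      rw [dotProduct_add, dotProduct_sub, f.aug_vec, g.aug_vec]
      simp at hε
      linear_combination hε
    have hm : A.ε ⬝ᵥ (x + f.φ *ᵥ z') ∈ 𝔠 := by
      apply hc _ (A.ε_dot_mem _)
      rw [eq_neg_of_add_eq_zero_left hs]
      exact neg_mem (B.ε_dot_mem _)
    obtain ⟨e, he, he'⟩ := C.lift _ hm
    obtain ⟨w1, hw1⟩ := A.exact (x + f.φ *ᵥ z' - f.φ *ᵥ e)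
      (by rw [mulVec_sub, hx1, f.comm_vec, he]; simp)
      (by rw [dotProduct_sub, f.aug_vec, he', sub_self])
    obtain ⟨w2, hw2⟩ := B.exact (y - g.φ *ᵥ z' + g.φ *ᵥ e)
      (by rw [mulVec_add, hy1, g.comm_vec, he]; simp)
      (by rw [dotProduct_add, g.aug_vec, he', add_comm, hs])
    refine ⟨Sum.elim w1 (Sum.elim w2 (e - z')), ?_⟩
    rw [coneD_mulVec, hw1, hw2]
    congr 2
    · rw [mulVec_sub]; abel
    · rw [mulVec_sub]; abel
    · rw [mulVec_sub, he]; simp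

/-- block diagonal matrix -/
def diag3 {A B C A' B' C' : Type} (a : Matrix A A' S) (b : Matrix B B' S) (c : Matrix C C' S) :
    Matrix (A ⊕ (B ⊕ C)) (A' ⊕ (B' ⊕ C')) S
  | .inl i, .inl j => a i j
  | .inr (.inl i), .inr (.inl j) => b i j
  | .inr (.inr i), .inr (.inr j) => c i j
  | _, _ => 0

theorem diag3_mulVec {A B C A' B' C' : Type} [Fintype A'] [Fintype B'] [Fintype C']
    (a : Matrix A A' S) (b : Matrix B B' S) (c : Matrix C C' S)
    (x : A' → S) (y : B' → S) (z : C' → S) :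
    diag3 a b c *ᵥ (Sum.elim x (Sum.elim y z)) =
      Sum.elim (a *ᵥ x) (Sum.elim (b *ᵥ y) (c *ᵥ z)) := by
  funext i
  rcases i with i | i | i <;> simp [diag3, mulVec, dotProduct]

/-- row of two blocks and zero -/
def row3 {A B C T : Type} (a : Matrix T A S) (b : Matrix T B S) :
    Matrix T (A ⊕ (B ⊕ C)) S
  | i, .inl j => a i j
  | i, .inr (.inl j) => b i j
  | _, .inr (.inr _) => 0

theorem row3_mulVec {A B C T : Type} [Fintype A] [Fintype B] [Fintype C]
    (a : Matrix T A S) (b : Matrix T B S)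
    (x : A → S) (y : B → S) (z : C → S) :
    row3 a b *ᵥ (Sum.elim x (Sum.elim y z)) = a *ᵥ x + b *ᵥ y := by
  funext i
  simp [row3, mulVec, dotProduct]

/-- functoriality of cones -/
def coneMap {𝔞' 𝔟' 𝔠' I' : Ideal S}
    {A : TRes 𝔪 𝔞} {B : TRes 𝔪 𝔟} {C : TRes 𝔪 𝔠} {f : THom C A} {g : THom C B}
    {hc : ∀ p, p ∈ 𝔞 → p ∈ 𝔟 → p ∈ 𝔠} {hI : I = 𝔞 ⊔ 𝔟}
    {A' : TRes 𝔪 𝔞'} {B' : TRes 𝔪 𝔟'} {C' : TRes 𝔪 𝔠'} {f' : THom C' A'} {g' : THom C' B'}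
    {hc' : ∀ p, p ∈ 𝔞' → p ∈ 𝔟' → p ∈ 𝔠'} {hI' : I' = 𝔞' ⊔ 𝔟'}
    (α : THom A A') (β : THom B B') (γ : THom C C')
    (hf : α.φ * f.φ = f'.φ * γ.φ) (hg : β.φ * g.φ = g'.φ * γ.φ) :
    THom (cone A B C f g hc hI) (cone A' B' C' f' g' hc' hI') where
  φ := diag3 α.φ β.φ γ.φ
  φ_deg := by
    rintro (i | i | i) (j | j | j) h <;> simp [diag3, cone] at h ⊢
    · exact α.φ_deg _ _ h
    · exact β.φ_deg _ _ h
    · exact γ.φ_deg _ _ h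
  φ_min := by
    rintro (i | i | i) (j | j | j) <;> simp [diag3, α.φ_min, β.φ_min, γ.φ_min]
  comm := by
    change coneD A'.D B'.D C'.D f'.φ g'.φ * diag3 α.φ β.φ γ.φ =
      diag3 α.φ β.φ γ.φ * coneD A.D B.D C.D f.φ g.φ
    apply mat_ext_vec
    intro v
    obtain ⟨x, y, z, rfl⟩ := vec_eta v
    have hf' : ∀ z, α.φ *ᵥ (f.φ *ᵥ z) = f'.φ *ᵥ (γ.φ *ᵥ z) := fun z => by
      rw [mulVec_mulVec, hf, mulVec_mulVec]
    have hg' : ∀ z, β.φ *ᵥ (g.φ *ᵥ z) = g'.φ *ᵥ (γ.φ *ᵥ z) := fun z => by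
      rw [mulVec_mulVec, hg, mulVec_mulVec]
    rw [← mulVec_mulVec, ← mulVec_mulVec]
    rw [diag3_mulVec, coneD_mulVec, coneD_mulVec, diag3_mulVec]
    simp [mulVec_add, mulVec_sub, mulVec_neg, α.comm_vec, β.comm_vec, γ.comm_vec, hf', hg']
  aug := by
    change Sum.elim A'.ε (Sum.elim B'.ε 0) ᵥ* diag3 α.φ β.φ γ.φ =
      Sum.elim A.ε (Sum.elim B.ε 0)
    apply dotProduct_eq
    intro v
    obtain ⟨x, y, z, rfl⟩ := vec_eta v
    rw [← dotProduct_mulVec]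
    rw [diag3_mulVec, elim_dot, elim_dot, α.aug_vec, β.aug_vec]
    simp

/-- maps out of cones -/
def coneDesc {A : TRes 𝔪 𝔞} {B : TRes 𝔪 𝔟} {C : TRes 𝔪 𝔠} {f : THom C A} {g : THom C B}
    {hc : ∀ p, p ∈ 𝔞 → p ∈ 𝔟 → p ∈ 𝔠} {hI : I = 𝔞 ⊔ 𝔟}
    {Y : TRes 𝔪 J} (α : THom A Y) (β : THom B Y) (h : α.φ * f.φ = β.φ * g.φ) :
    THom (cone A B C f g hc hI) Y where
  φ := row3 α.φ β.φ
  φ_deg := by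
    rintro i (j | j | j) h <;> simp [row3, cone] at h ⊢
    · exact α.φ_deg _ _ h
    · exact β.φ_deg _ _ h
  φ_min := by
    rintro i (j | j | j) <;> simp [row3, α.φ_min, β.φ_min]
  comm := by
    suffices key : Y.D * (row3 α.φ β.φ : Matrix Y.ι (A.ι ⊕ (B.ι ⊕ C.ι)) S) =
      (row3 α.φ β.φ : Matrix Y.ι (A.ι ⊕ (B.ι ⊕ C.ι)) S) * coneD A.D B.D C.D f.φ g.φ from key
    apply mat_ext_vec
    intro v
    obtain ⟨x, y, z, rfl⟩ := vec_eta v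
    have hf' : ∀ z, α.φ *ᵥ (f.φ *ᵥ z) = β.φ *ᵥ (g.φ *ᵥ z) := fun z => by
      rw [mulVec_mulVec, h, mulVec_mulVec]
    rw [← mulVec_mulVec, ← mulVec_mulVec]
    rw [row3_mulVec, coneD_mulVec, row3_mulVec]
    simp [mulVec_add, mulVec_sub, α.comm_vec, β.comm_vec, hf']
  aug := by
    change Y.ε ᵥ* row3 α.φ β.φ = Sum.elim A.ε (Sum.elim B.ε 0)
    apply dotProduct_eq
    intro v
    obtain ⟨x, y, z, rfl⟩ := vec_eta v
    rw [← dotProduct_mulVec]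
    rw [row3_mulVec, elim_dot, dotProduct_add, α.aug_vec, β.aug_vec]
    simp

/-- the trivial resolution of the unit ideal -/
def unitRes (hI : I = ⊤) : TRes 𝔪 I where
  ι := Unit
  deg _ := 0
  D := 0
  ε _ := 1
  D_deg := by simp
  D_min := by simp
  ε_deg := by simp
  DD := by simp
  εD := by simp
  ε_mem := by simp [hI]
  lift g _ := ⟨fun _ => g, by simp, by simp [dotProduct]⟩
  exact v _ h := ⟨0, by
    funext i
    simpa [dotProduct] using h.symm⟩

/-- the resolution of the zero ideal -/
def zeroRes (hI : I = ⊥) : TRes 𝔪 I where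
  ι := Empty
  deg _ := 0
  D := 0
  ε _ := 1
  D_deg := by simp
  D_min := by simp
  ε_deg := by simp
  DD := by simp
  εD := by simp
  ε_mem := by simp
  lift g hg := ⟨fun _ => 0, by simp, by subst hI; simpa [dotProduct] using hg.symm⟩
  exact v _ h := ⟨0, by
    funext i
    exact i.elim⟩

/-- the augmentation as a map to the trivial resolution -/
def augHom (X : TRes 𝔪 J) (hJ : J ≤ 𝔪) (hI : I = ⊤) : THom X (unitRes (𝔪 := 𝔪) hI) where
  φ := Matrix.of fun _ j => X.ε j
  φ_deg := by
    intro i j h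
    exact (X.ε_deg _ h).symm
  φ_min i j := hJ (X.ε_mem j)
  comm := by
    have := X.εD
    ext i j
    change ((0 : Matrix Unit Unit S) * (Matrix.of fun (_ : Unit) j => X.ε j)) i j = _
    rw [Matrix.zero_mul]
    change (0 : S) = _
    simpa [mul_apply, vecMul, dotProduct] using (congrFun this j).symm
  aug := by
    funext j
    change ((fun _ => (1 : S)) ᵥ* (Matrix.of fun (_ : Unit) j => X.ε j)) j = _
    simp [vecMul, dotProduct]

/-- maps out of the empty resolution -/
def zeroHom (hJ : J = ⊥) (Y : TRes 𝔪 I) : THom (zeroRes (𝔪 := 𝔪) hJ) Y where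
  φ := Matrix.of fun _ j => Empty.elim j
  φ_deg := by rintro i ⟨⟩
  φ_min := by rintro i ⟨⟩
  comm := by ext i ⟨⟩
  aug := by funext j; exact Empty.elim j

/-- scaling a resolution by a nonzerodivisor -/
def scale (x : S) (hx : ∀ p, x * p = 0 → p = 0) (X : TRes 𝔪 I)
    (hJ : ∀ p, p ∈ J ↔ ∃ r ∈ I, p = x * r) : TRes 𝔪 J where
  ι := X.ι
  deg := X.deg
  D := X.D
  ε i := x * X.ε i
  D_deg := X.D_deg
  D_min := X.D_min
  ε_deg i h := X.ε_deg i (right_ne_zero_of_mul h)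
  DD := X.DD
  εD := by
    change (x • X.ε) ᵥ* X.D = 0
    rw [smul_vecMul, X.εD, smul_zero]
  ε_mem i := (hJ _).2 ⟨_, X.ε_mem i, rfl⟩
  lift g hg := by
    obtain ⟨r, hr, rfl⟩ := (hJ _).1 hg
    obtain ⟨e, he, rfl⟩ := X.lift r hr
    refine ⟨e, he, ?_⟩
    change (x • X.ε) ⬝ᵥ e = _
    rw [smul_dotProduct, smul_eq_mul]
  exact v hv h := by
    refine X.exact v hv (hx _ ?_)
    change (x • X.ε) ⬝ᵥ v = _ at h
    rwa [smul_dotProduct, smul_eq_mul] at h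

/-- multiplication by `y` between scaled resolutions -/
noncomputable def scaleHom (X : TRes 𝔪 I) {J' : Ideal S} (x y z : S)
    (hx : ∀ p, x * p = 0 → p = 0) (hz : ∀ p, z * p = 0 → p = 0)
    (hJ : ∀ p, p ∈ J ↔ ∃ r ∈ I, p = x * r) (hJ' : ∀ p, p ∈ J' ↔ ∃ r ∈ I, p = z * r)
    (hy : y ∈ 𝔪) (h : z = x * y) : THom (scale z hz X hJ') (scale x hx X hJ) where
  φ := by classical exact y • (1 : Matrix X.ι X.ι S)
  φ_deg := by
    classical
    intro (i : X.ι) (j : X.ι) h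
    by_cases hij : i = j
    · subst hij; rfl
    · exact absurd (show (y • (1 : Matrix X.ι X.ι S)) i j = 0 by
        rw [Matrix.smul_apply, Matrix.one_apply_ne hij, smul_zero]) h
  φ_min := by
    classical
    intro i j
    exact 𝔪.mul_mem_right _ hy
  comm := by
    classical
    change X.D * (y • (1 : Matrix X.ι X.ι S)) = (y • (1 : Matrix X.ι X.ι S)) * X.D
    simp
  aug := by
    classical
    change (x • X.ε) ᵥ* (y • (1 : Matrix X.ι X.ι S)) = z • X.ε
    subst h
    funext i
    simp [vecMul_smul]
    ring

/-- multiplication by `x` from the scaled resolution to the original -/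
noncomputable def unscaleHom (X : TRes 𝔪 I) (x : S)
    (hx : ∀ p, x * p = 0 → p = 0)
    (hJ : ∀ p, p ∈ J ↔ ∃ r ∈ I, p = x * r)
    (hm : x ∈ 𝔪) : THom (scale x hx X hJ) X where
  φ := by classical exact x • (1 : Matrix X.ι X.ι S)
  φ_deg := by
    classical
    intro (i : X.ι) (j : X.ι) h
    by_cases hij : i = j
    · subst hij; rfl
    · exact absurd (show (x • (1 : Matrix X.ι X.ι S)) i j = 0 by
        rw [Matrix.smul_apply, Matrix.one_apply_ne hij, smul_zero]) h
  φ_min := by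
    classical
    intro i j
    exact 𝔪.mul_mem_right _ hm
  comm := by
    classical
    change X.D * (x • (1 : Matrix X.ι X.ι S)) = (x • (1 : Matrix X.ι X.ι S)) * X.D
    simp
  aug := by
    classical
    change X.ε ᵥ* (x • (1 : Matrix X.ι X.ι S)) = x • X.ε
    simp [vecMul_smul]

/-- a chain map between resolutions induces one between the scaled ones -/
def scaleMap {X : TRes 𝔪 I} {I' J' : Ideal S} {Y : TRes 𝔪 I'} (x : S) (f : THom X Y)
    (hx : ∀ p, x * p = 0 → p = 0)
    (hJ : ∀ p, p ∈ J ↔ ∃ r ∈ I, p = x * r) (hJ' : ∀ p, p ∈ J' ↔ ∃ r ∈ I', p = x * r) :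
    THom (scale x hx X hJ) (scale x hx Y hJ') where
  φ := f.φ
  φ_deg := f.φ_deg
  φ_min := f.φ_min
  comm := f.comm
  aug := by
    change (x • Y.ε) ᵥ* f.φ = x • X.ε
    rw [smul_vecMul, f.aug]

/-- hypotheses relating `I`, `xI`, `yI`, `xyI` and `(x,y)I` -/
structure KData (x y : S) (I Ix Iy Ixy IK : Ideal S) : Prop where
  hx : ∀ p, p ∈ Ix ↔ ∃ r ∈ I, p = x * r
  hy : ∀ p, p ∈ Iy ↔ ∃ r ∈ I, p = y * r
  hxy : ∀ p, p ∈ Ixy ↔ ∃ r ∈ I, p = (x * y) * r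
  hinf : ∀ p, p ∈ Ix → p ∈ Iy → p ∈ Ixy
  hK : IK = Ix ⊔ Iy

variable {x y : S} {Ix Iy Ixy IK I' Ix' Iy' Ixy' IK' : Ideal S}

/-- nonzerodivisors in the maximal ideal -/
structure Good (𝔪 : Ideal S) (x y : S) : Prop where
  nx : ∀ p, x * p = 0 → p = 0
  ny : ∀ p, y * p = 0 → p = 0
  nxy : ∀ p, (x * y) * p = 0 → p = 0
  mx : x ∈ 𝔪
  my : y ∈ 𝔪

/-- resolution of `(x,y)I` -/
noncomputable def Kres (G : Good 𝔪 x y) (H : KData x y I Ix Iy Ixy IK) (X : TRes 𝔪 I) :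
    TRes 𝔪 IK :=
  cone (scale x G.nx X H.hx) (scale y G.ny X H.hy) (scale (x * y) G.nxy X H.hxy)
    (scaleHom X x y (x * y) G.nx G.nxy H.hx H.hxy G.my rfl)
    (scaleHom X y x (x * y) G.ny G.nxy H.hy H.hxy G.mx (mul_comm _ _)) H.hinf H.hK

/-- functoriality of `Kres` -/
noncomputable def Kmap (G : Good 𝔪 x y) (H : KData x y I Ix Iy Ixy IK)
    (H' : KData x y I' Ix' Iy' Ixy' IK') {X : TRes 𝔪 I} {Y : TRes 𝔪 I'} (f : THom X Y) :
    THom (Kres G H X) (Kres G H' Y) :=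
  coneMap (scaleMap x f G.nx H.hx H'.hx) (scaleMap y f G.ny H.hy H'.hy)
    (scaleMap (x * y) f G.nxy H.hxy H'.hxy)
    (by
      classical
      change f.φ * (y • (1 : Matrix X.ι X.ι S)) = (y • (1 : Matrix Y.ι Y.ι S)) * f.φ
      simp)
    (by
      classical
      change f.φ * (x • (1 : Matrix X.ι X.ι S)) = (x • (1 : Matrix Y.ι Y.ι S)) * f.φ
      simp)

/-- the inclusion of `(x,y)I` in `I` -/
noncomputable def Kmu (G : Good 𝔪 x y) (H : KData x y I Ix Iy Ixy IK) (X : TRes 𝔪 I) :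
    THom (Kres G H X) X :=
  coneDesc (unscaleHom X x G.nx H.hx G.mx) (unscaleHom X y G.ny H.hy G.my)
    (by
      classical
      change (x • (1 : Matrix X.ι X.ι S)) * (y • (1 : Matrix X.ι X.ι S)) =
        (y • (1 : Matrix X.ι X.ι S)) * (x • (1 : Matrix X.ι X.ι S))
      simp [smul_smul, mul_comm])

theorem Kmu_nat (G : Good 𝔪 x y) (H : KData x y I Ix Iy Ixy IK)
    (H' : KData x y I' Ix' Iy' Ixy' IK') {X : TRes 𝔪 I} {Y : TRes 𝔪 I'} (f : THom X Y) :
    f.φ * (Kmu G H X).φ = (Kmu G H' Y).φ * (Kmap G H H' f).φ := by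
  classical
  change f.φ * (row3 (x • (1 : Matrix X.ι X.ι S)) (y • (1 : Matrix X.ι X.ι S)) :
      Matrix X.ι (X.ι ⊕ (X.ι ⊕ X.ι)) S) =
    (row3 (x • (1 : Matrix Y.ι Y.ι S)) (y • (1 : Matrix Y.ι Y.ι S)) :
      Matrix Y.ι (Y.ι ⊕ (Y.ι ⊕ Y.ι)) S) * diag3 f.φ f.φ f.φ
  apply mat_ext_vec
  intro v
  obtain ⟨a, b, c, rfl⟩ := vec_eta v
  rw [← mulVec_mulVec, ← mulVec_mulVec, row3_mulVec, diag3_mulVec, row3_mulVec]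
  simp [mulVec_add, smul_mulVec, mulVec_smul]

/-- hypotheses of the inductive step -/
structure StepData (J L KJ KL N : Ideal S) : Prop where
  hinf : ∀ p, p ∈ J → p ∈ KL → p ∈ KJ
  hsup : N = J ⊔ KL

/-- the inductive step -/
noncomputable def step {J L Jx Jy Jxy KJ Lx Ly Lxy KL N : Ideal S} (G : Good 𝔪 x y)
    (HJ : KData x y J Jx Jy Jxy KJ) (HL : KData x y L Lx Ly Lxy KL)
    (HS : StepData J L KJ KL N)
    {X : TRes 𝔪 J} {Y : TRes 𝔪 L} (f : THom X Y) : TRes 𝔪 N :=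
  cone X (Kres G HL Y) (Kres G HJ X) (Kmu G HJ X) (Kmap G HJ HL f) HS.hinf HS.hsup

/-- the chain maps of the inductive step -/
noncomputable def stepMap {J L Jx Jy Jxy KJ Lx Ly Lxy KL N : Ideal S}
    {M Mx My Mxy KM N' : Ideal S} (G : Good 𝔪 x y)
    (HJ : KData x y J Jx Jy Jxy KJ) (HL : KData x y L Lx Ly Lxy KL)
    (HM : KData x y M Mx My Mxy KM)
    (HS : StepData J L KJ KL N) (HS' : StepData L M KL KM N')
    {X : TRes 𝔪 J} {Y : TRes 𝔪 L} {Z : TRes 𝔪 M} (f : THom X Y) (g : THom Y Z) :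
    THom (step G HJ HL HS f) (step G HL HM HS' g) :=
  coneMap f (Kmap G HL HM g) (Kmap G HJ HL f) (Kmu_nat G HJ HL f) rfl

/-- generating polynomial of the ranks -/
noncomputable def TRes.poly (X : TRes 𝔪 I) : Polynomial ℕ := ∑ i, Polynomial.X ^ (X.deg i)

theorem cone_poly (A : TRes 𝔪 𝔞) (B : TRes 𝔪 𝔟) (C : TRes 𝔪 𝔠) (f : THom C A) (g : THom C B)
    (hc : ∀ p, p ∈ 𝔞 → p ∈ 𝔟 → p ∈ 𝔠) (hI : I = 𝔞 ⊔ 𝔟) :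
    (cone A B C f g hc hI).poly = A.poly + B.poly + Polynomial.X * C.poly := by
  change ∑ i : A.ι ⊕ (B.ι ⊕ C.ι), (Polynomial.X : Polynomial ℕ) ^
    (Sum.elim A.deg (Sum.elim B.deg (fun i => C.deg i + 1)) i) = _
  simp [Fintype.sum_sum_type, TRes.poly, Finset.mul_sum, pow_succ', add_assoc]

theorem Kres_poly (G : Good 𝔪 x y) (H : KData x y I Ix Iy Ixy IK) (X : TRes 𝔪 I) :
    (Kres G H X).poly = (2 + Polynomial.X) * X.poly := by
  rw [Kres, cone_poly]
  change X.poly + X.poly + Polynomial.X * X.poly = _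
  ring

theorem step_poly {J L Jx Jy Jxy KJ Lx Ly Lxy KL N : Ideal S} (G : Good 𝔪 x y)
    (HJ : KData x y J Jx Jy Jxy KJ) (HL : KData x y L Lx Ly Lxy KL)
    (HS : StepData J L KJ KL N)
    {X : TRes 𝔪 J} {Y : TRes 𝔪 L} (f : THom X Y) :
    (step G HJ HL HS f).poly = (1 + Polynomial.X) ^ 2 * X.poly +
      (2 + Polynomial.X) * Y.poly := by
  rw [step, cone_poly, Kres_poly, Kres_poly]
  ring

end TResSec

section Extract
open Matrix

variable {S : Type u} [CommRing S] {𝔪 I : Ideal S}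

/-- basis elements of degree `q` -/
def TRes.piece (X : TRes 𝔪 I) (q : ℕ) : Type := {i : X.ι // X.deg i = q}

noncomputable instance (X : TRes 𝔪 I) (q : ℕ) : Fintype (X.piece q) := by
  classical
  unfold TRes.piece
  infer_instance

theorem TRes.sum_piece (X : TRes 𝔪 I) (q : ℕ) {A : Type*} [AddCommMonoid A] (F : X.ι → A)
    (h : ∀ j, X.deg j ≠ q → F j = 0) : ∑ j, F j = ∑ j : X.piece q, F j.1 := by
  classical
  have h1 : ∑ j, F j = ∑ j ∈ Finset.univ.filter (fun j => X.deg j = q), F j := by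
    symm
    apply Finset.sum_filter_of_ne
    intro j _ hj
    by_contra hne
    exact hj (h j hne)
  rw [h1, Finset.sum_subtype (p := fun j => X.deg j = q) _ (by simp)]
  exact Fintype.sum_equiv (Equiv.refl _) _ _ (fun _ => rfl)

theorem TRes.card_piece (X : TRes 𝔪 I) (q : ℕ) : X.poly.coeff q = Fintype.card (X.piece q) := by
  rw [TRes.poly, Polynomial.finset_sum_coeff,
    X.sum_piece q _ (fun j hj => by rw [Polynomial.coeff_X_pow, if_neg (Ne.symm hj)])]
  simp only [Polynomial.coeff_X_pow]
  rw [Finset.sum_congr rfl (fun j _ => if_pos j.2.symm)]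
  simp

/-- differential in degree `q` -/
noncomputable def TRes.dmap (X : TRes 𝔪 I) (q : ℕ) :
    (X.piece (q + 1) → S) →ₗ[S] (X.piece q → S) :=
  Matrix.mulVecLin (Matrix.of fun i j => X.D i.1 j.1)

theorem TRes.dmap_apply (X : TRes 𝔪 I) (q : ℕ) (v) (i : X.piece q) :
    X.dmap q v i = ∑ j : X.piece (q + 1), X.D i.1 j.1 * v j := by
  simp [TRes.dmap, mulVec, dotProduct]

theorem TRes.dmap_restrict (X : TRes 𝔪 I) (q : ℕ) (v : X.ι → S) (i : X.piece q) :
    X.dmap q (fun j => v j.1) i = (X.D *ᵥ v) i.1 := by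
  rw [X.dmap_apply]
  unfold mulVec dotProduct
  rw [X.sum_piece (q + 1)]
  intro j hj
  have : X.D i.1 j = 0 := by
    by_contra h
    exact hj ((X.D_deg _ _ h).trans (by rw [i.2]))
  change X.D i.1 j * v j = 0
  rw [this, zero_mul]

/-- augmentation -/
noncomputable def TRes.emap (X : TRes 𝔪 I) : (X.piece 0 → S) →ₗ[S] I where
  toFun v := ⟨∑ j : X.piece 0, X.ε j.1 * v j,
    I.sum_mem fun j _ => I.mul_mem_right _ (X.ε_mem _)⟩
  map_add' v w := by
    apply Subtype.ext
    simp [mul_add, Finset.sum_add_distrib]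
  map_smul' c v := by
    apply Subtype.ext
    simp [Finset.mul_sum, mul_left_comm]

theorem TRes.emap_restrict (X : TRes 𝔪 I) (v : X.ι → S) :
    (X.emap (fun j => v j.1) : S) = X.ε ⬝ᵥ v := by
  unfold dotProduct
  rw [X.sum_piece 0]
  · rfl
  · intro j hj
    have : X.ε j = 0 := by
      by_contra h
      exact hj (X.ε_deg _ h)
    rw [this, zero_mul]

open Classical in
/-- extension by zero -/
noncomputable def TRes.ext0 (X : TRes 𝔪 I) {q : ℕ} (v : X.piece q → S) : X.ι → S :=
  fun i => if h : X.deg i = q then v ⟨i, h⟩ else 0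

theorem TRes.ext0_restrict (X : TRes 𝔪 I) {q : ℕ} (v : X.piece q → S) :
    (fun j : X.piece q => X.ext0 v j.1) = v := by
  funext j
  simp only [TRes.ext0]
  rw [dif_pos j.2]
  rfl

theorem TRes.ext0_of_ne (X : TRes 𝔪 I) {q : ℕ} (v : X.piece q → S) {i : X.ι}
    (h : X.deg i ≠ q) : X.ext0 v i = 0 := by
  simp [TRes.ext0, h]

theorem TRes.D_ext0_succ (X : TRes 𝔪 I) {q : ℕ} (v : X.piece (q + 1) → S)
    (h : X.dmap q v = 0) : X.D *ᵥ X.ext0 v = 0 := by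
  funext i
  by_cases hi : X.deg i = q
  · have := X.dmap_restrict q (X.ext0 v) ⟨i, hi⟩
    rw [X.ext0_restrict, h] at this
    exact this.symm
  · unfold mulVec dotProduct
    apply Finset.sum_eq_zero
    intro j _
    change X.D i j * X.ext0 v j = 0
    by_cases hD : X.D i j = 0
    · rw [hD, zero_mul]
    · rw [X.ext0_of_ne v, mul_zero]
      have := X.D_deg _ _ hD
      omega

theorem TRes.D_ext0_zero (X : TRes 𝔪 I) (v : X.piece 0 → S) : X.D *ᵥ X.ext0 v = 0 := by
  funext i
  unfold mulVec dotProduct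
  apply Finset.sum_eq_zero
  intro j _
  change X.D i j * X.ext0 v j = 0
  by_cases hD : X.D i j = 0
  · rw [hD, zero_mul]
  · rw [X.ext0_of_ne v, mul_zero]
    have := X.D_deg _ _ hD
    omega

theorem TRes.ε_ext0_succ (X : TRes 𝔪 I) {q : ℕ} (v : X.piece (q + 1) → S) :
    X.ε ⬝ᵥ X.ext0 v = 0 := by
  unfold dotProduct
  apply Finset.sum_eq_zero
  intro j _
  by_cases hD : X.ε j = 0
  · rw [hD, zero_mul]
  · rw [X.ext0_of_ne v, mul_zero]
    have := X.ε_deg _ hD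
    omega

theorem TRes.dmap_exact (X : TRes 𝔪 I) (q : ℕ) (v : X.piece (q + 1) → S) (h : X.dmap q v = 0) :
    ∃ w, X.dmap (q + 1) w = v := by
  obtain ⟨w, hw⟩ := X.exact _ (X.D_ext0_succ v h) (X.ε_ext0_succ v)
  refine ⟨fun j => w j.1, ?_⟩
  funext i
  rw [X.dmap_restrict, hw]
  exact congrFun (X.ext0_restrict v) i

theorem TRes.dmap_dmap (X : TRes 𝔪 I) (q : ℕ) (w) : X.dmap q (X.dmap (q + 1) w) = 0 := by
  have h1 : X.dmap (q + 1) w = fun j => (X.D *ᵥ X.ext0 w) j.1 := by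
    funext j
    rw [← X.dmap_restrict, X.ext0_restrict]
  funext i
  rw [h1, X.dmap_restrict, X.D_D_vec]
  rfl

theorem TRes.emap_dmap (X : TRes 𝔪 I) (w) : X.emap (X.dmap 0 w) = 0 := by
  have h1 : X.dmap 0 w = fun j => (X.D *ᵥ X.ext0 w) j.1 := by
    funext j
    rw [← X.dmap_restrict, X.ext0_restrict]
  apply Subtype.ext
  rw [h1, X.emap_restrict, X.ε_D_dot]
  rfl

theorem TRes.dmap_mem (X : TRes 𝔪 I) (q : ℕ) (w) (i) : X.dmap q w i ∈ 𝔪 := by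
  rw [X.dmap_apply]
  exact 𝔪.sum_mem fun j _ => 𝔪.mul_mem_right _ (X.D_min _ _)

theorem TRes.HB_ker (X : TRes 𝔪 I) (j : ℕ) : ∀ q,
    HB 𝔪 j (LinearMap.ker (X.dmap q)) (Fintype.card (X.piece (q + 2 + j))) := by
  have cov : ∀ q, IsCover 𝔪 ((X.dmap (q + 1)).codRestrict (LinearMap.ker (X.dmap q))
      (fun w => LinearMap.mem_ker.2 (X.dmap_dmap q w))) := by
    intro q
    constructor
    · rintro ⟨v, hv⟩
      obtain ⟨w, hw⟩ := X.dmap_exact q v hv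
      exact ⟨w, Subtype.ext hw⟩
    · intro v hv i
      obtain ⟨w, rfl⟩ := X.dmap_exact (q + 1) v (congrArg Subtype.val hv)
      exact X.dmap_mem _ _ _
  induction j with
  | zero => exact fun q => ⟨_, _, _, cov q, rfl⟩
  | succ j ih =>
    intro q
    refine ⟨_, inferInstance, _, cov q, ?_⟩
    rw [LinearMap.ker_codRestrict]
    have := ih (q + 1)
    rwa [show q + 1 + 2 + j = q + 2 + (j + 1) by ring] at this

theorem TRes.HB_res (X : TRes 𝔪 I) (j : ℕ) : HB 𝔪 j I (X.poly.coeff j) := by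
  rw [X.card_piece]
  have ex : ∀ v, X.emap v = 0 → ∃ w, X.dmap 0 w = v := by
    intro v hv
    obtain ⟨w, hw⟩ := X.exact _ (X.D_ext0_zero v) (by
      rw [← X.emap_restrict, X.ext0_restrict, hv]; rfl)
    refine ⟨fun j => w j.1, ?_⟩
    funext i
    rw [X.dmap_restrict, hw]
    exact congrFun (X.ext0_restrict v) i
  have cov0 : IsCover 𝔪 X.emap := by
    constructor
    · rintro ⟨g, hg⟩
      obtain ⟨e, _, he⟩ := X.lift g hg
      exact ⟨fun j => e j.1, Subtype.ext ((X.emap_restrict e).trans he)⟩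
    · intro v hv i
      obtain ⟨w, rfl⟩ := ex v hv
      exact X.dmap_mem _ _ _
  have cov1 : IsCover 𝔪 ((X.dmap 0).codRestrict (LinearMap.ker X.emap)
      (fun w => LinearMap.mem_ker.2 (X.emap_dmap w))) := by
    constructor
    · rintro ⟨v, hv⟩
      obtain ⟨w, hw⟩ := ex v hv
      exact ⟨w, Subtype.ext hw⟩
    · intro v hv i
      obtain ⟨w, rfl⟩ := X.dmap_exact 0 v (congrArg Subtype.val hv)
      exact X.dmap_mem _ _ _
  match j with
  | 0 => exact ⟨_, _, _, cov0, rfl⟩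
  | 1 => exact ⟨_, inferInstance, _, cov0, ⟨_, _, _, cov1, rfl⟩⟩
  | j + 2 =>
    refine ⟨_, inferInstance, _, cov0, ⟨_, inferInstance, _, cov1, ?_⟩⟩
    rw [LinearMap.ker_codRestrict]
    have := X.HB_ker j 0
    rwa [show 0 + 2 + j = j + 2 by ring] at this

end Extract

section Mono
open MvPolynomial

variable {k : Type u} [Field k] {σ : Type}

/-- monomial ideal of a set of exponents -/
noncomputable def mono (k : Type u) [Field k] (E : Set (σ →₀ ℕ)) : Ideal (MvPolynomial σ k) :=
  Ideal.span ((fun s => monomial s (1 : k)) '' E)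

theorem mem_mono {E : Set (σ →₀ ℕ)} (hE : IsUpperSet E) (p : MvPolynomial σ k) :
    p ∈ mono k E ↔ ∀ e ∈ p.support, e ∈ E := by
  rw [mono, mem_ideal_span_monomial_image]
  refine forall₂_congr fun e _ => ⟨?_, fun h => ⟨e, h, le_rfl⟩⟩
  rintro ⟨s, hs, hle⟩
  exact hE hle hs

/-- exponents in `E` divisible by `x` -/
def Ex (x : σ) (E : Set (σ →₀ ℕ)) : Set (σ →₀ ℕ) := {e | e x ≠ 0 ∧ e ∈ E}

theorem Ex_upper {x : σ} {E : Set (σ →₀ ℕ)} (hE : IsUpperSet E) : IsUpperSet (Ex x E) := by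
  rintro a b hab ⟨h1, h2⟩
  refine ⟨?_, hE hab h2⟩
  have := hab x
  omega

/-- membership in `E` does not depend on the coordinate `x` -/
def Ind (x : σ) (E : Set (σ →₀ ℕ)) : Prop := ∀ e, e + Finsupp.single x 1 ∈ E → e ∈ E

theorem Ex_ind {x y : σ} (hxy : x ≠ y) {E : Set (σ →₀ ℕ)} (hE : Ind x E) : Ind x (Ex y E) := by
  rintro e ⟨h1, h2⟩
  refine ⟨?_, hE e h2⟩
  simpa [Finsupp.single_apply, hxy] using h1

theorem mem_mono_Ex {x : σ} {E : Set (σ →₀ ℕ)} (hE : IsUpperSet E) (hI : Ind x E)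
    (p : MvPolynomial σ k) : p ∈ mono k (Ex x E) ↔ ∃ r ∈ mono k E, p = X x * r := by
  classical
  rw [mem_mono (Ex_upper hE)]
  constructor
  · intro h
    have hd : X x ∣ p := by
      rw [X_dvd_iff_modMonomial_eq_zero]
      ext e
      rw [coeff_zero]
      by_cases hle : Finsupp.single x 1 ≤ e
      · exact coeff_modMonomial_of_le _ hle
      · rw [coeff_modMonomial_of_not_le _ hle]
        by_contra hc
        apply hle
        have := (h e (mem_support_iff.2 hc)).1
        rw [Finsupp.single_le_iff]
        omega
    obtain ⟨r, rfl⟩ := hd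
    refine ⟨r, (mem_mono hE r).2 ?_, rfl⟩
    intro e he
    apply hI
    rw [add_comm]
    apply (h _ _).2
    rw [mem_support_iff, coeff_X_mul]
    exact mem_support_iff.1 he
  · rintro ⟨r, hr, rfl⟩ e he
    rw [mem_mono hE] at hr
    rw [support_X_mul, Finset.mem_map] at he
    obtain ⟨a, ha, rfl⟩ := he
    refine ⟨by simp, hE ?_ (hr a ha)⟩
    simp

/-- exponents in `E` divisible by `x` or `y` -/
def EK (x y : σ) (E : Set (σ →₀ ℕ)) : Set (σ →₀ ℕ) := Ex x E ∪ Ex y E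

theorem EK_upper {x y : σ} {E : Set (σ →₀ ℕ)} (hE : IsUpperSet E) : IsUpperSet (EK x y E) :=
  (Ex_upper hE).union (Ex_upper hE)

theorem kdata {x y : σ} (hxy : x ≠ y) {E : Set (σ →₀ ℕ)} (hE : IsUpperSet E) (hx : Ind x E)
    (hy : Ind y E) : KData (X x : MvPolynomial σ k) (X y) (mono k E) (mono k (Ex x E))
      (mono k (Ex y E)) (mono k (Ex x (Ex y E))) (mono k (EK x y E)) where
  hx p := mem_mono_Ex hE hx p
  hy p := mem_mono_Ex hE hy p
  hxy p := by
    rw [mem_mono_Ex (Ex_upper hE) (Ex_ind hxy hx)]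
    constructor
    · rintro ⟨r, hr, rfl⟩
      obtain ⟨r', hr', rfl⟩ := (mem_mono_Ex hE hy r).1 hr
      exact ⟨r', hr', (mul_assoc _ _ _).symm⟩
    · rintro ⟨r, hr, rfl⟩
      exact ⟨X y * r, (mem_mono_Ex hE hy _).2 ⟨r, hr, rfl⟩, mul_assoc _ _ _⟩
  hinf p hp hp' := by
    rw [mem_mono (Ex_upper (Ex_upper hE))]
    rw [mem_mono (Ex_upper hE)] at hp hp'
    exact fun e he => ⟨(hp e he).1, hp' e he⟩
  hK := by
    rw [mono, EK, Set.image_union, Ideal.span_union]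
    rfl

theorem stepdata {x y : σ} {J L N : Set (σ →₀ ℕ)} (hJ : IsUpperSet J) (hL : IsUpperSet L)
    (hN : N = J ∪ EK x y L) :
    StepData (mono k J) (mono k L) (mono k (EK x y J)) (mono k (EK x y L)) (mono k N) where
  hinf p hp hp' := by
    rw [mem_mono (EK_upper hJ)]
    rw [mem_mono hJ] at hp
    rw [mem_mono (EK_upper hL)] at hp'
    intro e he
    rcases hp' e he with h | h
    · exact Or.inl ⟨h.1, hp e he⟩
    · exact Or.inr ⟨h.1, hp e he⟩
  hsup := by
    rw [hN, mono, Set.image_union, Ideal.span_union]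
    rfl

theorem good (x y : σ) : Good (Ideal.span (Set.range (X : σ → MvPolynomial σ k))) (X x) (X y) where
  nx p h := (mul_eq_zero.1 h).resolve_left (X_ne_zero x)
  ny p h := (mul_eq_zero.1 h).resolve_left (X_ne_zero y)
  nxy p h := (mul_eq_zero.1 h).resolve_left (mul_ne_zero (X_ne_zero x) (X_ne_zero y))
  mx := Ideal.subset_span ⟨x, rfl⟩
  my := Ideal.subset_span ⟨y, rfl⟩

variable {n : ℕ}

/-- number of blocks among the first `m` which `e` meets -/
def hits (m : ℕ) (e : Fin n × Fin 2 →₀ ℕ) : ℕ :=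
  (Finset.univ.filter fun i : Fin n => i.val < m ∧ (e (i, 0) ≠ 0 ∨ e (i, 1) ≠ 0)).card

/-- exponents of the transversal ideal on the first `m` blocks -/
def ES (n m t : ℕ) : Set (Fin n × Fin 2 →₀ ℕ) := {e | t ≤ hits m e}

theorem ES_upper (m t : ℕ) : IsUpperSet (ES n m t) := by
  intro a b hab (h : t ≤ hits m a)
  refine le_trans h (Finset.card_le_card ?_)
  intro i
  simp only [Finset.mem_filter, Finset.mem_univ, true_and]
  have h0 := hab (i, 0)
  have h1 := hab (i, 1)
  rintro ⟨h2, h3⟩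
  exact ⟨h2, by omega⟩

theorem ES_ind (m t : ℕ) (hm : m < n) (j : Fin 2) : Ind (⟨m, hm⟩, j) (ES n m t) := by
  intro e (h : t ≤ hits m _)
  refine le_trans h (Finset.card_le_card ?_)
  intro i
  simp only [Finset.mem_filter, Finset.mem_univ, true_and]
  rintro ⟨h2, h3⟩
  refine ⟨h2, ?_⟩
  have hne : ¬ (⟨m, hm⟩ : Fin n) = i := by
    rintro rfl
    exact lt_irrefl _ h2
  simpa [Finsupp.single_apply, hne] using h3

theorem hits_succ (m : ℕ) (hm : m < n) (e : Fin n × Fin 2 →₀ ℕ) :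
    hits (m + 1) e = hits m e + if e (⟨m, hm⟩, 0) ≠ 0 ∨ e (⟨m, hm⟩, 1) ≠ 0 then 1 else 0 := by
  unfold hits
  split_ifs with h
  · rw [← Finset.card_insert_of_notMem (a := (⟨m, hm⟩ : Fin n)) (by simp)]
    congr 1
    ext i
    simp only [Finset.mem_filter, Finset.mem_univ, true_and, Finset.mem_insert]
    constructor
    · rintro ⟨h1, h2⟩
      by_cases hi : i.val = m
      · exact Or.inl (Fin.ext hi)
      · exact Or.inr ⟨by omega, h2⟩
    · rintro (rfl | ⟨h1, h2⟩)
      · exact ⟨Nat.lt_succ_self _, h⟩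
      · exact ⟨by omega, h2⟩
  · rw [add_zero]
    congr 1
    ext i
    simp only [Finset.mem_filter, Finset.mem_univ, true_and]
    constructor
    · rintro ⟨h1, h2⟩
      by_cases hi : i.val = m
      · exfalso
        apply h
        have : i = ⟨m, hm⟩ := Fin.ext hi
        rwa [← this]
      · exact ⟨by omega, h2⟩
    · rintro ⟨h1, h2⟩
      exact ⟨by omega, h2⟩

theorem ES_succ (m t : ℕ) (hm : m < n) : ES n (m + 1) (t + 1) =
    ES n m (t + 1) ∪ EK (⟨m, hm⟩, 0) (⟨m, hm⟩, 1) (ES n m t) := by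
  ext e
  simp only [ES, EK, Ex, Set.mem_union, Set.mem_setOf_eq, hits_succ m hm]
  split_ifs with h
  · constructor
    · intro h1
      rcases h with h | h
      · exact Or.inr (Or.inl ⟨h, by omega⟩)
      · exact Or.inr (Or.inr ⟨h, by omega⟩)
    · rintro (h1 | h1 | h1) <;> omega
  · constructor
    · intro h1
      exact Or.inl (by omega)
    · rintro (h1 | h1 | h1)
      · omega
      · exact absurd (Or.inl h1.1) h
      · exact absurd (Or.inr h1.1) h

theorem mono_ES_zero (m : ℕ) : mono k (ES n m 0) = ⊤ := by
  rw [eq_top_iff]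
  intro p _
  rw [mem_mono (ES_upper _ _)]
  intro e _
  exact Nat.zero_le _

theorem mono_ES_empty (t : ℕ) : mono k (ES n 0 (t + 1)) = ⊥ := by
  have : ES n 0 (t + 1) = ∅ := by
    ext e
    simp [ES, hits]
  rw [this, mono]
  simp

theorem mono_ES_le (m t : ℕ) : mono k (ES n m (t + 1)) ≤
    Ideal.span (Set.range (X : Fin n × Fin 2 → MvPolynomial (Fin n × Fin 2) k)) := by
  intro p hp
  rw [mem_mono (ES_upper _ _)] at hp
  rw [← Set.image_univ, mem_ideal_span_X_image]
  intro e he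
  have h : t + 1 ≤ hits m e := hp e he
  have h1 : 0 < hits m e := by omega
  obtain ⟨i, hi⟩ := Finset.card_pos.1 h1
  simp only [Finset.mem_filter, Finset.mem_univ, true_and] at hi
  rcases hi.2 with h | h
  · exact ⟨_, trivial, h⟩
  · exact ⟨_, trivial, h⟩

/-- generating polynomials of the Betti numbers -/
noncomputable def Pp : ℕ → ℕ → Polynomial ℕ
  | _, 0 => 1
  | 0, _ + 1 => 0
  | m + 1, t + 1 => (1 + Polynomial.X) ^ 2 * Pp m (t + 1) + (2 + Polynomial.X) * Pp m t

theorem stage (m : ℕ) (hm : m ≤ n) :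
    ∃ (R : ∀ t, TRes (Ideal.span (Set.range (X : Fin n × Fin 2 → MvPolynomial (Fin n × Fin 2) k)))
      (mono k (ES n m t))) (_ : ∀ t, THom (R (t + 1)) (R t)), ∀ t, (R t).poly = Pp m t := by
  induction m with
  | zero =>
    refine ⟨fun t => match t with
      | 0 => unitRes (mono_ES_zero 0)
      | t + 1 => zeroRes (mono_ES_empty t), fun t => zeroHom (mono_ES_empty t) _, ?_⟩
    intro t
    match t with
    | 0 =>
      change ∑ i : Unit, (Polynomial.X : Polynomial ℕ) ^ 0 = 1
      simp
    | t + 1 =>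
      change ∑ i : Empty, (Polynomial.X : Polynomial ℕ) ^ 0 = 0
      simp
  | succ m ih =>
    obtain ⟨R, φ, hP⟩ := ih (by omega)
    have hm' : m < n := hm
    have hne : ((⟨m, hm'⟩, 0) : Fin n × Fin 2) ≠ (⟨m, hm'⟩, 1) := by simp
    have G := good (k := k) ((⟨m, hm'⟩, 0) : Fin n × Fin 2) (⟨m, hm'⟩, 1)
    have K := fun t => kdata (k := k) hne (ES_upper m t) (ES_ind m t hm' 0) (ES_ind m t hm' 1)
    have SD := fun t => stepdata (k := k) (ES_upper m (t + 1)) (ES_upper m t) (ES_succ m t hm')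
    refine ⟨fun t => match t with
      | 0 => unitRes (mono_ES_zero (m + 1))
      | t + 1 => step G (K (t + 1)) (K t) (SD t) (φ t), fun t => match t with
      | 0 => augHom _ (mono_ES_le _ _) _
      | t + 1 => stepMap G (K (t + 2)) (K (t + 1)) (K t) (SD (t + 1)) (SD t) (φ (t + 1)) (φ t), ?_⟩
    intro t
    match t with
    | 0 =>
      change ∑ i : Unit, (Polynomial.X : Polynomial ℕ) ^ 0 = _
      simp [Pp]
    | t + 1 =>
      change (step G (K (t + 1)) (K t) (SD t) (φ t)).poly = _
      rw [step_poly, hP, hP, Pp]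

theorem ideal_eq (t : ℕ) :
    Ideal.span {p : MvPolynomial (Fin n × Fin 2) k |
        ∃ T : Finset (Fin n), T.card = t ∧
          ∃ j : Fin n → Fin 2,
            p = MvPolynomial.monomial (∑ i ∈ T, Finsupp.single (i, j i) 1) 1} =
      mono k (ES n n t) := by
  classical
  have hset : {p : MvPolynomial (Fin n × Fin 2) k |
        ∃ T : Finset (Fin n), T.card = t ∧
          ∃ j : Fin n → Fin 2,
            p = MvPolynomial.monomial (∑ i ∈ T, Finsupp.single (i, j i) 1) 1} =
      (fun s => monomial s (1 : k)) '' {s | ∃ T : Finset (Fin n), T.card = t ∧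
          ∃ j : Fin n → Fin 2, s = ∑ i ∈ T, Finsupp.single (i, j i) 1} := by
    ext p
    constructor
    · rintro ⟨T, hT, j, rfl⟩
      exact ⟨_, ⟨T, hT, j, rfl⟩, rfl⟩
    · rintro ⟨_, ⟨T, hT, j, rfl⟩, rfl⟩
      exact ⟨T, hT, j, rfl⟩
  have hval : ∀ (T : Finset (Fin n)) (j : Fin n → Fin 2) (i : Fin n) (c : Fin 2),
      (∑ i ∈ T, Finsupp.single (i, j i) 1 : Fin n × Fin 2 →₀ ℕ) (i, c) =
        if i ∈ T ∧ j i = c then 1 else 0 := by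
    intro T j i c
    rw [Finsupp.finset_sum_apply]
    simp only [Finsupp.single_apply, Prod.mk.injEq]
    split_ifs with h
    · rw [Finset.sum_eq_single i]
      · simp [h.2]
      · intro b _ hb
        simp [hb]
      · intro hi
        exact absurd h.1 hi
    · apply Finset.sum_eq_zero
      intro b hb
      rw [if_neg]
      rintro ⟨rfl, h2⟩
      exact h ⟨hb, h2⟩
  rw [hset]
  ext p
  rw [mem_mono (ES_upper _ _), mem_ideal_span_monomial_image]
  refine forall₂_congr fun e _ => ?_
  constructor
  · rintro ⟨_, ⟨T, rfl, j, rfl⟩, hle⟩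
    refine Finset.card_le_card ?_
    intro i hi
    simp only [Finset.mem_filter, Finset.mem_univ, true_and]
    refine ⟨i.2, ?_⟩
    have h1 := hle (i, j i)
    rw [hval, if_pos ⟨hi, rfl⟩] at h1
    generalize j i = c at h1
    fin_cases c
    · left; simp at h1; omega
    · right; simp at h1; omega
  · intro (h : t ≤ hits n e)
    obtain ⟨T, hT, hc⟩ := Finset.exists_subset_card_eq h
    refine ⟨_, ⟨T, hc, fun i => if e (i, 0) ≠ 0 then 0 else 1, rfl⟩, ?_⟩
    rintro ⟨i, c⟩
    rw [hval]
    by_cases h1 : i ∈ T ∧ (if e (i, 0) ≠ 0 then (0 : Fin 2) else 1) = c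
    · rw [if_pos h1]
      obtain ⟨h1, rfl⟩ := h1
      have := hT h1
      simp only [Finset.mem_filter, Finset.mem_univ, true_and] at this
      by_cases h2 : e (i, 0) ≠ 0
      · rw [if_pos h2]
        omega
      · rw [if_neg h2]
        have := this.2.resolve_left h2
        omega
    · rw [if_neg h1]
      exact Nat.zero_le _

end Mono

section Count
open Polynomial

/-- `binom(s-1,t-1)` with the convention at zero -/
def cc : ℕ → ℕ → ℕ
  | 0, 0 => 1
  | 0, _ + 1 => 0
  | _ + 1, 0 => 0
  | s + 1, t + 1 => cc s (t + 1) + cc s t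

theorem cc_eq (s t : ℕ) : cc (s + 1) (t + 1) = s.choose t := by
  induction s generalizing t with
  | zero => cases t <;> simp [cc]
  | succ s ih =>
    rw [cc]
    cases t with
    | zero => rw [ih]; simp [cc]
    | succ t => rw [ih, ih, Nat.choose_succ_succ, add_comm]

theorem Pp_formula (m t : ℕ) : (X : ℕ[X]) ^ t * Pp m t =
    ∑ s ∈ Finset.range (m + 1), C (cc s t * m.choose s) * (X * (X + C 2)) ^ s := by
  induction m generalizing t with
  | zero => cases t <;> simp [Pp, cc]
  | succ m ih =>
    cases t with
    | zero =>
      rw [Finset.sum_range_succ']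
      simp [Pp, cc]
    | succ t =>
      set u : ℕ[X] := X * (X + C 2) with hu
      have h1 : (X : ℕ[X]) ^ (t + 1) * Pp (m + 1) (t + 1) =
          (X ^ (t + 1) * Pp m (t + 1)) + u * (X ^ (t + 1) * Pp m (t + 1) + X ^ t * Pp m t) := by
        rw [Pp, hu, show (C 2 : ℕ[X]) = 2 from rfl]
        ring
      have h2 : ∑ s ∈ Finset.range (m + 1), C (cc s (t + 1) * m.choose s) * u ^ s =
          ∑ s ∈ Finset.range (m + 1), C (cc (s + 1) (t + 1) * m.choose (s + 1)) * u ^ (s + 1) := by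
        have := Finset.sum_range_succ' (fun s => C (cc s (t + 1) * m.choose s) * u ^ s) (m + 1)
        rw [Finset.sum_range_succ] at this
        simpa [cc] using this
      rw [h1, ih, ih, ← Finset.sum_add_distrib, Finset.mul_sum, h2, ← Finset.sum_add_distrib,
        Finset.sum_range_succ' _ (m + 1)]
      simp only [cc, zero_mul, map_zero, add_zero]
      refine Finset.sum_congr rfl fun s _ => ?_
      rw [Nat.choose_succ_succ]
      simp only [map_add, map_mul]
      ring

theorem Pp_coeff (n t q : ℕ) (ht : 1 ≤ t) : (Pp n t).coeff q =
    ∑ s ∈ Finset.Icc t (t + q), (s - 1).choose (t - 1) * n.choose s *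
          s.choose (t + q - s) * 2 ^ (2 * s - (t + q)) := by
  obtain ⟨t, rfl⟩ : ∃ t', t = t' + 1 := ⟨t - 1, by omega⟩
  have h0 : (Pp n (t + 1)).coeff q = ((X : ℕ[X]) ^ (t + 1) * Pp n (t + 1)).coeff (t + 1 + q) := by
    rw [add_comm (t + 1) q, coeff_X_pow_mul]
  have hterm : ∀ s, (C (cc s (t + 1) * n.choose s) * (X * (X + C 2)) ^ s : ℕ[X]).coeff (t + 1 + q) =
      if s ∈ Finset.Icc (t + 1) (t + 1 + q) then (s - 1).choose t * n.choose s *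
          s.choose (t + 1 + q - s) * 2 ^ (2 * s - (t + 1 + q)) else 0 := by
    intro s
    rw [coeff_C_mul, mul_pow, coeff_X_pow_mul']
    simp only [Finset.mem_Icc]
    rcases s with _ | s
    · simp [cc]
    · rw [cc_eq]
      by_cases h1 : t ≤ s
      · by_cases h2 : s + 1 ≤ t + 1 + q
        · rw [if_pos h2, if_pos ⟨by omega, h2⟩, coeff_X_add_C_pow,
            show s + 1 - (t + 1 + q - (s + 1)) = 2 * (s + 1) - (t + 1 + q) by omega]
          simp only [Nat.cast_id, Nat.add_sub_cancel]
          ring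
        · rw [if_neg h2, if_neg (by omega), mul_zero]
      · rw [Nat.choose_eq_zero_of_lt (show s < t by omega),
          if_neg (show ¬ (t + 1 ≤ s + 1 ∧ s + 1 ≤ t + 1 + q) by omega)]
        simp
  rw [h0, Pp_formula, finset_sum_coeff, Finset.sum_congr rfl (fun s _ => hterm s),
    Nat.add_sub_cancel, ← Finset.sum_filter]
  apply Finset.sum_subset
  · intro s hs
    exact (Finset.mem_filter.1 hs).2
  · intro s hs hs'
    have : n < s := by
      by_contra hlt
      exact hs' (Finset.mem_filter.2 ⟨Finset.mem_range.2 (by omega), hs⟩)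
    rw [Nat.choose_eq_zero_of_lt this]
    simp

end Count

theorem ker_constantCoeff {k : Type u} [Field k] {σ : Type} :
    Ideal.span (Set.range (MvPolynomial.X : σ → MvPolynomial σ k)) =
      RingHom.ker (MvPolynomial.constantCoeff : MvPolynomial σ k →+* k) := by
  ext p
  rw [← Set.image_univ, MvPolynomial.mem_ideal_span_X_image, RingHom.mem_ker,
    MvPolynomial.constantCoeff_eq]
  constructor
  · intro h
    by_contra hc
    obtain ⟨i, _, hi⟩ := h 0 (MvPolynomial.mem_support_iff.2 hc)
    exact hi rfl
  · intro h e he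
    by_contra hc
    push Not at hc
    have : e = 0 := by
      ext i
      exact hc i trivial
    subst this
    exact MvPolynomial.mem_support_iff.1 he h

end TB

/-- Proposition 2.4 in the case `b_1 = ⋯ = b_n = 2`. The transversal monomial ideal
`I_t(D)` lives in `k[y_{i,j} : 1 ≤ i ≤ n, 1 ≤ j ≤ 2]` and is generated by the monomials
`y_{i_1,j_1}⋯y_{i_t,j_t}` with `i_1 < ⋯ < i_t`. Then
`β_q(I_t(D)) = ∑_{s=t}^{t+q} C(s−1, t−1)·C(n, s)·C(s, t+q−s)·2^(2s−t−q)`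
(binomial coefficients with out-of-range arguments being `0`). -/
theorem betti_transversal_two_blocks {k : Type*} [Field k] (n t : ℕ)
    (ht : 1 ≤ t) (htn : t ≤ n)
    (F : MinimalFreeResolution (MvPolynomial (Fin n × Fin 2) k)
      (Ideal.span (Set.range MvPolynomial.X))
      (Ideal.span {p : MvPolynomial (Fin n × Fin 2) k |
        ∃ T : Finset (Fin n), T.card = t ∧
          ∃ j : Fin n → Fin 2,
            p = MvPolynomial.monomial (∑ i ∈ T, Finsupp.single (i, j i) 1) 1}))
    (q : ℕ) :
    F.β q
      = ∑ s ∈ Finset.Icc t (t + q), (s - 1).choose (t - 1) * n.choose s *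
          s.choose (t + q - s) * 2 ^ (2 * s - (t + q)) := by
  classical
  obtain ⟨R, _, hP⟩ := TB.stage (k := k) n (le_refl n)
  have h1 := TB.HB_of_res q F
  have h2 := (R t).HB_res q
  rw [hP, TB.Pp_coeff n t q ht, ← TB.ideal_eq] at h2
  generalize F.β q = b at h1 ⊢
  rw [TB.ker_constantCoeff] at h1 h2
  exact TB.HB_unique
    (MvPolynomial.constantCoeff : MvPolynomial (Fin n × Fin 2) k →+* k)
    (fun c => ⟨MvPolynomial.C c, MvPolynomial.constantCoeff_C _ c⟩) q _ _ Empty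
    (LinearEquiv.refl _ _) _ _ h1 h2
end
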